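/- Let X be a Borel subset of the Cantor space 2^ω that is dense in 2^ω, such that the subspace X is homogeneous and X ∉ Δ. Then for every nonempty clopen subset U of 2^ω there exists a homeomorphism h : 2^ω → U such that h[X] = U ∩ X. -/

import Mathlib

open Set

abbrev Cantor := ℕ → Bool

def UpwardClosed (S : Set Cantor) : Prop :=
  ∀ x ∈ S, ∀ y : Cantor, (∀ n, x n = true → y n = true) → y ∈ S

def DownwardClosed (R : Set Cantor) : Prop :=
  ∀ y ∈ R, ∀ x : Cantor, (∀ n, x n = true → y n = true) → x ∈ R

def ClosedUnderFinMod (S : Set Cantor) : Prop :=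
  ∀ x ∈ S, ∀ y : Cantor, {n | x n ≠ y n}.Finite → y ∈ S

def IsSemifilter (S : Set Cantor) : Prop :=
  (fun _ => false) ∉ S ∧ (fun _ => true) ∈ S ∧ UpwardClosed S ∧ ClosedUnderFinMod S

def IsSemiideal (R : Set Cantor) : Prop :=
  (fun _ => false) ∈ R ∧ (fun _ => true) ∉ R ∧ DownwardClosed R ∧ ClosedUnderFinMod R

def ClosedUnderInter (S : Set Cantor) : Prop :=
  ∀ x ∈ S, ∀ y ∈ S, (fun n => x n && y n) ∈ S

def IsFilterOnOmega (F : Set Cantor) : Prop := IsSemifilter F ∧ ClosedUnderInter F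

def IsHomogeneous (X : Type*) [TopologicalSpace X] : Prop :=
  ∀ x y : X, ∃ h : X ≃ₜ X, h x = y

def IsFsigma (A : Set Cantor) : Prop :=
  ∃ F : ℕ → Set Cantor, (∀ n, IsClosed (F n)) ∧ A = ⋃ n, F n

def DOmegaSigmaTwo (X : Set Cantor) : Prop :=
  ∃ A : ℕ → Set Cantor, (∀ n, IsFsigma (A n)) ∧ Monotone A ∧
    X = ⋃ n ∈ {n : ℕ | Odd n}, (A n \ ⋃ m < n, A m)

def InDelta (X : Set Cantor) : Prop := DOmegaSigmaTwo X ∧ DOmegaSigmaTwo Xᶜ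

def WadgeLe (A B : Set Cantor) : Prop :=
  ∃ f : Cantor → Cantor, Continuous f ∧ A = f ⁻¹' B

def WadgeEquiv (A B : Set Cantor) : Prop := WadgeLe A B ∧ WadgeLe B A

def CompletelyMetrizable (X : Type*) [t : TopologicalSpace X] : Prop :=
  ∃ m : MetricSpace X, m.toUniformSpace.toTopologicalSpace = t ∧
    @CompleteSpace X m.toUniformSpace

def FirstCategory (X : Type*) [TopologicalSpace X] : Prop :=
  ∃ f : ℕ → Set X, (∀ n, interior (closure (f n)) = ∅) ∧ (Set.univ : Set X) = ⋃ n, f n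

def CantorFin : Set Cantor := {x | {n | x n = true}.Finite}

def BorelSet (X : Set Cantor) : Prop := @MeasurableSet Cantor (borel Cantor) X
namespace BD

structure GT where
  Pos : Type
  lev : Pos → ℕ
  par : Pos → Pos
  lev_par : ∀ p, lev (par p) = lev p - 1
  ex : ∀ p, ∃ c, lev c = lev p + 1 ∧ par c = p

namespace GT
variable (G : GT)

def Child (p c : G.Pos) : Prop := G.lev c = G.lev p + 1 ∧ G.par c = p
def Play (x : ℕ → G.Pos) : Prop := (∀ n, G.lev (x n) = n) ∧ ∀ n, G.par (x (n+1)) = x n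
def Strat (s : G.Pos → G.Pos) : Prop := ∀ p, G.Child p (s p)
def Follows (b : Bool) (s : G.Pos → G.Pos) (x : ℕ → G.Pos) : Prop :=
  ∀ n, n.bodd = b → x (n+1) = s (x n)
def anc (p : G.Pos) (m : ℕ) : G.Pos := G.par^[G.lev p - m] p

variable {G}

theorem lev_iter (p : G.Pos) (i : ℕ) : G.lev (G.par^[i] p) = G.lev p - i := by
  induction i with
  | zero => rfl
  | succ i ih => rw [Function.iterate_succ_apply', G.lev_par, ih]; omega

theorem lev_anc (p : G.Pos) {m : ℕ} (h : m ≤ G.lev p) : G.lev (G.anc p m) = m := by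
  unfold anc; rw [lev_iter]; omega

theorem anc_of_le (p : G.Pos) {m : ℕ} (h : G.lev p ≤ m) : G.anc p m = p := by
  unfold anc; rw [Nat.sub_eq_zero_of_le h]; rfl

theorem anc_par (p : G.Pos) {m : ℕ} (h : m < G.lev p) : G.anc (G.par p) m = G.anc p m := by
  unfold anc; rw [G.lev_par, ← Function.iterate_succ_apply]; congr 1; omega

theorem par_anc (p : G.Pos) {m : ℕ} (h : m < G.lev p) : G.par (G.anc p (m+1)) = G.anc p m := by
  unfold anc; rw [← Function.iterate_succ_apply' G.par]; congr 1; omega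

theorem anc_anc (p : G.Pos) {m n : ℕ} (h : m ≤ n) : G.anc (G.anc p n) m = G.anc p m := by
  unfold anc; rw [lev_iter, ← Function.iterate_add_apply]; congr 1; omega

theorem Child.lev {p c : G.Pos} (h : G.Child p c) : G.lev c = G.lev p + 1 := h.1
theorem Child.anc {p c : G.Pos} (h : G.Child p c) {m : ℕ} (hm : m ≤ G.lev p) :
    G.anc c m = G.anc p m := by
  rw [← anc_par c (by rw [h.1]; omega), h.2]

theorem child_par {c : G.Pos} (h : 0 < G.lev c) : G.Child (G.par c) c :=
  ⟨by rw [G.lev_par]; omega, rfl⟩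

theorem child_anc (p : G.Pos) {m : ℕ} (h : m < G.lev p) : G.Child (G.anc p m) (G.anc p (m+1)) :=
  ⟨by rw [lev_anc p h, lev_anc p h.le], par_anc p h⟩

theorem Play.child {x : ℕ → G.Pos} (h : G.Play x) (n : ℕ) : G.Child (x n) (x (n+1)) :=
  ⟨by rw [h.1, h.1], h.2 n⟩

theorem Play.anc {x : ℕ → G.Pos} (h : G.Play x) {m n : ℕ} (hm : m ≤ n) : G.anc (x n) m = x m := by
  induction n, hm using Nat.le_induction with
  | base => exact anc_of_le _ (by rw [h.1])
  | succ n hn ih => rw [(h.child n).anc (by rw [h.1]; exact hn), ih]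

/-- positions are determined by eventual match -/
theorem Child.ext {p q c : G.Pos} (h : G.Child p c) (h' : G.Child q c) : p = q := by
  rw [← h.2, ← h'.2]

variable (G) in
noncomputable def dflt (p : G.Pos) : G.Pos := (G.ex p).choose
theorem dflt_child (p : G.Pos) : G.Child p (G.dflt p) := (G.ex p).choose_spec

open Classical in
variable (G) in
noncomputable def guard (p c : G.Pos) : G.Pos := if G.Child p c then c else G.dflt p
theorem guard_child (p c : G.Pos) : G.Child p (G.guard p c) := by
  unfold guard; split_ifs with h
  · exact h
  · exact dflt_child p
theorem guard_of {p c : G.Pos} (h : G.Child p c) : G.guard p c = c := by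
  unfold guard; rw [if_pos h]

/-- build play from strategies -/
theorem exists_play_of_strat (s : G.Pos → G.Pos) (hs : G.Strat s) (r : G.Pos) (hr : G.lev r = 0) :
    ∃ x, G.Play x ∧ x 0 = r ∧ ∀ n, x (n+1) = s (x n) := by
  let x : ℕ → G.Pos := fun n => s^[n] r
  have hx : ∀ n, x (n+1) = s (x n) := fun n => Function.iterate_succ_apply' s n r
  refine ⟨x, ⟨fun n => ?_, fun n => ?_⟩, rfl, hx⟩
  · induction n with
    | zero => exact hr
    | succ n ih => rw [hx, (hs _).1, ih]
  · rw [hx, (hs _).2]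

end GT

open BD.GT

/-! attractors -/
inductive WR (G : GT) (b : Bool) (S U : Set G.Pos) : Ordinal.{0} → G.Pos → Prop
  | base (α : Ordinal.{0}) (p : G.Pos) : p ∈ U → WR G b S U α p
  | mine (α β : Ordinal.{0}) (p c : G.Pos) : (G.lev p).bodd = b → G.Child p c → c ∈ S → β < α →
      WR G b S U β c → WR G b S U α p
  | opp (α : Ordinal.{0}) (p : G.Pos) (f : G.Pos → Ordinal.{0}) : (G.lev p).bodd ≠ b →
      (∀ c, G.Child p c → c ∈ S → f c < α) →
      (∀ c, G.Child p c → c ∈ S → WR G b S U (f c) c) → WR G b S U α p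

structure Att (G : GT) (b : Bool) (S U W : Set G.Pos) (rk : G.Pos → Ordinal.{0})
    (τ : G.Pos → G.Pos) : Prop where
  sub : U ⊆ W
  out_mine : ∀ p, p ∉ W → (G.lev p).bodd = b → ∀ c, G.Child p c → c ∈ S → c ∉ W
  out_opp : ∀ p, p ∉ W → (G.lev p).bodd ≠ b → ∃ c, G.Child p c ∧ c ∈ S ∧ c ∉ W
  in_mine : ∀ p, p ∈ W → p ∉ U → (G.lev p).bodd = b →
    G.Child p (τ p) ∧ τ p ∈ S ∧ τ p ∈ W ∧ rk (τ p) < rk p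
  in_opp : ∀ p, p ∈ W → p ∉ U → (G.lev p).bodd ≠ b →
    ∀ c, G.Child p c → c ∈ S → c ∈ W ∧ rk c < rk p

theorem exists_att (G : GT) (b : Bool) (S U : Set G.Pos) : ∃ W rk τ, Att G b S U W rk τ := by
  classical
  let W : Set G.Pos := {p | ∃ α, WR G b S U α p}
  let rk : G.Pos → Ordinal.{0} := fun p => sInf {α | WR G b S U α p}
  have hrk : ∀ p ∈ W, WR G b S U (rk p) p := fun p hp => csInf_mem (s := {α | WR G b S U α p}) hp
  have hle : ∀ p α, WR G b S U α p → rk p ≤ α := fun p α h => csInf_le' h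
  have hmine : ∀ p, p ∈ W → p ∉ U → (G.lev p).bodd = b →
      ∃ c, G.Child p c ∧ c ∈ S ∧ c ∈ W ∧ rk c < rk p := by
    intro p hp hU hb
    cases hrk p hp with
    | base _ _ h => exact (hU h).elim
    | mine _ β _ c _ h1 h2 h3 h4 => exact ⟨c, h1, h2, ⟨β, h4⟩, (hle _ _ h4).trans_lt h3⟩
    | opp _ _ f h => exact (h hb).elim
  refine ⟨W, rk, fun p => if h : p ∈ W ∧ p ∉ U ∧ (G.lev p).bodd = b then
    (hmine p h.1 h.2.1 h.2.2).choose else p, ?_, ?_, ?_, ?_, ?_⟩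
  · intro p hp; exact ⟨0, WR.base _ _ hp⟩
  · rintro p hp hb c hc hS ⟨β, hβ⟩
    exact hp ⟨β + 1, WR.mine _ β p c hb hc hS (by simp) hβ⟩
  · intro p hp hb
    by_contra hcon
    push Not at hcon
    apply hp
    refine ⟨(⨆ c, (rk c + 1)), WR.opp _ p rk hb ?_ ?_⟩
    · intro c _ _
      have : rk c + 1 ≤ ⨆ c, (rk c + 1) := Ordinal.le_iSup (fun c => rk c + 1) c
      exact (Order.lt_add_one_iff.2 le_rfl).trans_le this
    · intro c hc hS
      exact hrk c (hcon c hc hS)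
  · intro p h1 h2 h3
    have h : p ∈ W ∧ p ∉ U ∧ (G.lev p).bodd = b := ⟨h1, h2, h3⟩
    simp only [dif_pos h]
    exact (hmine p h.1 h.2.1 h.2.2).choose_spec
  · intro p h1 h2 h3 c hc hS
    cases hrk p h1 with
    | base _ _ h => exact (h2 h).elim
    | mine _ β _ c h => exact (h3 h).elim
    | opp _ _ f h h4 h5 => exact ⟨⟨_, h5 c hc hS⟩, (hle _ _ (h5 c hc hS)).trans_lt (h4 c hc hS)⟩

noncomputable def attW (G : GT) (b : Bool) (S U : Set G.Pos) : Set G.Pos := (exists_att G b S U).choose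
noncomputable def attRk (G : GT) (b : Bool) (S U : Set G.Pos) : G.Pos → Ordinal.{0} :=
  (exists_att G b S U).choose_spec.choose
noncomputable def attT (G : GT) (b : Bool) (S U : Set G.Pos) : G.Pos → G.Pos :=
  (exists_att G b S U).choose_spec.choose_spec.choose
theorem att_spec (G : GT) (b : Bool) (S U : Set G.Pos) :
    Att G b S U (attW G b S U) (attRk G b S U) (attT G b S U) :=
  (exists_att G b S U).choose_spec.choose_spec.choose_spec

theorem Att.reach {G : GT} {b : Bool} {S U W : Set G.Pos} {rk τ} (h : Att G b S U W rk τ)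
    {x : ℕ → G.Pos} (hx : G.Play x) (N : ℕ) (hxS : ∀ n, N < n → x n ∈ S)
    (hτ : ∀ n, N ≤ n → n.bodd = b → x n ∈ W → x n ∉ U → x (n+1) = τ (x n))
    (n0 : ℕ) (hn0 : N ≤ n0) (hW : x n0 ∈ W) : ∃ n, n0 ≤ n ∧ x n ∈ U := by
  generalize hr : rk (x n0) = α
  induction α using WellFoundedLT.induction generalizing n0 with
  | ind α ih =>
    by_cases hU : x n0 ∈ U
    · exact ⟨n0, le_rfl, hU⟩
    have hlev := hx.1 n0
    have key : x (n0+1) ∈ W ∧ rk (x (n0+1)) < rk (x n0) := by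
      by_cases hb : n0.bodd = b
      · have := h.in_mine (x n0) hW hU (by rw [hlev]; exact hb)
        rw [hτ n0 hn0 hb hW hU]; exact this.2.2
      · exact h.in_opp (x n0) hW hU (by rw [hlev]; exact hb) _ (hx.child n0) (hxS _ (by omega))
    obtain ⟨n, hn, hnU⟩ := ih _ (hr ▸ key.2) (n0+1) (by omega) key.1 rfl
    exact ⟨n, by omega, hnU⟩

/-! coverings -/
structure Cov (k : ℕ) (G' G : GT) where
  π : G'.Pos → G.Pos
  lev_π : ∀ p, G.lev (π p) = G'.lev p
  par_π : ∀ p, 0 < G'.lev p → G.par (π p) = π (G'.par p)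
  inj : ∀ p q, G'.lev p ≤ k → G'.lev q ≤ k → π p = π q → p = q
  surj : ∀ q, G.lev q ≤ k → ∃ p, π p = q
  φ : Bool → (G'.Pos → G'.Pos) → G.Pos → G.Pos
  strat : ∀ b s, G'.Strat s → G.Strat (φ b s)
  loc : ∀ b s t m, G'.Strat s → G'.Strat t → (∀ p, G'.lev p < m → s p = t p) →
    ∀ p, G.lev p < m → φ b s p = φ b t p
  agree : ∀ b s p, G'.Strat s → G'.lev p < k → φ b s (π p) = π (s p)
  lift : ∀ b s x, G'.Strat s → G.Play x → G.Follows b (φ b s) x →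
    ∃ y, G'.Play y ∧ G'.Follows b s y ∧ ∀ n, π (y n) = x n

namespace Cov
variable {k : ℕ} {G G' G'' : GT}

theorem π_child (c : Cov k G' G) {p q : G'.Pos} (h : G'.Child p q) : G.Child (c.π p) (c.π q) :=
  ⟨by rw [c.lev_π, c.lev_π, h.1], by rw [c.par_π _ (by rw [h.1]; omega), h.2]⟩

theorem π_play (c : Cov k G' G) {x : ℕ → G'.Pos} (h : G'.Play x) : G.Play (fun n => c.π (x n)) :=
  ⟨fun n => by rw [c.lev_π, h.1], fun n => (c.π_child (h.child n)).2⟩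

def id (k : ℕ) (G : GT) : Cov k G G where
  π := fun p => p
  lev_π := fun _ => rfl
  par_π := fun _ _ => rfl
  inj := fun _ _ _ _ h => h
  surj := fun q _ => ⟨q, rfl⟩
  φ := fun _ s => s
  strat := fun _ _ h => h
  loc := fun _ _ _ _ _ _ h => h
  agree := fun _ _ _ _ _ => rfl
  lift := fun _ _ x _ h h' => ⟨x, h, h', fun _ => rfl⟩

def comp (c' : Cov k G'' G') (c : Cov k G' G) : Cov k G'' G where
  π := fun p => c.π (c'.π p)
  lev_π := fun p => by rw [c.lev_π, c'.lev_π]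
  par_π := fun p h => by rw [c.par_π _ (by rw [c'.lev_π]; exact h), c'.par_π _ h]
  inj := fun p q hp hq h => c'.inj _ _ hp hq (c.inj _ _ (by rwa [c'.lev_π]) (by rwa [c'.lev_π]) h)
  surj := fun q hq => by
    obtain ⟨p, hp⟩ := c.surj q hq
    obtain ⟨r, hr⟩ := c'.surj p (by rw [← c.lev_π, hp]; exact hq)
    exact ⟨r, by rw [hr, hp]⟩
  φ := fun b s => c.φ b (c'.φ b s)
  strat := fun b s h => c.strat _ _ (c'.strat _ _ h)
  loc := fun b s t m hs ht h => c.loc b _ _ m (c'.strat _ _ hs) (c'.strat _ _ ht)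
    (c'.loc b s t m hs ht h)
  agree := fun b s p hs hp => by
    rw [c.agree _ _ _ (c'.strat _ _ hs) (by rwa [c'.lev_π]), c'.agree _ _ _ hs hp]
  lift := fun b s x hs hx hf => by
    obtain ⟨y, hy, hyf, hyx⟩ := c.lift b _ x (c'.strat _ _ hs) hx hf
    obtain ⟨z, hz, hzf, hzy⟩ := c'.lift b s y hs hy hyf
    exact ⟨z, hz, hzf, fun n => by rw [hzy, hyx]⟩

def weaken {k' : ℕ} (h : k' ≤ k) (c : Cov k G' G) : Cov k' G' G :=
  { c with
    inj := fun p q hp hq => c.inj p q (hp.trans h) (hq.trans h)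
    surj := fun q hq => c.surj q (hq.trans h)
    agree := fun b s p hs hp => c.agree b s p hs (hp.trans_le h) }

end Cov
end BD
namespace BD
open BD.GT

section unravel
variable (G : GT) (K : ℕ) (U0 : Set G.Pos)

def QI (a : G.Pos) (S : Set G.Pos) : Prop :=
  a ∈ S ∧ ∀ r ∈ S, K + 1 ≤ G.lev r ∧ G.anc r (K+1) = a ∧
    ((G.lev r).bodd = true → ∀ c, G.Child r c → c ∈ S) ∧
    ((G.lev r).bodd = false → ∃ c, G.Child r c ∧ c ∈ S)

def QII (b : G.Pos) (S S2 : Set G.Pos) : Prop :=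
  b ∈ S2 ∧ S2 ⊆ S ∧ (∀ r ∈ S2, r ∉ U0) ∧ ∀ r ∈ S2, K + 2 ≤ G.lev r ∧
    (K + 2 < G.lev r → G.par r ∈ S2) ∧
    ((G.lev r).bodd = true → ∃ c, G.Child r c ∧ c ∈ S2) ∧
    ((G.lev r).bodd = false → ∀ c, G.Child r c → c ∈ S → c ∈ S2)

def Comp (p u : G.Pos) : Prop :=
  (G.lev p ≤ G.lev u → G.anc u (G.lev p) = p) ∧ (G.lev u ≤ G.lev p → G.anc p (G.lev u) = u)

abbrev Raw := G.Pos × Set G.Pos × Option (G.Pos ⊕ Set G.Pos)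

def Valid (t : Raw G) : Prop :=
  (G.lev t.1 ≤ K ∧ t.2.1 = ∅ ∧ t.2.2 = none) ∨
  (G.lev t.1 = K + 1 ∧ t.2.2 = none ∧ QI G K t.1 t.2.1) ∨
  (K + 2 ≤ G.lev t.1 ∧ QI G K (G.anc t.1 (K+1)) t.2.1 ∧
    ((∃ u, t.2.2 = some (.inl u) ∧ u ∈ t.2.1 ∧ u ∈ U0 ∧ Comp G t.1 u) ∨
     (∃ S2, t.2.2 = some (.inr S2) ∧ QII G K U0 (G.anc t.1 (K+2)) t.2.1 S2 ∧ t.1 ∈ S2)))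

open Classical in
noncomputable def rpar (t : Raw G) : Raw G :=
  (G.par t.1, if G.lev t.1 ≤ K + 1 then ∅ else t.2.1, if G.lev t.1 ≤ K + 2 then none else t.2.2)

variable {G K U0}

theorem valid_rpar (t : Raw G) (h : Valid G K U0 t) : Valid G K U0 (rpar G K t) := by
  obtain ⟨p, S, o⟩ := t
  rcases h with ⟨h1, h2, h3⟩ | ⟨h1, h2, h3⟩ | ⟨h1, h2, h3⟩
  · left; simp only at h1 h2 h3
    refine ⟨?_, ?_, ?_⟩
    · simp only [rpar, G.lev_par]; omega
    · simp only [rpar]; rw [if_pos (by omega)]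
    · simp only [rpar]; rw [if_pos (by omega)]
  · left; simp only at h1 h2 h3
    refine ⟨?_, ?_, ?_⟩
    · simp only [rpar, G.lev_par]; omega
    · simp only [rpar]; rw [if_pos (by omega)]
    · simp only [rpar]; rw [if_pos (by omega)]
  · simp only at h1 h2 h3
    by_cases hp : G.lev p = K + 2
    · right; left
      refine ⟨?_, ?_, ?_⟩
      · simp only [rpar, G.lev_par]; omega
      · simp only [rpar]; rw [if_pos (by omega)]
      · simp only [rpar]; rw [if_neg (by omega)]
        rw [← anc_par p (by omega), anc_of_le _ (by rw [G.lev_par]; omega)] at h2; exact h2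
    · right; right
      refine ⟨?_, ?_, ?_⟩
      · simp only [rpar, G.lev_par]; omega
      · simp only [rpar]; rw [if_neg (by omega), anc_par p (by omega)]; exact h2
      · simp only [rpar]; rw [if_neg (by omega), if_neg (by omega), anc_par p (by omega)]
        rcases h3 with ⟨u, hu1, hu2, hu3, hu4⟩ | ⟨S2, hs1, hs2, hs3⟩
        · left
          refine ⟨u, hu1, hu2, hu3, ?_, ?_⟩
          · rw [G.lev_par]; intro hle
            by_cases hl : G.lev p ≤ G.lev u
            · have := hu4.1 hl
              have h5 := par_anc u (m := G.lev p - 1) (by omega)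
              rw [Nat.sub_add_cancel (by omega), this] at h5
              exact h5.symm
            · have := hu4.2 (by omega)
              rw [anc_of_le _ (by omega)]
              rw [← this, ← par_anc _ (by omega), anc_of_le p (by omega)]
          · rw [G.lev_par]; intro hle
            rw [anc_par _ (by omega)]; exact hu4.2 (by omega)
        · right
          exact ⟨S2, hs1, hs2, (hs2.2.2.2 p hs3).2.1 (by omega)⟩

theorem raw_child {p c : G.Pos} (hc : G.Child p c) {S S' : Set G.Pos}
    {o o' : Option (G.Pos ⊕ Set G.Pos)}
    (h1 : G.lev p ≤ K → S = ∅) (h2 : G.lev p ≤ K + 1 → o = none)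
    (h3 : K + 1 ≤ G.lev p → S' = S) (h4 : K + 2 ≤ G.lev p → o' = o) :
    rpar G K (c, S', o') = (p, S, o) := by
  have := hc.1
  unfold rpar
  refine Prod.ext hc.2 (Prod.ext ?_ ?_)
  · simp only; split_ifs with h
    · exact (h1 (by omega)).symm
    · exact h3 (by omega)
  · simp only; split_ifs with h
    · exact (h2 (by omega)).symm
    · exact h4 (by omega)

theorem QI_full {a : G.Pos} (ha : G.lev a = K + 1) :
    QI G K a {r | K + 1 ≤ G.lev r ∧ G.anc r (K+1) = a} := by
  have key : ∀ r, (K + 1 ≤ G.lev r ∧ G.anc r (K+1) = a) → ∀ c, G.Child r c →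
      (K + 1 ≤ G.lev c ∧ G.anc c (K+1) = a) := fun r hr c hc =>
    ⟨by rw [hc.1]; omega, by rw [hc.anc hr.1, hr.2]⟩
  refine ⟨⟨ha.ge, anc_of_le _ ha.le⟩, fun r hr => ⟨hr.1, hr.2, fun _ => key r hr, fun _ => ?_⟩⟩
  exact ⟨G.dflt r, dflt_child r, key r hr _ (dflt_child r)⟩

theorem comp_child {p u : G.Pos} (h : Comp G p u) : ∃ c, G.Child p c ∧ Comp G c u := by
  by_cases hl : G.lev p < G.lev u
  · have h1 := h.1 hl.le
    have h2 := child_anc u hl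
    rw [h1] at h2
    refine ⟨_, h2, ?_, ?_⟩
    · intro _; rw [h2.1]
    · intro h3; rw [h2.1] at h3
      have h4 : G.lev u = G.lev p + 1 := by omega
      rw [← h4, anc_of_le u le_rfl, anc_of_le u le_rfl]
  · refine ⟨G.dflt p, dflt_child p, ?_, ?_⟩
    · intro h3; rw [(dflt_child p).1] at h3; omega
    · intro _; rw [(dflt_child p).anc (by omega)]; exact h.2 (by omega)

theorem valid_ex (hK : K.bodd = false) (hU0 : ∀ u ∈ U0, K + 2 ≤ G.lev u)
    (t : Raw G) (h : Valid G K U0 t) :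
    ∃ t', Valid G K U0 t' ∧ G.lev t'.1 = G.lev t.1 + 1 ∧ rpar G K t' = t := by
  obtain ⟨p, S, o⟩ := t
  rcases h with ⟨h1, h2, h3⟩ | ⟨h1, h2, h3⟩ | ⟨h1, h2, h3⟩
  · simp only at h1 h2 h3
    have hc := dflt_child p
    by_cases hp : G.lev p = K
    · have e : G.lev (G.dflt p) = K + 1 := by rw [hc.1, hp]
      exact ⟨(G.dflt p, {r | K + 1 ≤ G.lev r ∧ G.anc r (K+1) = G.dflt p}, none),
        Or.inr (Or.inl ⟨e, rfl, QI_full e⟩), hc.1,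
        raw_child hc (fun _ => h2) (fun _ => h3) (fun h => by omega) (fun h => by omega)⟩
    · refine ⟨(G.dflt p, ∅, none), Or.inl ⟨?_, rfl, rfl⟩, hc.1,
        raw_child hc (fun _ => h2) (fun _ => h3) (fun h => by omega) (fun h => by omega)⟩
      simp only [hc.1]; omega
  · simp only at h1 h2 h3
    have hc := dflt_child p
    have hb : (G.lev p).bodd = true := by rw [h1]; simp [hK]
    have hcS := (h3.2 p h3.1).2.2.1 hb _ hc
    have hlc : G.lev (G.dflt p) = K + 2 := by rw [hc.1, h1]
    have hac : G.anc (G.dflt p) (K+1) = p := by rw [hc.anc (by omega), anc_of_le _ (by omega)]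
    by_cases hu : ∃ u ∈ S, u ∈ U0 ∧ Comp G (G.dflt p) u
    · obtain ⟨u, hu1, hu2, hu3⟩ := hu
      refine ⟨(G.dflt p, S, some (.inl u)), Or.inr (Or.inr ⟨hlc.ge, ?_, Or.inl ⟨u, rfl, hu1, hu2, hu3⟩⟩),
        hc.1, raw_child hc (fun h => by omega) (fun _ => h2) (fun _ => rfl) (fun h => by omega)⟩
      simp only [hac]; exact h3
    · let S2 : Set G.Pos := {r | K + 2 ≤ G.lev r ∧ G.anc r (K+2) = G.dflt p ∧ ∀ j, K + 2 ≤ j → G.anc r j ∈ S}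
      have key : ∀ r ∈ S2, ∀ c, G.Child r c → c ∈ S → c ∈ S2 := by
        intro r hr c hrc hcS'
        refine ⟨by rw [hrc.1]; have := hr.1; omega, by rw [hrc.anc hr.1, hr.2.1], fun j hj => ?_⟩
        by_cases hjr : j ≤ G.lev r
        · rw [hrc.anc hjr]; exact hr.2.2 j hj
        · rw [anc_of_le _ (by rw [hrc.1]; omega)]; exact hcS'
      have hsub : S2 ⊆ S := fun r hr => by
        have := hr.2.2 (G.lev r) hr.1; rwa [anc_of_le _ le_rfl] at this
      have hdS : G.dflt p ∈ S2 := ⟨hlc.ge, anc_of_le _ hlc.le, fun j hj => by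
        rw [anc_of_le _ (by omega)]; exact hcS⟩
      refine ⟨(G.dflt p, S, some (.inr S2)), Or.inr (Or.inr ⟨hlc.ge, ?_, Or.inr ⟨S2, rfl, ?_, hdS⟩⟩),
        hc.1, raw_child hc (fun h => by omega) (fun _ => h2) (fun _ => rfl) (fun h => by omega)⟩
      · simp only [hac]; exact h3
      · simp only; rw [anc_of_le _ hlc.le]
        refine ⟨hdS, hsub, ?_, ?_⟩
        · intro r hr hrU
          refine hu ⟨r, hsub hr, hrU, ?_, ?_⟩
          · intro _; rw [hlc]; exact hr.2.1
          · intro hle; rw [hlc] at hle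
            have h5 := hr.1
            rw [anc_of_le _ (by omega)]
            have h6 := hr.2.1
            rwa [anc_of_le _ (by omega), eq_comm] at h6
        · intro r hr
          refine ⟨hr.1, ?_, ?_, ?_⟩
          · intro hl
            refine ⟨by rw [G.lev_par]; omega, by rw [anc_par _ (by omega)]; exact hr.2.1, fun j hj => ?_⟩
            by_cases hjr : j < G.lev r
            · rw [anc_par _ hjr]; exact hr.2.2 j hj
            · rw [anc_of_le _ (by rw [G.lev_par]; omega)]
              have := hr.2.2 (G.lev r - 1) (by omega)
              rw [← par_anc _ (by omega), anc_of_le _ (by omega)] at this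
              exact this
          · intro hb'
            exact ⟨G.dflt r, dflt_child r, key r hr _ (dflt_child r)
              ((h3.2 r (hsub hr)).2.2.1 hb' _ (dflt_child r))⟩
          · intro _ c hc1 hc2; exact key r hr c hc1 hc2
  · simp only at h1 h2 h3
    rcases h3 with ⟨u, hu1, hu2, hu3, hu4⟩ | ⟨S2, hs1, hs2, hs3⟩
    · obtain ⟨c, hc, hcu⟩ := comp_child hu4
      refine ⟨(c, S, o), Or.inr (Or.inr ⟨?_, ?_, Or.inl ⟨u, hu1, hu2, hu3, hcu⟩⟩),
        hc.1, raw_child hc (fun h => by omega) (fun _ => by omega) (fun _ => rfl) (fun h => rfl)⟩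
      · simp only [hc.1]; omega
      · simp only; rw [hc.anc (by omega)]; exact h2
    · have : ∃ c, G.Child p c ∧ c ∈ S2 := by
        have h4 := hs2.2.2.2 p hs3
        by_cases hb : (G.lev p).bodd = true
        · exact h4.2.2.1 hb
        · have hb' : (G.lev p).bodd = false := by simpa using hb
          obtain ⟨c, hc, hcS⟩ := (h2.2 p (hs2.2.1 hs3)).2.2.2 hb'
          exact ⟨c, hc, h4.2.2.2 hb' c hc hcS⟩
      obtain ⟨c, hc, hcS⟩ := this
      refine ⟨(c, S, o), Or.inr (Or.inr ⟨?_, ?_, Or.inr ⟨S2, hs1, ?_, hcS⟩⟩),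
        hc.1, raw_child hc (fun h => by omega) (fun _ => by omega) (fun _ => rfl) (fun h => rfl)⟩
      · simp only [hc.1]; omega
      · simp only; rw [hc.anc (by omega)]; exact h2
      · simp only; rw [hc.anc (by omega)]; exact hs2

variable (G K U0) in
noncomputable def UG (hK : K.bodd = false) (hU0 : ∀ u ∈ U0, K + 2 ≤ G.lev u) : GT where
  Pos := {t : Raw G // Valid G K U0 t}
  lev := fun t => G.lev t.1.1
  par := fun t => ⟨rpar G K t.1, valid_rpar _ t.2⟩
  lev_par := fun t => by simp only [rpar]; exact G.lev_par _
  ex := fun t => by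
    obtain ⟨t', h1, h2, h3⟩ := valid_ex hK hU0 t.1 t.2
    exact ⟨⟨t', h1⟩, h2, Subtype.ext h3⟩

end unravel
end BD
namespace BD
open BD.GT

section unravel
variable {G : GT} {K : ℕ} {U0 : Set G.Pos} {hK : K.bodd = false} {hU0 : ∀ u ∈ U0, K + 2 ≤ G.lev u}

open Classical in
noncomputable def rev (s : (UG G K U0 hK hU0).Pos → (UG G K U0 hK hU0).Pos) (t : Raw G) : Raw G :=
  if h : Valid G K U0 t then (s ⟨t, h⟩).1 else t

theorem rev_of {s : (UG G K U0 hK hU0).Pos → (UG G K U0 hK hU0).Pos} {t : Raw G}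
    (h : Valid G K U0 t) : rev s t = (s ⟨t, h⟩).1 := by
  unfold rev; rw [dif_pos h]

theorem rev_valid {s : (UG G K U0 hK hU0).Pos → (UG G K U0 hK hU0).Pos} {t : Raw G}
    (h : Valid G K U0 t) : Valid G K U0 (rev s t) := by
  rw [rev_of h]; exact (s ⟨t, h⟩).2

theorem rev_rpar {s : (UG G K U0 hK hU0).Pos → (UG G K U0 hK hU0).Pos}
    (hs : (UG G K U0 hK hU0).Strat s) {t : Raw G}
    (h : Valid G K U0 t) : rpar G K (rev s t) = t := by
  rw [rev_of h]; exact congrArg Subtype.val (hs ⟨t, h⟩).2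

theorem rev_child {s : (UG G K U0 hK hU0).Pos → (UG G K U0 hK hU0).Pos}
    (hs : (UG G K U0 hK hU0).Strat s) {t : Raw G}
    (h : Valid G K U0 t) : G.Child t.1 (rev s t).1 := by
  refine ⟨?_, congrArg Prod.fst (rev_rpar hs h)⟩
  rw [rev_of h]; exact (hs ⟨t, h⟩).1

theorem rev_S {s : (UG G K U0 hK hU0).Pos → (UG G K U0 hK hU0).Pos}
    (hs : (UG G K U0 hK hU0).Strat s) {t : Raw G}
    (h : Valid G K U0 t) (hl : K + 1 ≤ G.lev t.1) : (rev s t).2.1 = t.2.1 := by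
  have h1 := congrArg (fun z => z.2.1) (rev_rpar hs h)
  have h2 := (rev_child hs h).1
  simp only [rpar] at h1; rwa [if_neg (by omega)] at h1

theorem rev_o {s : (UG G K U0 hK hU0).Pos → (UG G K U0 hK hU0).Pos}
    (hs : (UG G K U0 hK hU0).Strat s) {t : Raw G}
    (h : Valid G K U0 t) (hl : K + 2 ≤ G.lev t.1) : (rev s t).2.2 = t.2.2 := by
  have h1 := congrArg (fun z => z.2.2) (rev_rpar hs h)
  have h2 := (rev_child hs h).1
  simp only [rpar] at h1; rwa [if_neg (by omega)] at h1

theorem valid_low {p : G.Pos} (h : G.lev p ≤ K) : Valid G K U0 (p, ∅, none) :=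
  Or.inl ⟨h, rfl, rfl⟩
theorem valid_mid {p : G.Pos} (h : G.lev p = K + 1) {S : Set G.Pos} (hS : QI G K p S) :
    Valid G K U0 (p, S, none) := Or.inr (Or.inl ⟨h, rfl, hS⟩)

theorem lift_lemma {s : (UG G K U0 hK hU0).Pos → (UG G K U0 hK hU0).Pos}
    (hs : (UG G K U0 hK hU0).Strat s) (b : Bool) {x : ℕ → G.Pos} (hx : G.Play x)
    (S : Set G.Pos) (o : Option (G.Pos ⊕ Set G.Pos)) (hQI : QI G K (x (K+1)) S)
    (hV : ∀ n, K + 2 ≤ n → Valid G K U0 (x n, S, o))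
    (h1 : ∀ n < K, n.bodd = b → x (n+1) = (rev s (x n, ∅, none)).1)
    (h2 : K.bodd = b → rev s (x K, ∅, none) = (x (K+1), S, none))
    (h3 : (K+1).bodd = b → rev s (x (K+1), S, none) = (x (K+2), S, o))
    (h4 : ∀ n, K + 2 ≤ n → n.bodd = b → x (n+1) = (rev s (x n, S, o)).1) :
    ∃ y, (UG G K U0 hK hU0).Play y ∧ (UG G K U0 hK hU0).Follows b s y ∧ ∀ n, (y n).1.1 = x n := by
  classical
  let r : ℕ → Raw G := fun n => (x n, if n ≤ K then ∅ else S, if n ≤ K + 1 then none else o)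
  have r1 : ∀ n ≤ K, r n = (x n, ∅, none) := fun n hn => by
    simp only [r]; rw [if_pos hn, if_pos (by omega)]
  have r2 : r (K+1) = (x (K+1), S, none) := by
    simp only [r]; rw [if_neg (by omega), if_pos (by omega)]
  have r3 : ∀ n, K + 2 ≤ n → r n = (x n, S, o) := fun n hn => by
    simp only [r]; rw [if_neg (by omega), if_neg (by omega)]
  have rv : ∀ n, Valid G K U0 (r n) := by
    intro n
    rcases Nat.lt_trichotomy n (K+1) with h | h | h
    · rw [r1 n (by omega)]; exact valid_low (by rw [hx.1]; omega)
    · subst h; rw [r2]; exact valid_mid (hx.1 _) hQI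
    · rw [r3 n h]; exact hV n h
  have rp : ∀ n, rpar G K (r (n+1)) = r n := by
    intro n
    have hl := hx.1 n
    refine raw_child (hx.child n) ?_ ?_ ?_ ?_
    · intro h; rw [hl] at h; rw [if_pos h]
    · intro h; rw [hl] at h; rw [if_pos h]
    · intro h; rw [hl] at h; rw [if_neg (by omega), if_neg (by omega)]
    · intro h; rw [hl] at h; rw [if_neg (by omega), if_neg (by omega)]
  refine ⟨fun n => ⟨r n, rv n⟩, ⟨fun n => hx.1 n, fun n => Subtype.ext (rp n)⟩, ?_, fun n => rfl⟩
  intro n hn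
  apply Subtype.ext
  show r (n+1) = (s ⟨r n, rv n⟩).1
  rw [← rev_of (rv n)]
  rcases Nat.lt_trichotomy n (K+1) with h | h | h
  · rcases Nat.lt_or_ge n K with h' | h'
    · rw [r1 n h'.le, r1 (n+1) (by omega)]
      have hv : Valid G K U0 (x n, ∅, none) := valid_low (by rw [hx.1]; omega)
      have hv' := rev_valid (s := s) hv
      have hc := (rev_child hs hv).1
      simp only [hx.1] at hc
      rcases hv' with ⟨_, g2, g3⟩ | ⟨g1, _⟩ | ⟨g1, _⟩
      · exact Prod.ext (h1 n h' hn) (Prod.ext g2.symm g3.symm)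
      · omega
      · omega
    · obtain rfl : n = K := by omega
      rw [r1 n le_rfl, r2, h2 hn]
  · subst h; rw [r2, r3 _ le_rfl, h3 hn]
  · have hv := hV n h
    rw [r3 n h, r3 (n+1) (by omega)]
    exact Prod.ext (h4 n h hn) (Prod.ext (rev_S hs hv (by simp only [hx.1]; omega)).symm
      (rev_o hs hv (by simp only [hx.1]; omega)).symm)

variable (K U0) in
def SigI (S : Set G.Pos) (q : G.Pos) : Set G.Pos :=
  {r | K + 2 ≤ G.lev r ∧ G.anc r (K+2) = q ∧ ∀ j, K + 2 ≤ j → G.anc r j ∈ S ∧ G.anc r j ∉ attW G false S U0}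

variable (K) in
def SigII (Us : Set G.Pos) (a : G.Pos) : Set G.Pos :=
  {r | K + 1 ≤ G.lev r ∧ G.anc r (K+1) = a ∧ ∀ j, K + 1 ≤ j → G.anc r j ∉ attW G true univ Us}

open Classical in
variable (K U0) in
noncomputable def candI (p : G.Pos) (S : Set G.Pos)
    (e : Set G.Pos → Option (G.Pos ⊕ Set G.Pos) → Raw G) : G.Pos :=
  if h : ∃ j, K + 2 ≤ j ∧ j ≤ G.lev p ∧ G.anc p j ∈ U0 then
    (e S (some (.inl (G.anc p (Nat.find h))))).1
  else if p ∈ attW G false S U0 then attT G false S U0 p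
  else (e S (some (.inr (SigI K U0 S (G.anc p (K+2)))))).1

variable (K) in
def UsP (a : G.Pos) (g : Set G.Pos → Raw G) (u : G.Pos) (S : Set G.Pos) : Prop :=
  QI G K a S ∧ ∃ c, g S = (c, S, some (.inl u))

variable (K) in
def Us (a : G.Pos) (g : Set G.Pos → Raw G) : Set G.Pos := {u | ∃ S, UsP K a g u S}

open Classical in
variable (K) in
noncomputable def UsS (a : G.Pos) (g : Set G.Pos → Raw G) (u : G.Pos) : Set G.Pos :=
  if h : ∃ S, UsP K a g u S then h.choose else ∅

theorem UsS_spec {a : G.Pos} {g : Set G.Pos → Raw G} {u : G.Pos} (h : u ∈ Us K a g) :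
    UsP K a g u (UsS K a g u) := by
  have h' : ∃ S, UsP K a g u S := h
  unfold UsS; rw [dif_pos h']; exact h'.choose_spec

open Classical in
variable (K) in
noncomputable def candII (p a : G.Pos) (g : Set G.Pos → Raw G)
    (e : Set G.Pos → Option (G.Pos ⊕ Set G.Pos) → Raw G) : G.Pos :=
  if h : ∃ j, j ≤ G.lev p ∧ G.anc p j ∈ Us K a g then
    (e (UsS K a g (G.anc p (Nat.find h))) (some (.inl (G.anc p (Nat.find h))))).1
  else if p ∈ attW G true univ (Us K a g) then attT G true univ (Us K a g) p
  else (e (SigII K (Us K a g) a)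
    (if G.lev p = K + 1 then none else (g (SigII K (Us K a g) a)).2.2)).1

theorem candI_hit {x : ℕ → G.Pos} (hx : G.Play x) {m n : ℕ} (hm : K + 2 ≤ m) (hmU : x m ∈ U0)
    (hmin : ∀ j < m, x j ∉ U0) (hmn : m ≤ n) (S e) :
    candI K U0 (x n) S e = (e S (some (.inl (x m)))).1 := by
  classical
  have h : ∃ j, K + 2 ≤ j ∧ j ≤ G.lev (x n) ∧ G.anc (x n) j ∈ U0 :=
    ⟨m, hm, by rw [hx.1]; exact hmn, by rw [hx.anc hmn]; exact hmU⟩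
  unfold candI; rw [dif_pos h]
  have : Nat.find h = m := by
    rw [Nat.find_eq_iff]
    refine ⟨⟨hm, by rw [hx.1]; exact hmn, by rw [hx.anc hmn]; exact hmU⟩, ?_⟩
    rintro j hj ⟨_, _, h3⟩
    rw [hx.anc (by omega)] at h3; exact hmin j hj h3
  rw [this, hx.anc hmn]

open Classical in
theorem candI_miss {x : ℕ → G.Pos} (hx : G.Play x) {n : ℕ} (hn : K + 2 ≤ n)
    (hmin : ∀ j ≤ n, x j ∉ U0) (S e) :
    candI K U0 (x n) S e = if x n ∈ attW G false S U0 then attT G false S U0 (x n)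
      else (e S (some (.inr (SigI K U0 S (x (K+2)))))).1 := by
  have h : ¬ ∃ j, K + 2 ≤ j ∧ j ≤ G.lev (x n) ∧ G.anc (x n) j ∈ U0 := by
    rintro ⟨j, _, h2, h3⟩
    rw [hx.1] at h2; rw [hx.anc h2] at h3; exact hmin j h2 h3
  unfold candI; rw [dif_neg h, hx.anc hn]

theorem candII_hit {x : ℕ → G.Pos} (hx : G.Play x) {a : G.Pos} {g} {m n : ℕ}
    (hmU : x m ∈ Us K a g)
    (hmin : ∀ j < m, x j ∉ Us K a g) (hmn : m ≤ n) (e) :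
    candII K (x n) a g e = (e (UsS K a g (x m)) (some (.inl (x m)))).1 := by
  classical
  have h : ∃ j, j ≤ G.lev (x n) ∧ G.anc (x n) j ∈ Us K a g :=
    ⟨m, by rw [hx.1]; exact hmn, by rw [hx.anc hmn]; exact hmU⟩
  unfold candII; rw [dif_pos h]
  have : Nat.find h = m := by
    rw [Nat.find_eq_iff]
    refine ⟨⟨by rw [hx.1]; exact hmn, by rw [hx.anc hmn]; exact hmU⟩, ?_⟩
    rintro j hj ⟨_, h3⟩
    rw [hx.anc (by omega)] at h3; exact hmin j hj h3
  rw [this, hx.anc hmn]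

open Classical in
theorem candII_miss {x : ℕ → G.Pos} (hx : G.Play x) {a : G.Pos} {g} {n : ℕ}
    (hmin : ∀ j ≤ n, x j ∉ Us K a g) (e) :
    candII K (x n) a g e = if x n ∈ attW G true univ (Us K a g) then attT G true univ (Us K a g) (x n)
      else (e (SigII K (Us K a g) a)
        (if n = K + 1 then none else (g (SigII K (Us K a g) a)).2.2)).1 := by
  have h : ¬ ∃ j, j ≤ G.lev (x n) ∧ G.anc (x n) j ∈ Us K a g := by
    rintro ⟨j, h2, h3⟩
    rw [hx.1] at h2; rw [hx.anc h2] at h3; exact hmin j h2 h3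
  unfold candII; rw [dif_neg h, hx.1]

open Classical in
noncomputable def uφ (b : Bool) (s : (UG G K U0 hK hU0).Pos → (UG G K U0 hK hU0).Pos) (p : G.Pos) : G.Pos :=
  G.guard p (if G.lev p ≤ K then (rev s (p, ∅, none)).1 else
    if b = true then candII K p (G.anc p (K+1)) (fun S => rev s (G.anc p (K+1), S, none))
      (fun S o => rev s (p, S, o))
    else candI K U0 p (rev s (G.anc p K, ∅, none)).2.1 (fun S o => rev s (p, S, o)))

theorem uφ_loc (b : Bool) (s t : (UG G K U0 hK hU0).Pos → (UG G K U0 hK hU0).Pos) (m : ℕ)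
    (h : ∀ p, (UG G K U0 hK hU0).lev p < m → s p = t p) (p : G.Pos) (hp : G.lev p < m) :
    uφ b s p = uφ b t p := by
  have key : ∀ q : Raw G, G.lev q.1 < m → rev s q = rev t q := by
    intro q hq
    by_cases hv : Valid G K U0 q
    · rw [rev_of hv, rev_of hv, h ⟨q, hv⟩ hq]
    · unfold rev; rw [dif_neg hv, dif_neg hv]
  have key2 : ∀ j, G.lev (G.anc p j) < m := by
    intro j; unfold GT.anc; rw [lev_iter]; omega
  unfold uφ
  have e1 : (fun S => rev s (G.anc p (K+1), S, none)) = (fun S => rev t (G.anc p (K+1), S, none)) :=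
    funext fun S => key _ (key2 _)
  have e2 : (fun S o => rev s (p, S, o)) = (fun S o => rev t (p, S, o)) :=
    funext fun S => funext fun o => key _ hp
  rw [e1, e2, key (p, ∅, none) hp, key (G.anc p K, ∅, none) (key2 _)]

theorem uφ_low {b : Bool} {s : (UG G K U0 hK hU0).Pos → (UG G K U0 hK hU0).Pos}
    (hs : (UG G K U0 hK hU0).Strat s) {p : G.Pos} (hp : G.lev p ≤ K) :
    uφ b s p = (rev s (p, ∅, none)).1 := by
  unfold uφ
  rw [if_pos hp, guard_of (rev_child hs (valid_low hp))]

theorem SigI_sub (S : Set G.Pos) (q : G.Pos) : SigI K U0 S q ⊆ S := fun r hr => by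
  have := (hr.2.2 (G.lev r) hr.1).1; rwa [anc_of_le _ le_rfl] at this

theorem SigI_QII {a : G.Pos} {S : Set G.Pos} (hS : QI G K a S) {q : G.Pos}
    (hl : G.lev q = K + 2) (hq : q ∈ S) (hqW : q ∉ attW G false S U0) :
    QII G K U0 q S (SigI K U0 S q) := by
  have A := att_spec G false S U0
  have nW : ∀ r ∈ SigI K U0 S q, r ∉ attW G false S U0 := fun r hr => by
    have := (hr.2.2 (G.lev r) hr.1).2; rwa [anc_of_le _ le_rfl] at this
  have key : ∀ r ∈ SigI K U0 S q, ∀ c, G.Child r c → c ∈ S → c ∉ attW G false S U0 → c ∈ SigI K U0 S q := by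
    intro r hr c hc hcS hcW
    refine ⟨by rw [hc.1]; have := hr.1; omega, by rw [hc.anc hr.1, hr.2.1], fun j hj => ?_⟩
    by_cases hjr : j ≤ G.lev r
    · rw [hc.anc hjr]; exact hr.2.2 j hj
    · rw [anc_of_le _ (by rw [hc.1]; omega)]; exact ⟨hcS, hcW⟩
  refine ⟨⟨hl.ge, anc_of_le _ hl.le, fun j hj => by rw [anc_of_le _ (by omega)]; exact ⟨hq, hqW⟩⟩,
    SigI_sub S q, fun r hr hU => nW r hr (A.sub hU), fun r hr => ⟨hr.1, ?_, ?_, ?_⟩⟩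
  · intro hl
    refine ⟨by rw [G.lev_par]; omega, by rw [anc_par _ (by omega)]; exact hr.2.1, fun j hj => ?_⟩
    by_cases hjr : j < G.lev r
    · rw [anc_par _ hjr]; exact hr.2.2 j hj
    · rw [anc_of_le _ (by rw [G.lev_par]; omega)]
      have := hr.2.2 (G.lev r - 1) (by omega)
      rw [← par_anc _ (by omega), anc_of_le _ (by omega)] at this
      exact this
  · intro hb
    obtain ⟨c, h1, h2, h3⟩ := A.out_opp r (nW r hr) (by rw [hb]; simp)
    exact ⟨c, h1, key r hr c h1 h2 h3⟩
  · intro hb c h1 h2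
    exact key r hr c h1 h2 (A.out_mine r (nW r hr) hb c h1 h2)

theorem SigII_QI {Us : Set G.Pos} {a : G.Pos} (hl : G.lev a = K + 1) (haW : a ∉ attW G true univ Us) :
    QI G K a (SigII K Us a) := by
  have A := att_spec G true univ Us
  have nW : ∀ r ∈ SigII K Us a, r ∉ attW G true univ Us := fun r hr => by
    have := (hr.2.2 (G.lev r) hr.1); rwa [anc_of_le _ le_rfl] at this
  have key : ∀ r ∈ SigII K Us a, ∀ c, G.Child r c → c ∉ attW G true univ Us → c ∈ SigII K Us a := by
    intro r hr c hc hcW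
    refine ⟨by rw [hc.1]; have := hr.1; omega, by rw [hc.anc hr.1, hr.2.1], fun j hj => ?_⟩
    by_cases hjr : j ≤ G.lev r
    · rw [hc.anc hjr]; exact hr.2.2 j hj
    · rw [anc_of_le _ (by rw [hc.1]; omega)]; exact hcW
  refine ⟨⟨hl.ge, anc_of_le _ hl.le, fun j hj => by rw [anc_of_le _ (by omega)]; exact haW⟩,
    fun r hr => ⟨hr.1, hr.2.1, ?_, ?_⟩⟩
  · intro hb c hc
    exact key r hr c hc (A.out_mine r (nW r hr) hb c hc trivial)
  · intro hb
    obtain ⟨c, h1, _, h3⟩ := A.out_opp r (nW r hr) (by rw [hb]; simp)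
    exact ⟨c, h1, key r hr c h1 h3⟩

theorem play_comp {x : ℕ → G.Pos} (hx : G.Play x) (m n : ℕ) : Comp G (x n) (x m) := by
  refine ⟨fun h => ?_, fun h => ?_⟩ <;> rw [hx.1, hx.1] at h <;> rw [hx.1, hx.anc h]

/-- forced moves below a declared node -/
theorem forced {s : (UG G K U0 hK hU0).Pos → (UG G K U0 hK hU0).Pos}
    (hs : (UG G K U0 hK hU0).Strat s) {x : ℕ → G.Pos} (hx : G.Play x) {m n : ℕ} (hn : K + 2 ≤ n)
    (hnm : n < m) {S : Set G.Pos} (hv : Valid G K U0 (x n, S, some (.inl (x m)))) :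
    x (n+1) = (rev s (x n, S, some (.inl (x m)))).1 := by
  have h1 := rev_valid (s := s) hv
  have h2 := rev_child hs hv
  have h3 := rev_o hs hv (by simp only [hx.1]; omega)
  have hl : G.lev (rev s (x n, S, some (.inl (x m)))).1 = n + 1 := by
    rw [h2.1, hx.1]
  rcases h1 with ⟨g, _⟩ | ⟨g, _⟩ | ⟨_, _, ⟨u, g2, _, _, g3⟩ | ⟨S2, g2, _⟩⟩
  · omega
  · omega
  · rw [h3] at g2
    simp only [Option.some.injEq, Sum.inl.injEq] at g2
    subst g2
    have := g3.1 (by rw [hl, hx.1]; omega)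
    rw [hl, hx.anc (by omega)] at this; exact this
  · rw [h3] at g2; simp at g2

end unravel
end BD
namespace BD
open BD.GT

section unravel
variable {G : GT} {K : ℕ} {U0 : Set G.Pos} {hK : K.bodd = false} {hU0 : ∀ u ∈ U0, K + 2 ≤ G.lev u}

theorem bodd_succ' (n : ℕ) (b : Bool) : (n+1).bodd = b ↔ n.bodd = !b := by
  rw [Nat.bodd_succ]; cases n.bodd <;> cases b <;> simp

theorem liftI {s : (UG G K U0 hK hU0).Pos → (UG G K U0 hK hU0).Pos}
    (hs : (UG G K U0 hK hU0).Strat s) {x : ℕ → G.Pos} (hx : G.Play x)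
    (hf : G.Follows false (uφ false s) x) :
    ∃ y, (UG G K U0 hK hU0).Play y ∧ (UG G K U0 hK hU0).Follows false s y ∧ ∀ n, (y n).1.1 = x n := by
  classical
  have hvK : Valid G K U0 (x K, ∅, none) := valid_low (hx.1 K).le
  obtain ⟨S, hS⟩ : ∃ S, S = (rev s (x K, ∅, none)).2.1 := ⟨_, rfl⟩
  have hxK1 : x (K+1) = (rev s (x K, ∅, none)).1 := by
    rw [hf K hK, uφ_low hs (hx.1 K).le]
  have hvK1 := rev_valid (s := s) hvK
  have hfull : rev s (x K, ∅, none) = (x (K+1), S, none) ∧ QI G K (x (K+1)) S := by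
    rcases hvK1 with ⟨g, _⟩ | ⟨_, g2, g3⟩ | ⟨g, _⟩
    · rw [← hxK1, hx.1] at g; omega
    · rw [← hS, ← hxK1] at g3
      exact ⟨Prod.ext hxK1.symm (Prod.ext hS.symm g2), g3⟩
    · rw [← hxK1, hx.1] at g; omega
  obtain ⟨hfull, hQI⟩ := hfull
  have hcand : ∀ n, K + 2 ≤ n → n.bodd = false → x (n+1) = G.guard (x n)
      (candI K U0 (x n) S (fun S o => rev s (x n, S, o))) := by
    intro n hn hb
    rw [hf n hb]
    unfold uφ
    rw [if_neg (by rw [hx.1]; omega), if_neg (by simp), hx.anc (by omega), ← hS]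
  have A := att_spec G false S U0
  have hQI' : ∀ n, K + 1 ≤ n → QI G K (G.anc (x n) (K+1)) S := fun n hn => by
    rw [hx.anc hn]; exact hQI
  have hsig : ∀ n, K + 2 ≤ n → (∀ j, K + 1 ≤ j → j ≤ n → x j ∈ S) →
      (∀ j, K + 2 ≤ j → j ≤ n → x j ∉ attW G false S U0) →
      Valid G K U0 (x n, S, some (.inr (SigI K U0 S (x (K+2))))) := by
    intro n hn h1 h2
    refine Or.inr (Or.inr ⟨by simp only [hx.1]; exact hn, hQI' n (by omega), Or.inr ⟨_, rfl, ?_, ?_⟩⟩)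
    · simp only; rw [hx.anc hn]
      exact SigI_QII hQI (hx.1 _) (h1 _ (by omega) hn) (h2 _ le_rfl hn)
    · refine ⟨by rw [hx.1]; exact hn, by rw [hx.anc hn], fun j hj => ?_⟩
      by_cases hjn : j ≤ n
      · rw [hx.anc hjn]; exact ⟨h1 j (by omega) hjn, h2 j hj hjn⟩
      · simp only
        rw [anc_of_le _ (by rw [hx.1]; omega)]; exact ⟨h1 n (by omega) le_rfl, h2 n hn le_rfl⟩
  -- invariants
  have inv : ∀ n, K + 1 ≤ n → (∀ j < n, x j ∉ U0) → (∀ j, K + 1 ≤ j → j ≤ n → x j ∈ S) ∧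
      (x n ∉ attW G false S U0 → ∀ j, K + 2 ≤ j → j ≤ n → x j ∉ attW G false S U0) := by
    intro n hn
    induction n, hn using Nat.le_induction with
    | base =>
      intro _
      refine ⟨fun j h1 h2 => ?_, fun _ j h1 h2 => by omega⟩
      obtain rfl : j = K + 1 := by omega
      exact hQI.1
    | succ n hn ih =>
      intro hU
      obtain ⟨i1, i2⟩ := ih (fun j hj => hU j (by omega))
      have hnU : x n ∉ U0 := hU n (by omega)
      have hlev := hx.1 n
      have hnS := i1 n hn le_rfl
      have main : x (n+1) ∈ S ∧ (x n ∈ attW G false S U0 → x (n+1) ∈ attW G false S U0) := by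
        cases hb : n.bodd with
        | true =>
          have h1 := (hQI.2 _ hnS).2.2.1 (by rw [hlev, hb]) _ (hx.child n)
          exact ⟨h1, fun hW => (A.in_opp _ hW hnU (by rw [hlev, hb]; simp) _ (hx.child n) h1).1⟩
        | false =>
          have hn2 : K + 2 ≤ n := by
            rcases Nat.lt_or_ge (K+1) n with h | h
            · exact h
            · obtain rfl : n = K + 1 := by omega
              rw [bodd_succ', hK] at hb; simp at hb
          have hc := hcand n hn2 hb
          rw [candI_miss hx hn2 (fun j hj => hU j (by omega))] at hc
          by_cases hW : x n ∈ attW G false S U0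
          · rw [if_pos hW] at hc
            have := A.in_mine _ hW hnU (by rw [hlev, hb])
            rw [guard_of this.1] at hc
            rw [hc]; exact ⟨this.2.1, fun _ => this.2.2.1⟩
          · refine ⟨?_, fun h => (hW h).elim⟩
            rw [if_neg hW] at hc
            have hv := hsig n hn2 i1 (i2 hW)
            rw [guard_of (rev_child hs hv)] at hc
            have hl : G.lev (rev s (x n, S, some (.inr (SigI K U0 S (x (K+2)))))).1 = n + 1 := by
              rw [(rev_child hs hv).1, hlev]
            rcases rev_valid (s := s) hv with ⟨g, _⟩ | ⟨g, _⟩ | ⟨_, _, ⟨u, g2, _⟩ | ⟨S2, g2, g3, g4⟩⟩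
            · omega
            · omega
            · rw [rev_o hs hv (by simp only [hlev]; omega)] at g2; simp at g2
            · rw [← hc] at g4
              have := g3.2.1 g4
              rwa [rev_S hs hv (by simp only [hlev]; omega)] at this
      refine ⟨fun j h1 h2 => ?_, fun hW j h1 h2 => ?_⟩
      · rcases Nat.lt_or_ge n j with h | h
        · obtain rfl : j = n + 1 := by omega
          exact main.1
        · exact i1 j h1 h
      · rcases Nat.lt_or_ge n j with h | h
        · obtain rfl : j = n + 1 := by omega
          exact hW
        · exact i2 (fun h => hW (main.2 h)) j h1 h
  by_cases hit : ∃ m, x m ∈ U0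
  · have hmU := Nat.find_spec hit
    have hmin : ∀ j < Nat.find hit, x j ∉ U0 := fun j hj => Nat.find_min hit hj
    generalize Nat.find hit = m at hmU hmin
    have hm : K + 2 ≤ m := by have := hU0 _ hmU; rwa [hx.1] at this
    have hmS : x m ∈ S := (inv m (by omega) hmin).1 m (by omega) le_rfl
    have hV : ∀ n, K + 2 ≤ n → Valid G K U0 (x n, S, some (.inl (x m))) := fun n hn =>
      Or.inr (Or.inr ⟨by simp only [hx.1]; exact hn, hQI' n (by omega),
        Or.inl ⟨_, rfl, hmS, hmU, play_comp hx m n⟩⟩)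
    refine lift_lemma hs false hx S (some (.inl (x m))) hQI hV ?_ (fun _ => hfull) ?_ ?_
    · intro n hn hb; rw [hf n hb, uφ_low hs (by rw [hx.1]; omega)]
    · intro h; rw [bodd_succ', hK] at h; simp at h
    · intro n hn hb
      rcases Nat.lt_or_ge n m with h | h
      · exact forced hs hx hn h (hV n hn)
      · rw [hcand n hn hb, candI_hit hx hm hmU hmin h, guard_of (rev_child hs (hV n hn))]
  · push Not at hit
    have hSall : ∀ n, K + 1 ≤ n → x n ∈ S := fun n hn =>
      (inv n hn (fun j _ => hit j)).1 n hn le_rfl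
    have hW : ∀ n, K + 2 ≤ n → x n ∉ attW G false S U0 := by
      intro n hn hW
      obtain ⟨n', _, h⟩ := A.reach hx (K+2) (fun n hn => hSall n (by omega)) (fun n hn hb hW _ => by
        have hc := hcand n hn hb
        rw [candI_miss hx hn (fun j hj => hit j), if_pos hW,
          guard_of (A.in_mine _ hW (hit n) (by rw [hx.1, hb])).1] at hc
        exact hc) n hn hW
      exact hit _ h
    have hV : ∀ n, K + 2 ≤ n → Valid G K U0 (x n, S, some (.inr (SigI K U0 S (x (K+2))))) := fun n hn =>
      hsig n hn (fun j hj _ => hSall j hj) (fun j hj _ => hW j hj)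
    refine lift_lemma hs false hx S _ hQI hV ?_ (fun _ => hfull) ?_ ?_
    · intro n hn hb; rw [hf n hb, uφ_low hs (by rw [hx.1]; omega)]
    · intro h; rw [bodd_succ', hK] at h; simp at h
    · intro n hn hb
      rw [hcand n hn hb, candI_miss hx hn (fun j hj => hit j), if_neg (hW n hn),
        guard_of (rev_child hs (hV n hn))]

theorem liftII {s : (UG G K U0 hK hU0).Pos → (UG G K U0 hK hU0).Pos}
    (hs : (UG G K U0 hK hU0).Strat s) {x : ℕ → G.Pos} (hx : G.Play x)
    (hf : G.Follows true (uφ true s) x) :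
    ∃ y, (UG G K U0 hK hU0).Play y ∧ (UG G K U0 hK hU0).Follows true s y ∧ ∀ n, (y n).1.1 = x n := by
  classical
  obtain ⟨g, hg⟩ : ∃ g : Set G.Pos → Raw G, g = fun S => rev s (x (K+1), S, none) := ⟨_, rfl⟩
  have hgS : ∀ S, g S = rev s (x (K+1), S, none) := fun S => by rw [hg]
  obtain ⟨a, ha⟩ : ∃ a, a = x (K+1) := ⟨_, rfl⟩
  have hla : G.lev a = K + 1 := by rw [ha, hx.1]
  have hcand : ∀ n, K + 1 ≤ n → n.bodd = true → x (n+1) = G.guard (x n)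
      (candII K (x n) a g (fun S o => rev s (x n, S, o))) := by
    intro n hn hb
    rw [hf n hb]
    unfold uφ
    rw [if_neg (by rw [hx.1]; omega), if_pos rfl, hx.anc (by omega), ← hg, ← ha]
  obtain ⟨UU, hUU⟩ : ∃ UU, UU = Us K a g := ⟨_, rfl⟩
  have hUUmem : ∀ u ∈ UU, ∀ S, UsP K a g u S → u ∈ S ∧ u ∈ U0 ∧
      ∃ c, rev s (x (K+1), S, none) = (c, S, some (.inl u)) ∧ Comp G c u ∧ G.lev c = K + 2 := by
    rintro u - S ⟨h1, c, h2⟩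
    rw [hgS] at h2
    have hv : Valid G K U0 (x (K+1), S, none) := valid_mid (hx.1 _) (ha ▸ h1)
    have hl := (rev_child hs hv).1
    have hv' := rev_valid (s := s) hv
    rw [h2] at hl hv'
    simp only [hx.1] at hl
    rcases hv' with ⟨g1, _⟩ | ⟨g1, _⟩ | ⟨_, _, ⟨u', g2, g3, g4, g5⟩ | ⟨S2, g2, _⟩⟩
    · simp only at g1; omega
    · simp only at g1; omega
    · simp only [Option.some.injEq, Sum.inl.injEq] at g2
      subst g2
      exact ⟨g3, g4, c, h2, g5, by omega⟩
    · simp at g2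
  have hlow : ∀ n < K, n.bodd = true → x (n+1) = (rev s (x n, ∅, none)).1 := by
    intro n hn hb; rw [hf n hb, uφ_low hs (by rw [hx.1]; omega)]
  by_cases hit : ∃ m, x m ∈ UU
  · have hmU := Nat.find_spec hit
    have hmin : ∀ j < Nat.find hit, x j ∉ UU := fun j hj => Nat.find_min hit hj
    generalize Nat.find hit = m at hmU hmin
    have hsp : UsP K a g (x m) (UsS K a g (x m)) := UsS_spec (hUU ▸ hmU)
    obtain ⟨S, hS⟩ : ∃ S, S = UsS K a g (x m) := ⟨_, rfl⟩
    rw [← hS] at hsp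
    obtain ⟨hmS, hmU0, c, hc1, hc2, hc3⟩ := hUUmem _ hmU S hsp
    have hm : K + 2 ≤ m := by have := hU0 _ hmU0; rwa [hx.1] at this
    have hcx : c = x (K+2) := by
      have := hc2.1 (by rw [hc3, hx.1]; exact hm)
      rw [hc3, hx.anc hm] at this; exact this.symm
    have hQI : QI G K (x (K+1)) S := ha ▸ hsp.1
    have hV : ∀ n, K + 2 ≤ n → Valid G K U0 (x n, S, some (.inl (x m))) := fun n hn =>
      Or.inr (Or.inr ⟨by simp only [hx.1]; exact hn, by simp only; rw [hx.anc (by omega)]; exact hQI,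
        Or.inl ⟨_, rfl, hmS, hmU0, play_comp hx m n⟩⟩)
    refine lift_lemma hs true hx S (some (.inl (x m))) hQI hV hlow ?_ ?_ ?_
    · intro h; rw [hK] at h; simp at h
    · intro _; rw [hc1, hcx]
    · intro n hn hb
      rcases Nat.lt_or_ge n m with h | h
      · exact forced hs hx hn h (hV n hn)
      · subst hUU
        rw [hcand n (by omega) hb, candII_hit hx hmU hmin h, ← hS, guard_of (rev_child hs (hV n hn))]
  · push Not at hit
    have A := att_spec G true univ UU
    have hW : ∀ n, K + 1 ≤ n → x n ∉ attW G true univ UU := by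
      intro n hn hW
      obtain ⟨n', _, h⟩ := A.reach hx (K+1) (fun n hn => trivial) (fun n hn hb hW _ => by
        have hc := hcand n hn hb
        subst hUU
        rw [candII_miss hx (fun j hj => hit j), if_pos hW,
          guard_of (A.in_mine _ hW (hit n) (by rw [hx.1, hb])).1] at hc
        exact hc) n hn hW
      exact hit _ h
    obtain ⟨S, hS⟩ : ∃ S, S = SigII K UU a := ⟨_, rfl⟩
    have hQIa : QI G K a S := hS ▸ SigII_QI hla (ha ▸ hW _ le_rfl)
    have hQI : QI G K (x (K+1)) S := ha ▸ hQIa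
    have hv1 : Valid G K U0 (x (K+1), S, none) := valid_mid (hx.1 _) hQI
    have hb1 : (K+1).bodd = true := by rw [bodd_succ', hK]; rfl
    have hxS : ∀ n, K + 1 ≤ n → x n ∈ S := by
      intro n hn
      rw [hS]
      refine ⟨by rw [hx.1]; exact hn, by rw [hx.anc hn, ha], fun j hj => ?_⟩
      by_cases hjn : j ≤ n
      · rw [hx.anc hjn]; exact hW j hj
      · rw [anc_of_le _ (by rw [hx.1]; omega)]; exact hW n hn
    have hgv : rev s (x (K+1), S, none) = g S := (hgS S).symm
    have hx2 : x (K+2) = (g S).1 := by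
      have hc := hcand (K+1) le_rfl hb1
      rw [candII_miss hx (fun j hj => hUU ▸ hit j), ← hUU, if_neg (hW _ le_rfl), ← hS, if_pos rfl,
        guard_of (rev_child hs hv1), hgv] at hc
      exact hc
    have hgS1 : (g S).2.1 = S := by
      rw [← hgv]; exact rev_S hs hv1 (by simp only [hx.1]; omega)
    obtain ⟨S2, hS2, hQ2⟩ : ∃ S2, (g S).2.2 = some (.inr S2) ∧ QII G K U0 (x (K+2)) S S2 := by
      have hv' := rev_valid (s := s) hv1
      rw [hgv] at hv'
      rcases hv' with ⟨g1, _⟩ | ⟨g1, _⟩ | ⟨_, _, ⟨u, g2, g3, g4, g5⟩ | ⟨S2, g2, g3, _⟩⟩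
      · rw [← hx2, hx.1] at g1; omega
      · rw [← hx2, hx.1] at g1; omega
      · exfalso
        have huU : u ∈ UU := by
          rw [hUU]
          exact ⟨S, hQIa, (g S).1, Prod.ext rfl (Prod.ext hgS1 g2)⟩
        rw [hgS1, hS] at g3
        have := (g3.2.2 (G.lev u) g3.1); rw [anc_of_le _ le_rfl] at this
        exact this (A.sub huU)
      · rw [hgS1, ← hx2, hx.anc le_rfl] at g3
        exact ⟨S2, g2, g3⟩
    have hgfull : g S = (x (K+2), S, some (.inr S2)) :=
      Prod.ext hx2.symm (Prod.ext hgS1 hS2)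
    have hval : ∀ n, K + 2 ≤ n → x n ∈ S2 → Valid G K U0 (x n, S, some (.inr S2)) := fun n hn h =>
      Or.inr (Or.inr ⟨by simp only [hx.1]; exact hn, by simp only; rw [hx.anc (by omega)]; exact hQI,
        Or.inr ⟨_, rfl, by simp only; rw [hx.anc hn]; exact hQ2, h⟩⟩)
    have hstep : ∀ n, K + 2 ≤ n → n.bodd = true → x n ∈ S2 →
        x (n+1) = (rev s (x n, S, some (.inr S2))).1 := by
      intro n hn hb h
      have hc := hcand n (by omega) hb
      rw [candII_miss hx (fun j hj => hUU ▸ hit j), ← hUU, if_neg (hW _ (by omega)), ← hS,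
        if_neg (by omega), hS2, guard_of (rev_child hs (hval n hn h))] at hc
      exact hc
    have hin : ∀ n, K + 2 ≤ n → x n ∈ S2 := by
      intro n hn
      induction n, hn using Nat.le_induction with
      | base => exact hQ2.1
      | succ n hn ih =>
        cases hb : n.bodd with
        | false => exact (hQ2.2.2.2 _ ih).2.2.2 (by rw [hx.1, hb]) _ (hx.child n) (hxS _ (by omega))
        | true =>
          have hv := hval n hn ih
          have hc := hstep n hn hb ih
          have hl : G.lev (rev s (x n, S, some (.inr S2))).1 = n + 1 := by
              rw [← hc, hx.1]
          rcases rev_valid (s := s) hv with ⟨g, _⟩ | ⟨g, _⟩ | ⟨_, _, ⟨u, g2, _⟩ | ⟨S2', g2, g3, g4⟩⟩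
          · omega
          · omega
          · rw [rev_o hs hv (by simp only [hx.1]; omega)] at g2; simp at g2
          · rw [rev_o hs hv (by simp only [hx.1]; omega)] at g2
            simp only [Option.some.injEq, Sum.inr.injEq] at g2
            subst g2
            rwa [← hc] at g4
    refine lift_lemma hs true hx S (some (.inr S2)) hQI (fun n hn => hval n hn (hin n hn)) hlow ?_ ?_ ?_
    · intro h; rw [hK] at h; simp at h
    · intro _; rw [hgv, hgfull]
    · intro n hn hb; exact hstep n hn hb (hin n hn)

variable (G K U0 hK hU0) in
noncomputable def ucov : Cov K (UG G K U0 hK hU0) G where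
  π := fun t => t.1.1
  lev_π := fun _ => rfl
  par_π := fun _ _ => rfl
  inj := by
    rintro ⟨p, hp⟩ ⟨q, hq⟩ h1 h2 h3
    apply Subtype.ext
    simp only at h3
    change G.lev p.1 ≤ K at h1
    change G.lev q.1 ≤ K at h2
    rcases hp with ⟨_, a1, a2⟩ | ⟨a, _⟩ | ⟨a, _⟩
    · rcases hq with ⟨_, b1, b2⟩ | ⟨b, _⟩ | ⟨b, _⟩
      · exact Prod.ext h3 (Prod.ext (a1.trans b1.symm) (a2.trans b2.symm))
      · omega
      · omega
    · omega
    · omega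
  surj := fun q hq => ⟨⟨(q, ∅, none), valid_low hq⟩, rfl⟩
  φ := fun b s => uφ b s
  strat := fun b s _ p => guard_child _ _
  loc := fun b s t m _ _ h p hp => uφ_loc b s t m h p hp
  agree := by
    intro b s p hs hp
    change G.lev p.1.1 < K at hp
    rw [uφ_low hs hp.le]
    have : p = ⟨(p.1.1, ∅, none), valid_low hp.le⟩ := by
      apply Subtype.ext
      rcases p.2 with ⟨_, a1, a2⟩ | ⟨a, _⟩ | ⟨a, _⟩
      · exact Prod.ext rfl (Prod.ext a1 a2)
      · omega
      · omega
    rw [rev_of (valid_low hp.le), ← this]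
  lift := by
    intro b s x hs hx hf
    cases b with
    | false => exact liftI hs hx hf
    | true => exact liftII hs hx hf

theorem ucov_decides (y : ℕ → (UG G K U0 hK hU0).Pos) (hy : (UG G K U0 hK hU0).Play y) :
    (∃ n, (y n).1.1 ∈ U0) ↔ ∃ u, (y (K+2)).1.2.2 = some (.inl u) := by
  have hx : G.Play (fun n => (y n).1.1) := (ucov G K U0 hK hU0).π_play hy
  have hl : ∀ n, G.lev (y n).1.1 = n := hx.1
  have hconst : ∀ n, K + 2 ≤ n → (y n).1.2.2 = (y (K+2)).1.2.2 := by
    intro n hn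
    induction n, hn using Nat.le_induction with
    | base => rfl
    | succ n hn ih =>
      rw [← ih]
      have := congrArg (fun z => z.1.2.2) (hy.2 n)
      change (rpar G K (y (n+1)).1).2.2 = _ at this
      rw [← this]; unfold rpar; simp only
      rw [if_neg (by rw [hl]; omega)]
  have hv : ∀ n, Valid G K U0 (y n).1 := fun n => (y n).2
  constructor
  · rintro ⟨n, hn⟩
    have hn2 : K + 2 ≤ n := by have := hU0 _ hn; rwa [hl] at this
    rcases hv n with ⟨a, _⟩ | ⟨a, _⟩ | ⟨_, _, ⟨u, g2, _⟩ | ⟨S2, g2, g3, g4⟩⟩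
    · rw [hl] at a; omega
    · rw [hl] at a; omega
    · exact ⟨u, by rw [← hconst n hn2, g2]⟩
    · exact (g3.2.2.1 _ g4 hn).elim
  · rintro ⟨u, hu⟩
    have key : ∀ n, K + 2 ≤ n → u ∈ U0 ∧ Comp G (y n).1.1 u := by
      intro n hn
      have ho := hconst n hn
      rw [hu] at ho
      rcases hv n with ⟨a, _⟩ | ⟨a, _⟩ | ⟨_, _, ⟨u', g2, _, g3, g4⟩ | ⟨S2, g2, g3, g4⟩⟩
      · rw [hl] at a; omega
      · rw [hl] at a; omega
      · rw [ho] at g2; simp only [Option.some.injEq, Sum.inl.injEq] at g2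
        subst g2; exact ⟨g3, g4⟩
      · rw [ho] at g2; simp at g2
    have hu0 := (key (K+2) le_rfl).1
    refine ⟨G.lev u, ?_⟩
    have := (key _ (hU0 u hu0)).2.1 (by rw [hl])
    rw [hl, anc_of_le _ le_rfl] at this
    rw [← this]; exact hu0

end unravel
end BD
namespace BD
open BD.GT

section invlim

abbrev Thr {Gs : ℕ → GT} {K : ℕ → ℕ} (cs : ∀ m, Cov (K m) (Gs (m+1)) (Gs m)) : Type :=
  {t : ∀ m, (Gs m).Pos // ∀ m, (cs m).π (t (m+1)) = t m}

theorem Thr.lev {Gs : ℕ → GT} {K : ℕ → ℕ} {cs : ∀ m, Cov (K m) (Gs (m+1)) (Gs m)} (t : Thr cs) (m : ℕ) :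
    (Gs m).lev (t.1 m) = (Gs 0).lev (t.1 0) := by
  induction m with
  | zero => rfl
  | succ m ih => rw [← ih, ← t.2 m, (cs m).lev_π]

theorem Thr.unique {Gs : ℕ → GT} {K : ℕ → ℕ} {cs : ∀ m, Cov (K m) (Gs (m+1)) (Gs m)} (hK : Monotone K)
    (t t' : Thr cs) (m : ℕ)
    (h : t.1 m = t'.1 m) (hl : (Gs m).lev (t.1 m) ≤ K m) : t = t' := by
  have hl' : (Gs 0).lev (t.1 0) ≤ K m := by rwa [Thr.lev] at hl
  have hl'' : (Gs 0).lev (t'.1 0) ≤ K m := by rw [h, Thr.lev] at hl; exact hl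
  have up : ∀ j, m ≤ j → t.1 j = t'.1 j := by
    intro j hj
    induction j, hj using Nat.le_induction with
    | base => exact h
    | succ j hj ih =>
      have := hK hj
      apply (cs j).inj
      · rw [Thr.lev]; omega
      · rw [Thr.lev]; omega
      · rw [t.2, t'.2, ih]
  have down : ∀ i, i ≤ m → t.1 (m - i) = t'.1 (m - i) := by
    intro i
    induction i with
    | zero => intro _; exact h
    | succ i ih =>
      intro hi
      have h2 := ih (by omega)
      have e : m - i = m - (i+1) + 1 := by omega
      rw [e] at h2
      rw [← t.2, ← t'.2, h2]
  apply Subtype.ext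
  funext j
  rcases Nat.lt_or_ge j m with hj | hj
  · have := down (m - j) (by omega)
    rwa [Nat.sub_sub_self hj.le] at this
  · exact up j hj

theorem Thr.exists0 {Gs : ℕ → GT} {K : ℕ → ℕ} (cs : ∀ m, Cov (K m) (Gs (m+1)) (Gs m)) (hK : Monotone K)
    (p : (Gs 0).Pos) (hp : (Gs 0).lev p ≤ K 0) : ∃ t : Thr cs, t.1 0 = p := by
  let A : ℕ → Type := fun m => {q : (Gs m).Pos // (Gs m).lev q ≤ K 0}
  have step : ∀ m, ∀ q : A m, ∃ q' : A (m+1), (cs m).π q'.1 = q.1 := by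
    intro m q
    obtain ⟨q', hq'⟩ := (cs m).surj q.1 (q.2.trans (hK (Nat.zero_le m)))
    exact ⟨⟨q', by rw [← (cs m).lev_π, hq']; exact q.2⟩, hq'⟩
  choose f hf using step
  let u : ∀ m, A m := fun m => Nat.rec (motive := A) ⟨p, hp⟩ (fun m q => f m q) m
  exact ⟨⟨fun m => (u m).1, fun m => hf m (u m)⟩, rfl⟩

theorem Thr.exists {Gs : ℕ → GT} {K : ℕ → ℕ} (cs : ∀ m, Cov (K m) (Gs (m+1)) (Gs m)) (hK : Monotone K)
    (m : ℕ) (p : (Gs m).Pos) (hp : (Gs m).lev p ≤ K m) : ∃ t : Thr cs, t.1 m = p := by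
  induction m generalizing Gs K with
  | zero => exact Thr.exists0 cs hK p hp
  | succ m ih =>
    obtain ⟨t, ht⟩ := ih (Gs := fun n => Gs (n+1)) (K := fun n => K (n+1)) (fun n => cs (n+1))
      (fun a b h => hK (by omega)) p hp
    refine ⟨⟨fun n => Nat.casesOn (motive := fun n => (Gs n).Pos) n ((cs 0).π (t.1 0)) (fun n => t.1 n), ?_⟩, ht⟩
    intro n
    cases n with
    | zero => rfl
    | succ n => exact t.2 n

variable {Gs : ℕ → GT} {K : ℕ → ℕ} (cs : ∀ m, Cov (K m) (Gs (m+1)) (Gs m))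
  (hK : Monotone K) (hK2 : ∀ m, m ≤ K m)

open Classical in
noncomputable def ipar (t : Thr cs) : Thr cs :=
  if h : (Gs 0).lev (t.1 0) = 0 then t else
  ⟨fun m => (Gs m).par (t.1 m), fun m => by
    rw [← (cs m).par_π _ (by rw [t.lev]; omega), t.2]⟩

theorem ipar_apply {t : Thr cs} (h : (Gs 0).lev (t.1 0) ≠ 0) (m : ℕ) :
    (ipar cs t).1 m = (Gs m).par (t.1 m) := by
  unfold ipar; rw [dif_neg h]

noncomputable abbrev IG : GT where
  Pos := Thr cs
  lev := fun t => (Gs 0).lev (t.1 0)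
  par := ipar cs
  lev_par := fun t => by
    by_cases h : (Gs 0).lev (t.1 0) = 0
    · unfold ipar; rw [dif_pos h]; omega
    · rw [ipar_apply cs h, (Gs 0).lev_par]
  ex := fun t => by
    obtain ⟨n, hn⟩ : ∃ n, n = (Gs 0).lev (t.1 0) := ⟨_, rfl⟩
    have hk := hK2 (n+1)
    have hc := dflt_child (G := Gs (n+1)) (t.1 (n+1))
    have hl : (Gs (n+1)).lev ((Gs (n+1)).dflt (t.1 (n+1))) = n + 1 := by rw [hc.1, t.lev, hn]
    obtain ⟨t', ht'⟩ := Thr.exists cs hK (n+1) _ (by rw [hl]; exact hk)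
    have hl' : (Gs 0).lev (t'.1 0) = n + 1 := by rw [← t'.lev (n+1), ht', hl]
    refine ⟨t', by rw [hl', hn], ?_⟩
    have e : (ipar cs t').1 (n+1) = t.1 (n+1) := by
      rw [ipar_apply cs (by omega), ht', hc.2]
    refine Thr.unique hK _ _ (n+1) e ?_
    rw [e, t.lev]; omega

theorem iproj_child {t t' : (IG cs hK hK2).Pos} (h : (IG cs hK hK2).Child t t') (m : ℕ) :
    (Gs m).Child (t.1 m) (t'.1 m) := by
  have h1 : (Gs 0).lev (t'.1 0) = (Gs 0).lev (t.1 0) + 1 := h.1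
  have h2 : ipar cs t' = t := h.2
  refine ⟨by rw [t.lev, t'.lev, h1], ?_⟩
  rw [← h2, ipar_apply cs (by omega)]

theorem iproj_play {x : ℕ → (IG cs hK hK2).Pos} (h : (IG cs hK hK2).Play x) (m : ℕ) :
    (Gs m).Play (fun n => (x n).1 m) :=
  ⟨fun n => by rw [Thr.lev]; exact h.1 n, fun n => (iproj_child cs hK hK2 (h.child n) m).2⟩

open Classical in
noncomputable def thr (m : ℕ) (p : (Gs m).Pos) (hp : (Gs m).lev p ≤ K m) : Thr cs :=
  (Thr.exists cs hK m p hp).choose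
theorem thr_spec (m : ℕ) (p : (Gs m).Pos) (hp : (Gs m).lev p ≤ K m) : (thr cs hK m p hp).1 m = p :=
  (Thr.exists cs hK m p hp).choose_spec
theorem thr_eq (m : ℕ) (t : Thr cs) (hp : (Gs m).lev (t.1 m) ≤ K m) : thr cs hK m (t.1 m) hp = t :=
  Thr.unique hK _ _ m (thr_spec cs hK m _ hp) (by rw [thr_spec]; exact hp)

variable (s : (IG cs hK hK2).Pos → (IG cs hK hK2).Pos)

open Classical in
noncomputable def sg (m : ℕ) (p : (Gs m).Pos) : (Gs m).Pos :=
  if h : (Gs m).lev p < K m then (s (thr cs hK m p h.le)).1 m else (Gs m).dflt p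

theorem sg_apply (t : Thr cs) (m : ℕ) (h : (Gs m).lev (t.1 m) < K m) :
    sg cs hK hK2 s m (t.1 m) = (s t).1 m := by
  unfold sg; rw [dif_pos h, thr_eq]

theorem sg_strat (hs : (IG cs hK hK2).Strat s) (m : ℕ) : (Gs m).Strat (sg cs hK hK2 s m) := by
  intro p
  by_cases h : (Gs m).lev p < K m
  · unfold sg; rw [dif_pos h]
    have := iproj_child cs hK hK2 (hs (thr cs hK m p h.le)) m
    rwa [thr_spec] at this
  · unfold sg; rw [dif_neg h]; exact dflt_child p

noncomputable def SS (b : Bool) : ℕ → ∀ m, (Gs m).Pos → (Gs m).Pos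
  | 0 => fun m => sg cs hK hK2 s m
  | i+1 => fun m => (cs m).φ b (SS b i (m+1))

variable {s}

theorem SS_strat (hs : (IG cs hK hK2).Strat s) (b : Bool) (i m : ℕ) : (Gs m).Strat (SS cs hK hK2 s b i m) := by
  induction i generalizing m with
  | zero => exact sg_strat cs hK hK2 s hs m
  | succ i ih => exact (cs m).strat _ _ (ih (m+1))

theorem SS_A (hs : (IG cs hK hK2).Strat s) (b : Bool) (i m : ℕ) (p : (Gs m).Pos) (hp : (Gs m).lev p < K m) :
    SS cs hK hK2 s b i m p = sg cs hK hK2 s m p := by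
  induction i generalizing m with
  | zero => rfl
  | succ i ih =>
    obtain ⟨t, rfl⟩ := Thr.exists cs hK m p hp.le
    have hm := hK (Nat.le_succ m)
    have e : t.1 m = (cs m).π (t.1 (m+1)) := (t.2 m).symm
    have hl : (Gs (m+1)).lev (t.1 (m+1)) < K m := by rw [t.lev] at hp ⊢; exact hp
    rw [sg_apply _ _ _ _ _ _ hp]
    show (cs m).φ b (SS cs hK hK2 s b i (m+1)) (t.1 m) = _
    rw [e, (cs m).agree _ _ _ (SS_strat cs hK hK2 hs b i (m+1)) hl, ih (m+1) _ (hl.trans_le hm),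
      sg_apply _ _ _ _ _ _ (hl.trans_le hm), (s t).2]

theorem SS_B (hs : (IG cs hK hK2).Strat s) (b : Bool) (i m : ℕ) (p : (Gs m).Pos) (hp : (Gs m).lev p < K (m+i)) :
    SS cs hK hK2 s b (i+1) m p = SS cs hK hK2 s b i m p := by
  induction i generalizing m with
  | zero => exact SS_A cs hK hK2 hs b 1 m p hp
  | succ i ih =>
    refine (cs m).loc b _ _ (K (m+(i+1))) (SS_strat cs hK hK2 hs b (i+1) (m+1))
      (SS_strat cs hK hK2 hs b i (m+1)) (fun q hq => ?_) p hp
    refine ih (m+1) q ?_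
    rwa [show m + 1 + i = m + (i+1) by omega]

theorem SS_B' (hs : (IG cs hK hK2).Strat s) (b : Bool) (m : ℕ) (p : (Gs m).Pos) (i : ℕ) (hi : (Gs m).lev p < i) :
    SS cs hK hK2 s b i m p = SS cs hK hK2 s b ((Gs m).lev p + 1) m p := by
  induction i, hi using Nat.le_induction with
  | base => rfl
  | succ i hi ih =>
    rw [← ih]; apply SS_B cs hK hK2 hs b
    have := hK2 (m+i); simp only [Nat.succ_eq_add_one] at hi; omega

variable (s) in
noncomputable def SF (b : Bool) (m : ℕ) (p : (Gs m).Pos) : (Gs m).Pos :=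
  SS cs hK hK2 s b ((Gs m).lev p + 1) m p

theorem SF_strat (hs : (IG cs hK hK2).Strat s) (b : Bool) (m : ℕ) : (Gs m).Strat (SF cs hK hK2 s b m) := fun p =>
  SS_strat cs hK hK2 hs b _ m p

theorem SF_C (hs : (IG cs hK hK2).Strat s) (b : Bool) (m : ℕ) : SF cs hK hK2 s b m = (cs m).φ b (SF cs hK hK2 s b (m+1)) := by
  funext p
  have : (cs m).φ b (SF cs hK hK2 s b (m+1)) p =
      (cs m).φ b (SS cs hK hK2 s b ((Gs m).lev p + 1) (m+1)) p := by
    refine (cs m).loc b _ _ ((Gs m).lev p + 1) (SF_strat cs hK hK2 hs b (m+1))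
      (SS_strat cs hK hK2 hs b _ (m+1)) (fun q hq => ?_) p (by omega)
    exact (SS_B' cs hK hK2 hs b (m+1) q _ hq).symm
  rw [this]
  exact (SS_B' cs hK hK2 hs b m p ((Gs m).lev p + 2) (by omega)).symm

theorem SF_D (hs : (IG cs hK hK2).Strat s) (b : Bool) (m : ℕ) (t : Thr cs) (h : (Gs m).lev (t.1 m) < K m) :
    SF cs hK hK2 s b m (t.1 m) = (s t).1 m := by
  unfold SF
  rw [SS_A cs hK hK2 hs b _ _ _ h, sg_apply _ _ _ _ _ _ h]

noncomputable def icov : Cov (K 0) (IG cs hK hK2) (Gs 0) where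
  π := fun t => t.1 0
  lev_π := fun _ => rfl
  par_π := fun t h => (ipar_apply cs (Nat.pos_iff_ne_zero.1 h) 0).symm
  inj := fun p q hp hq h => Thr.unique hK p q 0 h hp
  surj := fun q hq => Thr.exists cs hK 0 q hq
  φ := fun b s => SF cs hK hK2 s b 0
  strat := fun b s hs => SF_strat cs hK hK2 hs b 0
  loc := by
    intro b s t n hs ht h p hp
    have h0 : ∀ m, ∀ p, (Gs m).lev p < n → sg cs hK hK2 s m p = sg cs hK hK2 t m p := by
      intro m p hp
      unfold sg
      split_ifs with hk
      · rw [h]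
        change (Gs 0).lev ((thr cs hK m p hk.le).1 0) < n
        rw [← (thr cs hK m p hk.le).lev m, thr_spec]; exact hp
      · rfl
    have h1 : ∀ i m, ∀ p, (Gs m).lev p < n → SS cs hK hK2 s b i m p = SS cs hK hK2 t b i m p := by
      intro i
      induction i with
      | zero => exact h0
      | succ i ih =>
        intro m
        exact (cs m).loc b _ _ n (SS_strat cs hK hK2 hs b i (m+1)) (SS_strat cs hK hK2 ht b i (m+1))
          (ih (m+1))
    exact h1 _ 0 p hp
  agree := fun b s t hs hl => SF_D cs hK hK2 hs b 0 t hl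
  lift := by
    intro b s x hs hx hf
    let A : ℕ → Type := fun m => {y : ℕ → (Gs m).Pos // (Gs m).Play y ∧ (Gs m).Follows b (SF cs hK hK2 s b m) y}
    have step : ∀ m, ∀ y : A m, ∃ y' : A (m+1), ∀ n, (cs m).π (y'.1 n) = y.1 n := by
      rintro m ⟨y, hy1, h2⟩
      rw [SF_C cs hK hK2 hs b m] at h2
      obtain ⟨z, h3, h4, h5⟩ := (cs m).lift b _ y (SF_strat cs hK hK2 hs b (m+1)) hy1 h2
      exact ⟨⟨z, h3, h4⟩, h5⟩
    choose f hf' using step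
    let u : ∀ m, A m := fun m => Nat.rec (motive := A) ⟨x, hx, hf⟩ (fun m q => f m q) m
    let y : ℕ → (IG cs hK hK2).Pos := fun n => ⟨fun m => (u m).1 n, fun m => hf' m (u m) n⟩
    have hy : (IG cs hK hK2).Play y := by
      refine ⟨fun n => hx.1 n, fun n => ?_⟩
      apply Subtype.ext; funext m
      show (ipar cs (y (n+1))).1 m = _
      rw [ipar_apply cs]
      · exact (u m).2.1.2 n
      · show (Gs 0).lev (x (n+1)) ≠ 0
        rw [hx.1]; omega
    refine ⟨y, hy, fun n hn => ?_, fun n => rfl⟩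
    have hk := hK2 (n+1)
    have hln : (Gs (n+1)).lev ((y n).1 (n+1)) = n := (u (n+1)).2.1.1 n
    have hln1 : (Gs (n+1)).lev ((y (n+1)).1 (n+1)) = n+1 := (u (n+1)).2.1.1 (n+1)
    refine Thr.unique hK _ _ (n+1) ?_ (by rw [hln1]; exact hk)
    rw [← SF_D cs hK hK2 hs b (n+1) (y n) (by omega)]
    exact (u (n+1)).2.2 n hn

theorem icov_proj (t : (IG cs hK hK2).Pos) : (icov cs hK hK2).π t = t.1 0 := rfl

end invlim
end BD
namespace BD
open BD.GT

def Unr (G : GT) (v : G.Pos → ℕ) (k : ℕ) (X : Set (ℕ → ℕ)) : Prop :=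
  ∃ (G' : GT) (c : Cov k G' G) (m : ℕ) (D : Set G'.Pos), ∀ x, G'.Play x →
    ((fun n => v (c.π (x (n+1)))) ∈ X ↔ x m ∈ D)

theorem Unr.compl {G : GT} {v : G.Pos → ℕ} {k : ℕ} {X : Set (ℕ → ℕ)} (h : Unr G v k X) :
    Unr G v k Xᶜ := by
  obtain ⟨G', c, m, D, h⟩ := h
  exact ⟨G', c, m, Dᶜ, fun x hx => not_congr (h x hx)⟩

theorem Unr.iUnion {X : ℕ → Set (ℕ → ℕ)} (h : ∀ i, ∀ G v k, Unr G v k (X i)) (G : GT) (v : G.Pos → ℕ)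
    (k : ℕ) : Unr G v k (⋃ i, X i) := by
  classical
  let St : ℕ → (Σ G : GT, G.Pos → ℕ) := fun n => Nat.rec ⟨G, v⟩
    (fun i st => ⟨(h i st.1 st.2 (k+i)).choose, fun p =>
      st.2 ((h i st.1 st.2 (k+i)).choose_spec.choose.π p)⟩) n
  let Gs : ℕ → GT := fun m => (St m).1
  let vs : ∀ m, (Gs m).Pos → ℕ := fun m => (St m).2
  let cs : ∀ m, Cov (k+m) (Gs (m+1)) (Gs m) := fun m =>
    (h m (St m).1 (St m).2 (k+m)).choose_spec.choose
  have hvs : ∀ m p, vs (m+1) p = vs m ((cs m).π p) := fun m p => rfl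
  have hdec : ∀ m, ∃ (j : ℕ) (D : Set (Gs (m+1)).Pos), ∀ x, (Gs (m+1)).Play x →
    ((fun n => vs m ((cs m).π (x (n+1)))) ∈ X m ↔ x j ∈ D) := fun m =>
    (h m (St m).1 (St m).2 (k+m)).choose_spec.choose_spec
  choose mm DD hDD using hdec
  have hK : Monotone (fun m => k + m) := fun a b hab => by simp only; omega
  have hK2 : ∀ m, m ≤ k + m := fun m => by omega
  let I := IG cs hK hK2
  have hlab : ∀ m (t : Thr cs), vs m (t.1 m) = v (t.1 0) := by
    intro m t
    induction m with
    | zero => rfl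
    | succ m ih => rw [hvs, t.2, ih]
  have hmem : ∀ x, I.Play x → ((fun n => v ((x (n+1)).1 0)) ∈ ⋃ i, X i ↔ ∃ i, (x (mm i)).1 (i+1) ∈ DD i) := by
    intro x hx
    rw [mem_iUnion]
    refine exists_congr fun i => ?_
    rw [← hDD i _ (iproj_play cs hK hK2 hx (i+1))]
    have : (fun n => v ((x (n+1)).1 0)) = fun n => vs i ((cs i).π ((x (n+1)).1 (i+1))) := by
      funext n; rw [(x (n+1)).2, hlab]
    rw [this]
  let K := 2 * k
  have hKb : K.bodd = false := by simp [K]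
  let U0 : Set I.Pos := {p | K + 2 ≤ I.lev p ∧ ∃ i, mm i ≤ I.lev p ∧ (I.anc p (mm i)).1 (i+1) ∈ DD i}
  have hU0 : ∀ u ∈ U0, K + 2 ≤ I.lev u := fun u hu => hu.1
  have hU : ∀ x, I.Play x → ((∃ i, (x (mm i)).1 (i+1) ∈ DD i) ↔ ∃ n, x n ∈ U0) := by
    intro x hx
    constructor
    · rintro ⟨i, hi⟩
      refine ⟨max (K+2) (mm i), ?_, i, ?_, ?_⟩
      · rw [hx.1]; exact le_max_left _ _
      · rw [hx.1]; exact le_max_right _ _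
      · rw [hx.anc (le_max_right _ _)]; exact hi
    · rintro ⟨n, _, i, h1, h2⟩
      rw [hx.1] at h1
      rw [hx.anc h1] at h2
      exact ⟨i, h2⟩
  refine ⟨UG I K U0 hKb hU0, ((ucov I K U0 hKb hU0).weaken (by omega : k ≤ K)).comp (icov cs hK hK2),
    K + 2, {y | ∃ u, y.1.2.2 = some (.inl u)}, fun y hy => ?_⟩
  have hx : I.Play (fun n => (y n).1.1) := (ucov I K U0 hKb hU0).π_play hy
  exact (hmem _ hx).trans ((hU _ hx).trans (ucov_decides y hy))

@[reducible] def unrMS : MeasurableSpace (ℕ → ℕ) where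
  MeasurableSet' := fun X => ∀ G v k, Unr G v k X
  measurableSet_empty := fun G v k => ⟨G, Cov.id k G, 0, ∅, fun x _ => by simp⟩
  measurableSet_compl := fun X h G v k => (h G v k).compl
  measurableSet_iUnion := fun X h G v k => Unr.iUnion h G v k

theorem unr_borel {X : Set (ℕ → ℕ)} (hX : MeasurableSet X) : ∀ G v k, Unr G v k X := by
  have : (MeasurableSpace.pi : MeasurableSpace (ℕ → ℕ)) ≤ unrMS := by
    refine iSup_le fun n => ?_
    rintro _ ⟨T, -, rfl⟩
    intro G v k
    exact ⟨G, Cov.id k G, n + 1, {p | v p ∈ T}, fun x _ => Iff.rfl⟩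
  exact this X hX

/-- clopen determinacy -/
theorem clopen_det (G : GT) (m : ℕ) (D : Set G.Pos) (r : G.Pos) (_hr : G.lev r = 0) :
    (∃ s, G.Strat s ∧ ∀ x, G.Play x → x 0 = r → G.Follows false s x → x m ∈ D) ∨
    (∃ s, G.Strat s ∧ ∀ x, G.Play x → x 0 = r → G.Follows true s x → x m ∉ D) := by
  classical
  let V : ℕ → G.Pos → Prop := fun i => Nat.rec (fun p => p ∈ D) (fun _ Vi p =>
    if (G.lev p).bodd = false then ∃ c, G.Child p c ∧ Vi c else ∀ c, G.Child p c → Vi c) i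
  have V0 : ∀ p, V 0 p ↔ p ∈ D := fun p => Iff.rfl
  have VS : ∀ i p, V (i+1) p ↔ (if (G.lev p).bodd = false then ∃ c, G.Child p c ∧ V i c
    else ∀ c, G.Child p c → V i c) := fun i p => Iff.rfl
  have hex : ∀ (b : Bool) (p : G.Pos), ∃ c0, G.Child p c0 ∧
      ((∃ c, G.Child p c ∧ (V (m - (G.lev p + 1)) c ↔ b = false)) →
      (V (m - (G.lev p + 1)) c0 ↔ b = false)) := by
    intro b p
    rcases Classical.em (∃ c, G.Child p c ∧ (V (m - (G.lev p + 1)) c ↔ b = false)) with h | h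
    · exact ⟨h.choose, h.choose_spec.1, fun _ => h.choose_spec.2⟩
    · exact ⟨G.dflt p, dflt_child p, fun h' => absurd h' h⟩
  choose s hs hs2 using hex
  have key : ∀ b x, G.Play x → G.Follows b (s b) x → (V m (x 0) ↔ b = false) →
      ∀ n ≤ m, (V (m - n) (x n) ↔ b = false) := by
    intro b x hx hf h0 n
    induction n with
    | zero => intro _; exact h0
    | succ n ih =>
      intro hn
      have h1 := ih (by omega)
      have e : m - n = (m - (n+1)) + 1 := by omega
      rw [e, VS, hx.1] at h1
      by_cases hb : n.bodd = b
      · rw [hf n hb]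
        have := hs2 b (x n)
        rw [hx.1] at this
        apply this
        cases b with
        | false =>
          rw [if_pos hb] at h1
          obtain ⟨c, hc1, hc2⟩ := h1.2 rfl
          exact ⟨c, hc1, by simpa using hc2⟩
        | true =>
          rw [if_neg (by rw [hb]; simp)] at h1
          have h2 : ¬ ∀ c, G.Child (x n) c → V (m - (n+1)) c := fun h => by simpa using h1.1 h
          push Not at h2
          obtain ⟨c, hc1, hc2⟩ := h2
          exact ⟨c, hc1, by simpa using hc2⟩
      · cases b with
        | false =>
          rw [if_neg hb] at h1
          have := h1.2 rfl _ (hx.child n)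
          simpa using this
        | true =>
          have hb' : n.bodd = false := by simpa using hb
          rw [if_pos hb'] at h1
          have h2 : ¬ ∃ c, G.Child (x n) c ∧ V (m - (n+1)) c := fun h => by simpa using h1.1 h
          have : ¬ V (m - (n+1)) (x (n+1)) := fun h => h2 ⟨_, hx.child n, h⟩
          simpa using this
  rcases Classical.em (V m r) with hV | hV
  · left
    refine ⟨s false, hs false, fun x hx hr0 hf => ?_⟩
    have := key false x hx hf (by rw [hr0]; simpa using hV) m le_rfl
    rw [Nat.sub_self] at this
    exact this.2 rfl
  · right
    refine ⟨s true, hs true, fun x hx hr0 hf => ?_⟩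
    have := key true x hx hf (by rw [hr0]; simpa using hV) m le_rfl
    rw [Nat.sub_self] at this
    intro h
    simpa using this.1 h

def LG : GT where
  Pos := List ℕ
  lev := List.length
  par := List.tail
  lev_par := fun p => by simp
  ex := fun p => ⟨0 :: p, by simp, rfl⟩

def pl (x : ℕ → ℕ) : ℕ → List ℕ
  | 0 => []
  | n+1 => x n :: pl x n

theorem pl_length (x : ℕ → ℕ) (n : ℕ) : (pl x n).length = n := by
  induction n with
  | zero => rfl
  | succ n ih => simp [pl, ih]

theorem pl_play (x : ℕ → ℕ) : LG.Play (pl x) := ⟨pl_length x, fun n => rfl⟩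

theorem determinacy {X : Set (ℕ → ℕ)} (hX : MeasurableSet X) :
    (∃ s : List ℕ → ℕ, ∀ x : ℕ → ℕ, (∀ n, n.bodd = false → x n = s (pl x n)) → x ∈ X) ∨
    (∃ s : List ℕ → ℕ, ∀ x : ℕ → ℕ, (∀ n, n.bodd = true → x n = s (pl x n)) → x ∉ X) := by
  obtain ⟨G', c, m, D, h⟩ := unr_borel hX LG (fun p => p.headD 0) 0
  obtain ⟨r, hr⟩ := c.surj ([] : List ℕ) (le_refl 0)
  have hr0 : G'.lev r = 0 := by rw [← c.lev_π, hr]; rfl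
  have key : ∀ b s, G'.Strat s → ∀ x : ℕ → ℕ,
      (∀ n, n.bodd = b → x n = List.headD (c.φ b s (pl x n)) 0) →
      ∃ y, G'.Play y ∧ y 0 = r ∧ G'.Follows b s y ∧ (x ∈ X ↔ y m ∈ D) := by
    intro b s hs x hx
    obtain ⟨y, h1, h2, h3⟩ := c.lift b s (pl x) hs (pl_play x) (by
      intro n hn
      have hc : LG.Child (pl x n) (c.φ b s (pl x n)) := c.strat b s hs (pl x n)
      have h1 : List.length (c.φ b s (pl x n)) = List.length (pl x n) + 1 := hc.1
      have h2 : List.tail (c.φ b s (pl x n)) = pl x n := hc.2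
      show x n :: pl x n = _
      rw [hx n hn]
      generalize c.φ b s (pl x n) = q at h1 h2
      cases q with
      | nil => simp at h1
      | cons a q => simp only [List.tail_cons] at h2; simp [h2])
    refine ⟨y, h1, ?_, h2, ?_⟩
    · apply c.inj _ _ (h1.1 0).le hr0.le
      rw [h3, hr]; rfl
    · rw [← h y h1]
      have : (fun n => List.headD (c.π (y (n+1))) 0) = x := by
        funext n; rw [h3]; rfl
      rw [this]
  rcases clopen_det G' m D r hr0 with ⟨s, hs, h'⟩ | ⟨s, hs, h'⟩
  · left
    refine ⟨fun p => List.headD (c.φ false s p) 0, fun x hx => ?_⟩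
    obtain ⟨y, h1, h2, h3, h4⟩ := key false s hs x hx
    exact h4.2 (h' y h1 h2 h3)
  · right
    refine ⟨fun p => List.headD (c.φ true s p) 0, fun x hx => ?_⟩
    obtain ⟨y, h1, h2, h3, h4⟩ := key true s hs x hx
    exact fun h => h' y h1 h2 h3 (h4.1 h)

end BD

/-- finite dependence gives continuity -/
theorem cont_of_dep {α β : Type*} [TopologicalSpace α] [DiscreteTopology α] [TopologicalSpace β]
    {f : (ℕ → α) → β} (m : ℕ) (h : ∀ x y, (∀ i < m, x i = y i) → f x = f y) : Continuous f := by
  refine IsLocallyConstant.continuous ?_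
  rw [IsLocallyConstant.iff_exists_open]
  intro x
  refine ⟨⋂ i ∈ Finset.range m, {y | y i = x i}, ?_, by simp, ?_⟩
  · refine isOpen_biInter_finset fun i _ => ?_
    show IsOpen ((fun y : ℕ → α => y i) ⁻¹' {x i})
    exact (isOpen_discrete ({x i} : Set α)).preimage (continuous_apply (A := fun _ => α) i)
  · intro y hy
    refine h y x fun i hi => ?_
    simp only [mem_iInter, Finset.mem_range] at hy
    exact hy i hi

def ev (x : ℕ → ℕ) : ℕ → ℕ := fun n => x (2*n)
def od (x : ℕ → ℕ) : ℕ → ℕ := fun n => x (2*n+1)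
def il (a b : ℕ → ℕ) : ℕ → ℕ := fun n => if n.bodd then b n.div2 else a n.div2
theorem il_ev (a b : ℕ → ℕ) (n : ℕ) : il a b (2*n) = a n := by
  simp [il, Nat.div2_val]
theorem il_od (a b : ℕ → ℕ) (n : ℕ) : il a b (2*n+1) = b n := by
  have : (2*n+1)/2 = n := by omega
  simp [il, Nat.div2_val, this]
theorem ev_il (a b : ℕ → ℕ) : ev (il a b) = a := funext fun n => il_ev a b n
theorem od_il (a b : ℕ → ℕ) : od (il a b) = b := funext fun n => il_od a b n

theorem wadge_lemma {A D : Set (ℕ → ℕ)} (hA : MeasurableSet A) (hD : MeasurableSet D) :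
    (∃ ρ : (ℕ → ℕ) → ℕ → ℕ, Continuous ρ ∧ ∀ z, z ∈ A ↔ ρ z ∈ D) ∨
    (∃ ρ : (ℕ → ℕ) → ℕ → ℕ, Continuous ρ ∧ (∀ b b' n, (∀ i < n, b i = b' i) → ρ b n = ρ b' n) ∧
      ∀ z, z ∈ D ↔ ρ z ∉ A) := by
  have hev : Measurable ev := measurable_pi_lambda _ fun n => measurable_pi_apply _
  have hod : Measurable od := measurable_pi_lambda _ fun n => measurable_pi_apply _
  have hX : MeasurableSet {x : ℕ → ℕ | ¬ (x ∈ ev ⁻¹' A ↔ x ∈ od ⁻¹' D)} :=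
    (MeasurableSet.iff (hev hA) (hod hD)).compl
  have parity : ∀ n : ℕ, (n.bodd = false → ∃ k, n = 2*k) ∧ (n.bodd = true → ∃ k, n = 2*k+1) := by
    intro n
    have := Nat.bodd_add_div2 n
    constructor
    · intro h; rw [h] at this; exact ⟨n.div2, by simp at this; omega⟩
    · intro h; rw [h] at this; exact ⟨n.div2, by simp at this; omega⟩
  rcases BD.determinacy hX with ⟨s, hs⟩ | ⟨s, hs⟩
  · right
    let L : (ℕ → ℕ) → ℕ → List ℕ := fun b n => Nat.rec [] (fun n l => b n :: s l :: l) n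
    have LS : ∀ b n, L b (n+1) = b n :: s (L b n) :: L b n := fun b n => rfl
    have Ldep : ∀ b b' n, (∀ i < n, b i = b' i) → L b n = L b' n := by
      intro b b' n
      induction n with
      | zero => intro _; rfl
      | succ n ih => intro h; rw [LS, LS, ih (fun i hi => h i (by omega)), h n (by omega)]
    refine ⟨fun b n => s (L b n), continuous_pi fun n => cont_of_dep n fun b b' h => by
      show s _ = s _; rw [Ldep b b' n h], fun b b' n h => by
      show s _ = s _; rw [Ldep b b' n h], fun b => ?_⟩
    have hpl : ∀ n, BD.pl (il (fun n => s (L b n)) b) (2*n) = L b n := by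
      intro n
      induction n with
      | zero => rfl
      | succ n ih =>
        rw [LS, show 2*(n+1) = 2*n+1+1 by ring]
        simp only [BD.pl, il_od, il_ev, ih]
    have := hs (il (fun n => s (L b n)) b) (by
      intro n hn
      obtain ⟨k, rfl⟩ := (parity n).1 hn
      rw [hpl, il_ev])
    have e1 : ev (il (fun n => s (L b n)) b) = fun n => s (L b n) := ev_il _ _
    have e2 : od (il (fun n => s (L b n)) b) = b := od_il _ _
    simp only [mem_ofPred_eq, mem_preimage, e1, e2] at this
    tauto
  · left
    let L : (ℕ → ℕ) → ℕ → List ℕ := fun a n => Nat.rec [] (fun n l => s (a n :: l) :: a n :: l) n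
    have LS : ∀ b n, L b (n+1) = s (b n :: L b n) :: b n :: L b n := fun b n => rfl
    have Ldep : ∀ b b' n, (∀ i < n, b i = b' i) → L b n = L b' n := by
      intro b b' n
      induction n with
      | zero => intro _; rfl
      | succ n ih => intro h; rw [LS, LS, ih (fun i hi => h i (by omega)), h n (by omega)]
    refine ⟨fun a n => s (a n :: L a n), continuous_pi fun n => cont_of_dep (n+1) fun b b' h => by
      show s _ = s _; rw [Ldep b b' n (fun i hi => h i (by omega)), h n (by omega)], fun a => ?_⟩
    have hpl : ∀ n, BD.pl (il a (fun n => s (a n :: L a n))) (2*n) = L a n := by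
      intro n
      induction n with
      | zero => rfl
      | succ n ih =>
        rw [LS, show 2*(n+1) = 2*n+1+1 by ring]
        simp only [BD.pl, il_od, il_ev, ih]
    have := hs (il a (fun n => s (a n :: L a n))) (by
      intro n hn
      obtain ⟨k, rfl⟩ := (parity n).2 hn
      rw [BD.pl, hpl, il_od, il_ev])
    have e1 : ev (il a (fun n => s (a n :: L a n))) = a := ev_il _ _
    have e2 : od (il a (fun n => s (a n :: L a n))) = fun n => s (a n :: L a n) := od_il _ _
    simp only [mem_ofPred_eq, mem_preimage, e1, e2] at this
    tauto

def agr {α : Type*} (n : ℕ) (x y : ℕ → α) : Prop := ∀ i < n, x i = y i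

theorem agr.symm {α : Type*} {n : ℕ} {x y : ℕ → α} (h : agr n x y) : agr n y x := fun i hi => (h i hi).symm
theorem agr.trans {α : Type*} {n : ℕ} {x y z : ℕ → α} (h : agr n x y) (h' : agr n y z) : agr n x z :=
  fun i hi => (h i hi).trans (h' i hi)
theorem agr.mono {α : Type*} {m n : ℕ} {x y : ℕ → α} (h : agr n x y) (hm : m ≤ n) : agr m x y :=
  fun i hi => h i (by omega)
theorem agr_refl {α : Type*} (n : ℕ) (x : ℕ → α) : agr n x x := fun _ _ => rfl

section
variable {α β : Type*} [TopologicalSpace α] [DiscreteTopology α] [TopologicalSpace β] [DiscreteTopology β]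

theorem open_agr {O : Set (ℕ → α)} : IsOpen O ↔ ∀ x ∈ O, ∃ n, ∀ u, agr n x u → u ∈ O := by
  constructor
  · intro h x hx
    obtain ⟨s, ⟨y, n, rfl⟩, hxs, hs⟩ := (PiNat.isTopologicalBasis_cylinders (fun _ : ℕ => α)).exists_subset_of_mem_open hx h
    refine ⟨n, fun u hu => hs ?_⟩
    rw [PiNat.mem_cylinder_iff] at hxs ⊢
    intro i hi
    rw [← hu i hi, hxs i hi]
  · intro h
    rw [isOpen_iff_forall_mem_open]
    intro x hx
    obtain ⟨n, hn⟩ := h x hx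
    refine ⟨PiNat.cylinder x n, fun u hu => hn u ?_, PiNat.isOpen_cylinder (fun _ : ℕ => α) x n, PiNat.self_mem_cylinder x n⟩
    rw [PiNat.mem_cylinder_iff] at hu
    exact fun i hi => (hu i hi).symm

theorem closed_agr {O : Set (ℕ → α)} : IsClosed O ↔ ∀ x, (∀ n, ∃ u ∈ O, agr n x u) → x ∈ O := by
  rw [← isOpen_compl_iff, open_agr]
  constructor
  · intro h x hx
    by_contra hc
    obtain ⟨n, hn⟩ := h x hc
    obtain ⟨u, hu, hu'⟩ := hx n
    exact hn u hu' hu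
  · intro h x hx
    by_contra hc
    push Not at hc
    refine hx (h x fun n => ?_)
    obtain ⟨u, hu, hu'⟩ := hc n
    exact ⟨u, by simpa using hu', hu⟩

theorem open_cyl (n : ℕ) (x : ℕ → α) : IsOpen {u | agr n x u} :=
  open_agr.2 fun y hy => ⟨n, fun u hu => agr.trans hy hu⟩

theorem closed_cyl (n : ℕ) (x : ℕ → α) : IsClosed {u | agr n x u} :=
  closed_agr.2 fun y hy => by
    obtain ⟨u, hu, hu'⟩ := hy n
    exact agr.trans hu hu'.symm

theorem cont_agr {f : (ℕ → α) → ℕ → β} : Continuous f ↔ ∀ x k, ∃ n, ∀ u, agr n x u → agr k (f x) (f u) := by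
  constructor
  · intro h x k
    exact open_agr.1 ((open_cyl k (f x)).preimage h) x (agr_refl _ _)
  · intro h
    rw [continuous_def]
    intro O hO
    rw [open_agr] at hO ⊢
    intro x hx
    obtain ⟨k, hk⟩ := hO _ hx
    obtain ⟨n, hn⟩ := h x k
    exact ⟨n, fun u hu => hk _ (hn u hu)⟩

theorem contOn_agr {H : Set (ℕ → α)} {f : (ℕ → α) → ℕ → β} :
    ContinuousOn f H ↔ ∀ x ∈ H, ∀ k, ∃ n, ∀ u ∈ H, agr n x u → agr k (f x) (f u) := by
  rw [continuousOn_iff']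
  constructor
  · intro h x hx k
    obtain ⟨u, hu, he⟩ := h _ (open_cyl k (f x))
    have : x ∈ u ∩ H := by rw [← he]; exact ⟨agr_refl _ _, hx⟩
    obtain ⟨n, hn⟩ := open_agr.1 hu x this.1
    refine ⟨n, fun v hv hxv => ?_⟩
    have : v ∈ u ∩ H := ⟨hn v hxv, hv⟩
    rw [← he] at this
    exact this.1
  · intro h O hO
    refine ⟨⋃ x ∈ H ∩ f ⁻¹' O, ⋃ n ∈ {n : ℕ | ∀ u ∈ H, agr n x u → f u ∈ O}, {u | agr n x u}, ?_, ?_⟩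
    · exact isOpen_biUnion fun x _ => isOpen_biUnion fun n _ => open_cyl n x
    · ext y
      simp only [mem_inter_iff, mem_preimage, mem_iUnion]
      constructor
      · rintro ⟨h1, h2⟩
        refine ⟨⟨y, ⟨h2, h1⟩, ?_⟩, h2⟩
        obtain ⟨k, hk⟩ := open_agr.1 hO _ h1
        obtain ⟨n, hn⟩ := h y h2 k
        exact ⟨n, fun u hu hyu => hk _ (hn u hu hyu), agr_refl _ _⟩
      · rintro ⟨⟨x, hx, n, hn, hxy⟩, h2⟩
        exact ⟨hn y h2 hxy, h2⟩
end

/-! Fσ sets -/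
def Fs {Y : Type*} [TopologicalSpace Y] (A : Set Y) : Prop :=
  ∃ F : ℕ → Set Y, (∀ n, IsClosed (F n)) ∧ A = ⋃ n, F n

section
variable {Y Y' : Type*} [TopologicalSpace Y] [TopologicalSpace Y']

theorem fs_iff {A : Set Y} : Fs A ↔ IsGδ Aᶜ := by
  rw [isGδ_iff_eq_iInter_nat]
  constructor
  · rintro ⟨F, hF, rfl⟩
    exact ⟨fun n => (F n)ᶜ, fun n => (hF n).isOpen_compl, compl_iUnion _⟩
  · rintro ⟨f, hf, h⟩
    refine ⟨fun n => (f n)ᶜ, fun n => (hf n).isClosed_compl, ?_⟩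
    rw [← compl_iInter, ← h, compl_compl]

theorem IsClosed.fs {A : Set Y} (h : IsClosed A) : Fs A := ⟨fun _ => A, fun _ => h, by simp [iUnion_const]⟩
theorem IsOpen.fs [PerfectlyNormalSpace Y] {A : Set Y} (h : IsOpen A) : Fs A :=
  fs_iff.2 h.isClosed_compl.isGδ
theorem Fs.iUnion {ι : Type*} [Countable ι] {A : ι → Set Y} (h : ∀ i, Fs (A i)) : Fs (⋃ i, A i) := by
  rw [fs_iff, compl_iUnion]
  exact IsGδ.iInter fun i => fs_iff.1 (h i)
theorem Fs.union {A B : Set Y} (h : Fs A) (h' : Fs B) : Fs (A ∪ B) := by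
  rw [fs_iff, compl_union]; exact (fs_iff.1 h).inter (fs_iff.1 h')
theorem Fs.inter {A B : Set Y} (h : Fs A) (h' : Fs B) : Fs (A ∩ B) := by
  rw [fs_iff, compl_inter]; exact (fs_iff.1 h).union (fs_iff.1 h')
theorem Fs.preimage {A : Set Y'} (h : Fs A) {f : Y → Y'} (hf : Continuous f) : Fs (f ⁻¹' A) := by
  rw [fs_iff]; exact (fs_iff.1 h).preimage hf
theorem Fs.measurable [MeasurableSpace Y] [BorelSpace Y] {A : Set Y} (h : Fs A) : MeasurableSet A := by
  obtain ⟨F, hF, rfl⟩ := h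
  exact MeasurableSet.iUnion fun n => (hF n).measurableSet

theorem IsClosed.forall {ι : Sort*} {A : ι → Set Y} (h : ∀ i, IsClosed (A i)) : IsClosed {x | ∀ i, x ∈ A i} := by
  have : {x | ∀ i, x ∈ A i} = ⋂ i, A i := by ext; simp
  rw [this]; exact isClosed_iInter h

def Sig2 (F : Y → ℕ → ℕ) : Prop := ∀ n k, Fs {x | F x n = k}

theorem Sig2.comp_cont {F : Y' → ℕ → ℕ} (h : Sig2 F) {g : Y → Y'} (hg : Continuous g) : Sig2 (fun x => F (g x)) :=
  fun n k => (h n k).preimage hg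

theorem Sig2.cyl {F : Y → ℕ → ℕ} (h : Sig2 F) (y : ℕ → ℕ) (n : ℕ) : Fs {x | agr n y (F x)} := by
  induction n with
  | zero =>
    have : {x : Y | agr 0 y (F x)} = univ := by ext x; simp [agr]
    rw [this]; exact isClosed_univ.fs
  | succ n ih =>
    have : {x : Y | agr (n+1) y (F x)} = {x | agr n y (F x)} ∩ {x | F x n = y n} := by
      ext x
      constructor
      · exact fun hx => ⟨hx.mono (by omega), (hx n (by omega)).symm⟩
      · rintro ⟨h1, h2⟩ i hi
        rcases Nat.lt_succ_iff_lt_or_eq.1 hi with hi | rfl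
        · exact h1 i hi
        · exact h2.symm
    rw [this]; exact ih.inter (h n _)

theorem Sig2.open {F : Y → ℕ → ℕ} (h : Sig2 F) {O : Set (ℕ → ℕ)} (hO : IsOpen O) : Fs (F ⁻¹' O) := by
  have : F ⁻¹' O = ⋃ l : {l : List ℕ // ∀ u, agr l.length (fun i => l.getD i 0) u → u ∈ O},
      {x | agr l.1.length (fun i => l.1.getD i 0) (F x)} := by
    ext x
    simp only [mem_preimage, mem_iUnion]
    constructor
    · intro hx
      obtain ⟨n, hn⟩ := open_agr.1 hO _ hx
      have hl : ((List.range n).map (F x)).length = n := by simp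
      have hag : agr n (fun i => ((List.range n).map (F x)).getD i 0) (F x) := by
        intro i hi
        simp [List.getD, hi]
      refine ⟨⟨(List.range n).map (F x), fun u hu => hn u ?_⟩, ?_⟩
      · rw [hl] at hu; exact hag.symm.trans hu
      · exact hag.mono hl.le
    · rintro ⟨⟨l, hl⟩, hx⟩
      exact hl _ hx
  rw [this]
  exact Fs.iUnion fun l => h.cyl _ _

theorem Sig2.cont_comp {F : Y → ℕ → ℕ} (h : Sig2 F) {Ψ : (ℕ → ℕ) → ℕ → ℕ} (hΨ : Continuous Ψ) :
    Sig2 (fun x => Ψ (F x)) := fun n k => by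
  have : IsOpen {y | Ψ y n = k} := by
    show IsOpen ((fun y => Ψ y n) ⁻¹' {k})
    exact (isOpen_discrete _).preimage ((continuous_apply n).comp hΨ)
  exact h.open this

theorem Sig2.measurable [MeasurableSpace Y] [BorelSpace Y] {F : Y → ℕ → ℕ} (h : Sig2 F) : Measurable F :=
  measurable_pi_iff.2 fun n => measurable_to_countable' fun k => (h n k).measurable

theorem Continuous.sig2 [PerfectlyNormalSpace Y] {F : Y → ℕ → ℕ} (h : Continuous F) : Sig2 F := fun n k => by
  have : IsOpen {y | F y n = k} := by
    show IsOpen ((fun y => F y n) ⁻¹' {k})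
    exact (isOpen_discrete _).preimage ((continuous_apply n).comp h)
  exact this.fs

/-- least-index lemma -/
theorem sig2_least [PerfectlyNormalSpace Y] (L : ℕ → ℕ → Set Y) (hL : ∀ n i, IsClosed (L n i))
    (hc : ∀ n x, ∃ i, x ∈ L n i) (lab : ℕ → ℕ → ℕ) (F : Y → ℕ → ℕ)
    (hF : ∀ x n i, x ∈ L n i → (∀ j < i, x ∉ L n j) → F x n = lab n i) : Sig2 F := by
  classical
  intro n k
  have : {x | F x n = k} = ⋃ i : {i : ℕ // lab n i = k}, (L n i ∩ (⋃ j ∈ Iio i.1, L n j)ᶜ) := by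
    ext x
    simp only [mem_iUnion, mem_inter_iff, mem_compl_iff]
    constructor
    · intro hx
      have h1 := Nat.find_spec (hc n x)
      have h2 : ∀ j < Nat.find (hc n x), x ∉ L n j := fun j hj => Nat.find_min (hc n x) hj
      refine ⟨⟨Nat.find (hc n x), ?_⟩, h1, ?_⟩
      · rw [← hF x n _ h1 h2]; exact hx
      · rintro ⟨j, hj, hj'⟩; exact h2 j hj hj'
    · rintro ⟨⟨i, hi⟩, h1, h2⟩
      have := hF x n i h1 (fun j hj h3 => h2 ⟨j, hj, h3⟩)
      show F x n = k
      rw [this, hi]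
  rw [this]
  refine Fs.iUnion fun i => (hL n i).fs.inter (IsOpen.fs ?_)
  exact ((finite_Iio i.1).isClosed_biUnion fun j _ => hL n j).isOpen_compl

end

theorem retr_agr {Q : Set (ℕ → ℕ)} (hQ : IsClosed Q) (hne : Q.Nonempty) :
    ∃ ρ : (ℕ → ℕ) → ℕ → ℕ, (∀ x ∈ Q, ρ x = x) ∧ (∀ x, ρ x ∈ Q) ∧
      ∀ n x y, agr n x y → agr n (ρ x) (ρ y) := by
  obtain ⟨f, h1, h2, h3⟩ := PiNat.exists_lipschitz_retraction_of_isClosed hQ hne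
  refine ⟨f, h1, fun x => by rw [← h2]; exact mem_range_self x, fun n x y h => ?_⟩
  let _ := PiNat.metricSpace (E := fun _ : ℕ => ℕ)
  have h4 := PiNat.mem_cylinder_iff_dist_le.1 (PiNat.mem_cylinder_iff.2 (fun i hi => h i hi) : x ∈ PiNat.cylinder y n)
  have h5 := h3.dist_le_mul x y
  have h6 : f x ∈ PiNat.cylinder (f y) n := by
    refine PiNat.mem_cylinder_iff_dist_le.2 (le_trans h5 ?_)
    rw [NNReal.coe_one, one_mul]; exact h4
  exact fun i hi => PiNat.mem_cylinder_iff.1 h6 i hi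

theorem common_cover {f g : Cantor → ℕ → ℕ} (hf : Sig2 f) (hg : Sig2 g) :
    ∃ (L : ℕ → ℕ → Set Cantor) (la lb : ℕ → ℕ → ℕ), (∀ n i, IsClosed (L n i)) ∧
      (∀ n x, ∃ i, x ∈ L n i) ∧ ∀ n i, ∀ x ∈ L n i, f x n = la n i ∧ g x n = lb n i := by
  choose Ff hFf hFf' using hf
  choose Fg hFg hFg' using hg
  refine ⟨fun n i => Ff n i.unpair.1.unpair.1 i.unpair.2.unpair.1 ∩ Fg n i.unpair.1.unpair.2 i.unpair.2.unpair.2,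
    fun n i => i.unpair.1.unpair.1, fun n i => i.unpair.1.unpair.2, fun n i => (hFf _ _ _).inter (hFg _ _ _), ?_, ?_⟩
  · intro n x
    have h1 : x ∈ {y | f y n = f x n} := rfl
    have h2 : x ∈ {y | g y n = g x n} := rfl
    rw [hFf', mem_iUnion] at h1
    rw [hFg', mem_iUnion] at h2
    obtain ⟨a, ha⟩ := h1
    obtain ⟨b, hb⟩ := h2
    refine ⟨Nat.pair (Nat.pair (f x n) (g x n)) (Nat.pair a b), ?_⟩
    simp only [Nat.unpair_pair]
    exact ⟨ha, hb⟩
  · rintro n i x ⟨h1, h2⟩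
    constructor
    · have : x ∈ {y | f y n = i.unpair.1.unpair.1} := by rw [hFf']; exact mem_iUnion.2 ⟨_, h1⟩
      exact this
    · have : x ∈ {y | g y n = i.unpair.1.unpair.2} := by rw [hFg']; exact mem_iUnion.2 ⟨_, h2⟩
      exact this

theorem clopen_in_open {O : Set Cantor} (hO : IsOpen O) (hne : O.Nonempty) :
    ∃ V ⊆ O, IsClopen V ∧ V.Nonempty := by
  obtain ⟨x, hx⟩ := hne
  obtain ⟨n, hn⟩ := open_agr.1 hO x hx
  exact ⟨{u | agr n x u}, fun u hu => hn u hu, ⟨closed_cyl n x, open_cyl n x⟩, x, agr_refl _ _⟩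

theorem baire_clopen {V : Set Cantor} (hV : IsClopen V) (hne : V.Nonempty) {L : ℕ → Set Cantor}
    (hL : ∀ i, IsClosed (L i)) (hc : ∀ x, ∃ i, x ∈ L i) : ∃ i, ∃ V' ⊆ V, IsClopen V' ∧ V'.Nonempty ∧ V' ⊆ L i := by
  have : Nonempty V := hne.to_subtype
  have : BaireSpace V := by
    have : CompactSpace V := isCompact_iff_compactSpace.1 hV.1.isCompact
    infer_instance
  obtain ⟨i, x, hx⟩ := nonempty_interior_of_iUnion_of_closed (f := fun i => ((↑) ⁻¹' L i : Set V))
    (fun i => (hL i).preimage continuous_subtype_val) (by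
      ext x; simp only [mem_iUnion, mem_univ, iff_true]; exact hc x)
  have ho : IsOpen ((↑) '' interior ((↑) ⁻¹' L i : Set V) : Set Cantor) :=
    hV.2.isOpenMap_subtype_val _ isOpen_interior
  obtain ⟨V', h1, h2, h3⟩ := clopen_in_open ho ⟨_, x, hx, rfl⟩
  refine ⟨i, V', fun y hy => ?_, h2, h3, fun y hy => ?_⟩
  · obtain ⟨z, _, rfl⟩ := h1 hy; exact z.2
  · obtain ⟨z, hz, rfl⟩ := h1 hy; have := interior_subset hz; exact this

def bits (p : ℕ → ℕ) : Cantor := fun n => (p n).bodd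

theorem bits_cont : Continuous bits :=
  continuous_pi fun n => (continuous_of_discreteTopology (f := Nat.bodd)).comp (continuous_apply n)

theorem flip_step (X V : Set Cantor) (hV : IsClopen V) (hne : V.Nonempty)
    (f g : Cantor → ℕ → ℕ) (hf : Sig2 f) (hg : Sig2 g) (B : Set (ℕ → ℕ))
    (h1 : ∀ x ∈ V, (x ∈ X ↔ f x ∈ B)) (h2 : ∀ x ∈ V, (x ∈ X ↔ g x ∉ B)) :
    ∃ V' ⊆ V, IsClopen V' ∧ V'.Nonempty ∧ ∃ f' : Cantor → ℕ → ℕ, Sig2 f' ∧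
      ∃ c : Bool → (ℕ → ℕ) → ℕ → ℕ, (∀ b p p' n, agr n p p' → c b p n = c b p' n) ∧
        (∀ p, c false p ∈ B ↔ c true p ∉ B) ∧ ∀ x ∈ V', (x ∈ X ↔ c false (f' x) ∈ B) := by
  classical
  obtain ⟨L, la, lb, hL, hc, hlab⟩ := common_cover hf hg
  obtain ⟨i0, V', hVV, hV', hne', hVL⟩ := baire_clopen hV hne (hL 0) (hc 0)
  -- shifted cover
  obtain ⟨M, hM⟩ : ∃ M : ℕ → ℕ → Set Cantor, ∀ n j, M n j = {x | x n = j.bodd} ∩ L (n+1) j.div2 :=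
    ⟨_, fun n j => rfl⟩
  have hMcl : ∀ n j, IsClosed (M n j) := fun n j => by
    rw [hM]
    refine IsClosed.inter ?_ (hL _ _)
    show IsClosed ((fun x : Cantor => x n) ⁻¹' {j.bodd})
    exact (isClosed_discrete _).preimage (continuous_apply n)
  have hMc : ∀ n x, ∃ j, x ∈ M n j := fun n x => by
    obtain ⟨i, hi⟩ := hc (n+1) x
    refine ⟨Nat.bit (x n) i, ?_⟩
    rw [hM]
    simp only [Nat.bodd_bit, Nat.div2_bit]
    exact ⟨rfl, hi⟩
  obtain ⟨Q, hQ⟩ : ∃ Q : Set (ℕ → ℕ), Q = {p | bits p ∈ V' ∧ ∀ n, bits p ∈ L (n+1) (p n).div2} := ⟨_, rfl⟩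
  have hQcl : IsClosed Q := by
    rw [closed_agr]
    intro p hp
    rw [hQ] at hp ⊢
    constructor
    · refine closed_agr.1 (hV'.1.preimage bits_cont) p fun m => ?_
      obtain ⟨u, hu, hu'⟩ := hp m
      exact ⟨u, hu.1, hu'⟩
    · intro n
      refine closed_agr.1 ((hL (n+1) (p n).div2).preimage bits_cont) p fun m => ?_
      obtain ⟨u, hu, hu'⟩ := hp (max m (n+1))
      refine ⟨u, ?_, hu'.mono (le_max_left _ _)⟩
      have := hu.2 n
      rw [← hu' n (lt_of_lt_of_le (Nat.lt_succ_self n) (le_max_right _ _))] at this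
      exact this
  obtain ⟨f', hf'⟩ : ∃ f' : Cantor → ℕ → ℕ, ∀ x n, f' x n = Nat.find (hMc n x) := ⟨_, fun x n => rfl⟩
  have hfM : ∀ x n, x ∈ M n (f' x n) := fun x n => by rw [hf']; exact Nat.find_spec (hMc n x)
  have hbits : ∀ x, bits (f' x) = x := fun x => funext fun n => by
    have := hfM x n
    rw [hM] at this
    exact this.1.symm
  have hfQ : ∀ x ∈ V', f' x ∈ Q := by
    intro x hx
    rw [hQ]
    refine ⟨by rw [hbits]; exact hx, fun n => ?_⟩
    rw [hbits]
    have := hfM x n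
    rw [hM] at this
    exact this.2
  have hQne : Q.Nonempty := by
    obtain ⟨x, hx⟩ := hne'
    exact ⟨_, hfQ x hx⟩
  have hf's : Sig2 f' := by
    refine sig2_least M hMcl hMc (fun _ j => j) f' fun x n i hi hi' => ?_
    rw [hf']
    exact (Nat.find_eq_iff _).2 ⟨hi, fun j hj => hi' j hj⟩
  obtain ⟨ρ, hρ1, hρ2, hρ3⟩ := retr_agr hQcl hQne
  obtain ⟨lc, hlc⟩ : ∃ lc : Bool → ℕ → ℕ → ℕ, lc = fun b => if b then lb else la := ⟨_, rfl⟩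
  obtain ⟨c, hc0, hcS⟩ : ∃ c : Bool → (ℕ → ℕ) → ℕ → ℕ, (∀ b p, c b p 0 = lc b 0 i0) ∧
      ∀ b p n, c b p (n+1) = lc b (n+1) (ρ p n).div2 :=
    ⟨fun b p n => Nat.casesOn n (lc b 0 i0) (fun n => lc b (n+1) (ρ p n).div2), fun b p => rfl, fun b p n => rfl⟩
  have hcf : ∀ p, c false p = f (bits (ρ p)) ∧ c true p = g (bits (ρ p)) := by
    intro p
    have hq := hρ2 p
    rw [hQ] at hq
    constructor
    · funext n
      cases n with
      | zero => rw [hc0, (hlab 0 i0 _ (hVL hq.1)).1, hlc]; rfl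
      | succ n => rw [hcS, (hlab (n+1) _ _ (hq.2 n)).1, hlc]; rfl
    · funext n
      cases n with
      | zero => rw [hc0, (hlab 0 i0 _ (hVL hq.1)).2, hlc]; rfl
      | succ n => rw [hcS, (hlab (n+1) _ _ (hq.2 n)).2, hlc]; rfl
  have hin : ∀ p, bits (ρ p) ∈ V := fun p => by
    have hq := hρ2 p
    rw [hQ] at hq
    exact hVV hq.1
  refine ⟨V', hVV, hV', hne', f', hf's, c, ?_, ?_, ?_⟩
  · intro b p p' n h
    cases n with
    | zero => rw [hc0, hc0]
    | succ n => rw [hcS, hcS, hρ3 (n+1) p p' h n (Nat.lt_succ_self n)]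
  · intro p
    rw [(hcf p).1, (hcf p).2, ← h1 _ (hin p), ← h2 _ (hin p)]
  · intro x hx
    rw [(hcf _).1, hρ1 _ (hfQ x hx), hbits, h1 x (hVV hx)]

def chU (c : ℕ → Bool → (ℕ → ℕ) → ℕ → ℕ) (z : Cantor) (k n : ℕ) : ℕ :=
  c n (z n) (fun j => if _h : j < k then chU c z j (n+1) else 0) k
termination_by k

theorem chU_eq {c : ℕ → Bool → (ℕ → ℕ) → ℕ → ℕ}
    (hc : ∀ n b p p' k, agr k p p' → c n b p k = c n b p' k) (z : Cantor) (n : ℕ) :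
    (fun k => chU c z k n) = c n (z n) (fun k => chU c z k (n+1)) := by
  funext k
  rw [chU]
  refine hc _ _ _ _ _ fun i hi => ?_
  simp [hi]

theorem chU_dep {c : ℕ → Bool → (ℕ → ℕ) → ℕ → ℕ} (z z' : Cantor) : ∀ k n,
    (∀ i, n ≤ i → i ≤ n + k → z i = z' i) → chU c z k n = chU c z' k n := by
  intro k
  induction k using Nat.strong_induction_on with
  | _ k ih =>
    intro n h
    rw [chU, chU, h n le_rfl (by omega)]
    congr 1
    funext j
    split_ifs with hj
    · exact ih j hj (n+1) fun i h1 h2 => h i (by omega) (by omega)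
    · rfl

def flipH (n : ℕ) : Cantor ≃ₜ Cantor where
  toFun := fun z => Function.update z n (!z n)
  invFun := fun z => Function.update z n (!z n)
  left_inv := fun z => by simp
  right_inv := fun z => by simp
  continuous_toFun := by
    refine continuous_id.update n ?_
    exact (continuous_of_discreteTopology (f := fun b : Bool => !b)).comp (continuous_apply n)
  continuous_invFun := by
    refine continuous_id.update n ?_
    exact (continuous_of_discreteTopology (f := fun b : Bool => !b)).comp (continuous_apply n)

theorem no_chain (c : ℕ → Bool → (ℕ → ℕ) → ℕ → ℕ)
    (hc : ∀ n b p p' k, agr k p p' → c n b p k = c n b p' k)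
    (B : ℕ → Set (ℕ → ℕ)) (hB0 : MeasurableSet (B 0)) (hB : ∀ n p, p ∈ B (n+1) ↔ c n false p ∈ B n)
    (hB' : ∀ n p, c n false p ∈ B n ↔ c n true p ∉ B n) : False := by
  obtain ⟨u, hu⟩ : ∃ u : ℕ → Cantor → ℕ → ℕ, ∀ n z k, u n z k = chU c z k n := ⟨_, fun n z k => rfl⟩
  have hu' : ∀ n z, u n z = fun k => chU c z k n := fun n z => funext fun k => hu n z k
  have heq : ∀ n z, u n z = c n (z n) (u (n+1) z) := fun n z => by
    rw [hu', hu']; exact chU_eq hc z n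
  have hcont : Continuous (u 0) := by
    refine continuous_pi fun k => cont_of_dep (k+1) fun z z' h => ?_
    rw [hu, hu]
    exact chU_dep _ _ _ _ fun i _ hi => h i (by omega)
  have flip : ∀ n z z', (∀ i, i ≠ n → z i = z' i) → z n ≠ z' n → ∀ d m, m + d = n → (u m z ∈ B m ↔ u m z' ∉ B m) := by
    intro n z z' h1 h2 d
    induction d with
    | zero =>
      intro m hm
      obtain rfl : m = n := by omega
      have e : u (m+1) z = u (m+1) z' := by
        rw [hu', hu']
        funext k
        exact chU_dep _ _ _ _ fun i hi _ => h1 i (by omega)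
      rw [heq m z, heq m z', e]
      have h3 := hB' m (u (m+1) z')
      cases hz : z m <;> cases hz' : z' m
      · rw [hz, hz'] at h2; exact absurd rfl h2
      · exact h3
      · tauto
      · rw [hz, hz'] at h2; exact absurd rfl h2
    | succ d ih =>
      intro m hm
      have h3 := ih (m+1) (by omega)
      rw [heq m z, heq m z', ← h1 m (by omega)]
      have a1 := hB' m (u (m+1) z)
      have a2 := hB' m (u (m+1) z')
      have b1 := hB m (u (m+1) z)
      have b2 := hB m (u (m+1) z')
      cases z m <;> tauto
  have hE : MeasurableSet (u 0 ⁻¹' B 0) := hcont.measurable hB0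
  obtain ⟨O, hO, hEO⟩ := hE.baireMeasurableSet.residualEq_isOpen
  obtain ⟨n, W, hWo, hWne, hWflip, hW⟩ : ∃ (n : ℕ) (W : Set Cantor), IsOpen W ∧ W.Nonempty ∧
      (∀ z ∈ W, flipH n z ∈ W) ∧ ((∀ z ∈ W, z ∈ O) ∨ ∀ z ∈ W, z ∉ O) := by
    rcases O.eq_empty_or_nonempty with rfl | ⟨x, hx⟩
    · exact ⟨0, univ, isOpen_univ, univ_nonempty, fun _ _ => mem_univ _, Or.inr fun _ _ h => h⟩
    · obtain ⟨n, hn⟩ := open_agr.1 hO x hx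
      refine ⟨n, {u | agr n x u}, open_cyl n x, ⟨x, agr_refl _ _⟩, ?_, Or.inl fun z hz => hn z hz⟩
      intro z hz i hi
      rw [hz i hi]
      show z i = Function.update z n (!z n) i
      rw [Function.update_of_ne (by omega)]
  have h1 : ∀ᶠ z in residual Cantor, (z ∈ u 0 ⁻¹' B 0 ↔ z ∈ O) := hEO.mem_iff
  have h2 : ∀ᶠ z in residual Cantor, (flipH n z ∈ u 0 ⁻¹' B 0 ↔ flipH n z ∈ O) :=
    (tendsto_residual_of_isOpenMap (flipH n).continuous (flipH n).isOpenMap).eventually h1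
  obtain ⟨z, hzW, hz1, hz2⟩ := (dense_of_mem_residual (h1.and h2)).inter_open_nonempty W hWo hWne
  have h3 := flip n z (flipH n z) (fun i hi => by
    show z i = Function.update z n (!z n) i
    rw [Function.update_of_ne hi]) (by
    show z n ≠ Function.update z n (!z n) n
    simp) n 0 (by omega)
  have h4 := hWflip z hzW
  simp only [mem_preimage] at hz1 hz2
  rcases hW with hW | hW
  · have := hW z hzW
    have := hW _ h4
    tauto
  · have := hW z hzW
    have := hW _ h4
    tauto

structure FSt (X V0 : Set Cantor) where
  V : Set Cantor
  f : Cantor → ℕ → ℕ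
  B : Set (ℕ → ℕ)
  sub : V ⊆ V0
  clopen : IsClopen V
  ne : V.Nonempty
  sig : Sig2 f
  meas : MeasurableSet B
  eqv : ∀ x ∈ V, (x ∈ X ↔ f x ∈ B)

def FSt.Good {X V0 : Set Cantor} (s : FSt X V0) : Prop :=
  ∀ t : (ℕ → ℕ) → ℕ → ℕ, Sig2 t → ∃ r : (ℕ → ℕ) → Cantor, Continuous r ∧ (∀ z, r z ∈ s.V) ∧
    ∀ z, (r z ∈ X ↔ t z ∈ s.B)

def emb (x : Cantor) : ℕ → ℕ := fun n => (x n).toNat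
theorem emb_cont : Continuous emb :=
  continuous_pi fun n => (continuous_of_discreteTopology (f := Bool.toNat)).comp (continuous_apply n)
theorem bits_emb (x : Cantor) : bits (emb x) = x := by
  funext n
  show (x n).toNat.bodd = x n
  cases x n <;> rfl

theorem retrV {V : Set Cantor} (hV : IsClopen V) (hne : V.Nonempty) :
    ∃ r : (ℕ → ℕ) → Cantor, Continuous r ∧ (∀ z, r z ∈ V) ∧ ∀ x ∈ V, r (emb x) = x := by
  classical
  obtain ⟨v, hv⟩ := hne
  refine ⟨fun z => if bits z ∈ V then bits z else v, ?_, ?_, ?_⟩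
  · refine Continuous.if ?_ bits_cont continuous_const
    intro a ha
    have : frontier {a : ℕ → ℕ | bits a ∈ V} = ∅ := (hV.preimage bits_cont).frontier_eq
    rw [this] at ha
    exact absurd ha (notMem_empty _)
  · intro z
    by_cases h : bits z ∈ V
    · simp only [h, if_true]
    · simp only [h, if_false]; exact hv
  · intro x hx
    simp only [bits_emb, hx, if_true]

theorem FSt.step {X V0 : Set Cantor} (hX : MeasurableSet X) (s : FSt X V0) (hs : ¬ s.Good) :
    ∃ s' : FSt X V0, ∃ c : Bool → (ℕ → ℕ) → ℕ → ℕ,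
      (∀ b p p' n, agr n p p' → c b p n = c b p' n) ∧ (∀ p, c false p ∈ s.B ↔ c true p ∉ s.B) ∧
      ∀ p, p ∈ s'.B ↔ c false p ∈ s.B := by
  unfold FSt.Good at hs
  push Not at hs
  obtain ⟨t, ht, hbad⟩ := hs
  obtain ⟨r, hr1, hr2, hr3⟩ := retrV s.clopen s.ne
  have hA : MeasurableSet (t ⁻¹' s.B) := ht.measurable s.meas
  have hD : MeasurableSet (r ⁻¹' X) := hr1.measurable hX
  rcases wadge_lemma hA hD with ⟨ρ, hρ, h⟩ | ⟨ρ, hρ, -, h⟩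
  · obtain ⟨z, hz⟩ := hbad (fun z => r (ρ z)) (hr1.comp hρ) (fun z => hr2 _)
    have := h z
    simp only [mem_preimage] at this
    tauto
  · have hg : Sig2 (fun x : Cantor => t (ρ (emb x))) := ht.comp_cont (hρ.comp emb_cont)
    obtain ⟨V', h1, h2, h3, f', h4, c, h5, h6, h7⟩ := flip_step X s.V s.clopen s.ne s.f _ s.sig hg s.B s.eqv
      (fun x hx => by
        have := h (emb x)
        simp only [mem_preimage] at this
        rw [hr3 x hx] at this
        exact this)
    have hcc : Continuous (c false) := continuous_pi fun n => cont_of_dep n fun x y hxy => h5 _ _ _ _ hxy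
    exact ⟨⟨V', f', c false ⁻¹' s.B, h1.trans s.sub, h2, h3, h4, hcc.measurable s.meas, h7⟩, c, h5, h6,
      fun p => Iff.rfl⟩

theorem claimD {X : Set Cantor} (hX : MeasurableSet X) {V0 : Set Cantor} (h1 : IsClopen V0) (h2 : V0.Nonempty) :
    ∃ s : FSt X V0, s.Good := by
  by_contra hc
  push Not at hc
  have hstep := fun s : FSt X V0 => s.step hX (hc s)
  choose nx cc k1 k2 k3 using hstep
  obtain ⟨S, hS⟩ : ∃ S : ℕ → FSt X V0, ∀ n, S (n+1) = nx (S n) :=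
    ⟨fun n => Nat.rec ⟨V0, emb, bits ⁻¹' X, subset_rfl, h1, h2, emb_cont.sig2, bits_cont.measurable hX,
      fun x _ => by rw [mem_preimage, bits_emb]⟩ (fun _ s => nx s) n, fun n => rfl⟩
  refine no_chain (fun n => cc (S n)) (fun n => k1 (S n)) (fun n => (S n).B) (S 0).meas ?_ (fun n => k2 (S n))
  intro n p
  simp only [hS]
  exact k3 (S n) p

def dP (B : Set (ℕ → ℕ)) : ℕ → Set (ℕ → ℕ)
  | 0 => univ
  | m+1 => {y | ∀ k, (∃ u ∈ dP B m, agr k y u ∧ u ∈ B) ∧ (∃ u ∈ dP B m, agr k y u ∧ u ∉ B)}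

theorem dP_succ_sub (B : Set (ℕ → ℕ)) (m : ℕ) : dP B (m+1) ⊆ dP B m := by
  induction m with
  | zero => exact fun _ _ => mem_univ _
  | succ m ih =>
    intro y hy k
    obtain ⟨⟨u, h1, h2⟩, ⟨v, h3, h4⟩⟩ := hy k
    exact ⟨⟨u, ih h1, h2⟩, ⟨v, ih h3, h4⟩⟩

theorem dP_anti (B : Set (ℕ → ℕ)) : Antitone (dP B) := antitone_nat_of_succ_le (dP_succ_sub B)

theorem dP_closed (B : Set (ℕ → ℕ)) (m : ℕ) : IsClosed (dP B m) := by
  cases m with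
  | zero => exact isClosed_univ
  | succ m =>
    rw [closed_agr]
    intro x hx k
    obtain ⟨u, hu, hxu⟩ := hx k
    obtain ⟨⟨v, h1, h2, h3⟩, ⟨w, h4, h5, h6⟩⟩ := hu k
    exact ⟨⟨v, h1, hxu.trans h2, h3⟩, ⟨w, h4, hxu.trans h5, h6⟩⟩

def noQ (z : ℕ → ℕ) : Prop := ∀ n, 2 ≤ z n
def decq (z : ℕ → ℕ) : ℕ → ℕ := fun n => z n - 2
def Bq (B : Set (ℕ → ℕ)) : Set (ℕ → ℕ) :=
  {z | noQ z ∧ decq z ∈ B} ∪ {z | ∃ n, z n = 0 ∧ ∀ i < n, 2 ≤ z i}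

theorem decq_cont : Continuous decq := continuous_pi fun n =>
  (continuous_of_discreteTopology (f := fun k : ℕ => k - 2)).comp (continuous_apply n)

theorem noQ_closed : IsClosed {z | noQ z} := by
  rw [closed_agr]
  intro x hx n
  obtain ⟨u, hu, h⟩ := hx (n+1)
  rw [h n (by omega)]; exact hu n

theorem Bq_meas {B : Set (ℕ → ℕ)} (hB : MeasurableSet B) : MeasurableSet (Bq B) := by
  refine MeasurableSet.union (noQ_closed.measurableSet.inter (decq_cont.measurable hB)) ?_
  refine IsOpen.measurableSet (open_agr.2 ?_)
  rintro x ⟨n, h1, h2⟩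
  refine ⟨n+1, fun u hu => ⟨n, by rw [← hu n (by omega)]; exact h1, fun i hi => ?_⟩⟩
  rw [← hu i (by omega)]; exact h2 i hi

def Pq (B : Set (ℕ → ℕ)) : ℕ → Set (ℕ → ℕ)
  | 0 => univ
  | m+1 => {z | noQ z ∧ decq z ∈ dP B m}

/-- first quit determines -/
theorem Bq_quit {B : Set (ℕ → ℕ)} {z : ℕ → ℕ} {i : ℕ} (hi : z i < 2) (hlt : ∀ j < i, 2 ≤ z j) :
    z ∈ Bq B ↔ z i = 0 := by
  constructor
  · rintro (⟨h, -⟩ | ⟨n, h1, h2⟩)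
    · exact absurd (h i) (by omega)
    · rcases lt_trichotomy n i with h | rfl | h
      · have := hlt n h; omega
      · exact h1
      · have := h2 i h; omega
  · exact fun h => Or.inr ⟨i, h, hlt⟩

theorem Bq_noQ {B : Set (ℕ → ℕ)} {z : ℕ → ℕ} (h : noQ z) : z ∈ Bq B ↔ decq z ∈ B := by
  constructor
  · rintro (⟨-, h'⟩ | ⟨n, h1, h2⟩)
    · exact h'
    · have := h n; omega
  · exact fun h' => Or.inl ⟨h, h'⟩

theorem not_noQ {z : ℕ → ℕ} (h : ¬ noQ z) : ∃ i, z i < 2 ∧ ∀ j < i, 2 ≤ z j := by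
  classical
  unfold noQ at h
  push Not at h
  exact ⟨Nat.find h, Nat.find_spec h, fun j hj => by have := Nat.find_min h hj; omega⟩

theorem Bq_const {B : Set (ℕ → ℕ)} {z : ℕ → ℕ} {ℓ : ℕ} (h : z ∉ Pq B (ℓ+1)) :
    ∃ k, ∃ b : Prop, ∀ v ∈ Pq B ℓ, agr k z v → (v ∈ Bq B ↔ b) := by
  by_cases hq : noQ z
  · have h1 : decq z ∉ dP B ℓ := fun h' => h ⟨hq, h'⟩
    cases ℓ with
    | zero => exact absurd (mem_univ _) h1
    | succ ℓ =>
      have : ∃ k, ¬ ((∃ u ∈ dP B ℓ, agr k (decq z) u ∧ u ∈ B) ∧ (∃ u ∈ dP B ℓ, agr k (decq z) u ∧ u ∉ B)) := by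
        by_contra hc
        push Not at hc
        exact h1 fun k => by simpa using hc k
      obtain ⟨k, hk⟩ := this
      have hd : ∀ v, agr k z v → agr k (decq z) (decq v) := fun v hv i hi => by
        show z i - 2 = v i - 2
        rw [hv i hi]
      rcases not_and_or.1 hk with hk | hk
      · refine ⟨k, False, fun v hv hzv => ?_⟩
        rw [Bq_noQ hv.1]
        exact ⟨fun hh => hk ⟨_, hv.2, hd v hzv, hh⟩, False.elim⟩
      · refine ⟨k, True, fun v hv hzv => ?_⟩
        rw [Bq_noQ hv.1]
        exact ⟨fun _ => trivial, fun _ => by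
          by_contra hh
          exact hk ⟨_, hv.2, hd v hzv, hh⟩⟩
  · obtain ⟨i, hi, hlt⟩ := not_noQ hq
    refine ⟨i+1, z i = 0, fun v _ hzv => ?_⟩
    rw [Bq_quit (i := i) (by rw [← hzv i (by omega)]; exact hi)
      (fun j hj => by rw [← hzv j (by omega)]; exact hlt j hj), hzv i (by omega)]

theorem psi_claim {B : Set (ℕ → ℕ)} {ρ : (ℕ → ℕ) → ℕ → ℕ} (hρ : Continuous ρ)
    (h : ∀ z, z ∈ B ↔ ρ z ∉ Bq B) : ∀ ℓ y n z k (b : Prop),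
      (∃ u ∈ dP B ℓ, agr n y u ∧ u ∈ B) → (∃ u ∈ dP B ℓ, agr n y u ∧ u ∉ B) →
      (∀ u, agr n y u → agr k z (ρ u)) → (∀ v ∈ Pq B ℓ, agr k z v → (v ∈ Bq B ↔ b)) → False := by
  intro ℓ
  induction ℓ with
  | zero =>
    rintro y n z k b ⟨u, -, h1, h2⟩ ⟨v, -, h3, h4⟩ h5 h6
    have a := h6 _ (mem_univ _) (h5 u h1)
    have a' := h6 _ (mem_univ _) (h5 v h3)
    have := h u
    have := h v
    tauto
  | succ ℓ ih =>
    rintro y n z k b ⟨u, hu, h1, h2⟩ ⟨v, hv, h3, h4⟩ h5 h6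
    obtain ⟨x, hx, hx1, hx2⟩ : ∃ x ∈ dP B (ℓ+1), agr n y x ∧ (x ∈ B ↔ b) := by
      by_cases hb : b
      · exact ⟨u, hu, h1, by tauto⟩
      · exact ⟨v, hv, h3, by tauto⟩
    have hnot : ρ x ∉ Pq B (ℓ+1) := by
      intro hin
      have := h6 _ hin (h5 x hx1)
      have := h x
      tauto
    obtain ⟨k', b', hk'⟩ := Bq_const hnot
    obtain ⟨n', hn'⟩ := cont_agr.1 hρ x k'
    exact ih x n' (ρ x) k' b' (hx n').1 (hx n').2 hn' hk'

def diagSeq (ρ : (ℕ → ℕ) → ℕ → ℕ) (n : ℕ) : ℕ :=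
  ρ (fun i => if _h : i < n then diagSeq ρ i else 0) n - 2
termination_by n

theorem psi {B : Set (ℕ → ℕ)} (hB : MeasurableSet B) {y0 : ℕ → ℕ} (hy0 : ∀ m, y0 ∈ dP B m) :
    ∃ Ψ : (ℕ → ℕ) → ℕ → ℕ, Continuous Ψ ∧ ∀ z, z ∈ Bq B ↔ Ψ z ∈ B := by
  rcases wadge_lemma (Bq_meas hB) hB with h | ⟨ρ, hρ, hst, h⟩
  · exact h
  exfalso
  obtain ⟨y, hy⟩ : ∃ y : ℕ → ℕ, ∀ n, y n = ρ y n - 2 := by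
    refine ⟨diagSeq ρ, fun n => ?_⟩
    rw [diagSeq]
    congr 1
    refine hst _ _ _ fun i hi => ?_
    simp [hi]
  have hstr : ∀ n u, agr n y u → agr (n+1) (ρ y) (ρ u) := fun n u hu i hi =>
    hst _ _ _ (hu.mono (by omega))
  have hyd : decq (ρ y) = y := funext fun n => (hy n).symm
  by_cases hq : noQ (ρ y)
  · have := h y
    rw [Bq_noQ hq, hyd] at this
    tauto
  obtain ⟨i, hi, hlt⟩ := not_noQ hq
  let Tw : ℕ → ℕ → Prop := fun m n => (∃ u ∈ dP B m, agr n y u ∧ u ∈ B) ∧ (∃ u ∈ dP B m, agr n y u ∧ u ∉ B)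
  have g0 : ∀ m, Tw m 0 := by
    intro m
    obtain ⟨⟨u, h1, _, h2⟩, ⟨v, h3, _, h4⟩⟩ := hy0 (m+1) 0
    exact ⟨⟨u, h1, fun i hi => absurd hi (by omega), h2⟩, ⟨v, h3, fun i hi => absurd hi (by omega), h4⟩⟩
  have key : ∀ n ≤ i, ∀ m, Tw m n := by
    intro n
    induction n with
    | zero => exact fun _ => g0
    | succ n ih =>
      intro hn m
      by_contra hc
      have hg := ih (by omega) (m+1)
      have hag : ∀ v, noQ v → agr (n+1) (ρ y) v → agr (n+1) y (decq v) := fun v hv hyv j hj => by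
        rw [hy j, hyv j hj]; rfl
      refine psi_claim hρ h (m+1) y n (ρ y) (n+1) (∃ u ∈ dP B m, agr (n+1) y u ∧ u ∈ B) hg.1 hg.2 (hstr n) ?_
      rintro v ⟨hv1, hv2⟩ hyv
      rw [Bq_noQ hv1]
      constructor
      · exact fun hh => ⟨_, hv2, hag v hv1 hyv, hh⟩
      · intro hh
        by_contra hcc
        exact hc ⟨hh, _, hv2, hag v hv1 hyv, hcc⟩
  have hg := key i le_rfl 0
  refine psi_claim hρ h 0 y i (ρ y) (i+1) (ρ y i = 0) hg.1 hg.2 (hstr i) fun v _ hzv => ?_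
  rw [Bq_quit (i := i) (by rw [← hzv i (by omega)]; exact hi)
      (fun j hj => by rw [← hzv j (by omega)]; exact hlt j hj), hzv i (by omega)]

/-! the Δ case -/
theorem gd_pull {Y : Type*} [TopologicalSpace Y] {H : Set Y} (hH : IsGδ H) {Y' : Type*} [TopologicalSpace Y'] {h : Y → Y'}
    (hh : ContinuousOn h H) {S : Set Y'} (hS : IsGδ S) : IsGδ (H ∩ h ⁻¹' S) := by
  obtain ⟨O, hO, rfl⟩ := isGδ_iff_eq_iInter_nat.1 hS
  choose U hU hU' using fun n => continuousOn_iff'.1 hh (O n) (hO n)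
  have : H ∩ h ⁻¹' (⋂ n, O n) = H ∩ ⋂ n, U n := by
    ext x
    simp only [mem_inter_iff, mem_preimage, mem_iInter]
    refine and_congr_right fun hx => forall_congr' fun n => ?_
    have := Set.ext_iff.1 (hU' n) x
    simp only [mem_inter_iff, mem_preimage, hx, and_true] at this
    exact this
  rw [this]
  exact hH.inter (IsGδ.iInter fun n => (hU n).isGδ)

theorem fs_pull {H : Set Cantor} (hH : IsGδ H) {h : Cantor → Cantor}
    (hh : ContinuousOn h H) {S : Set Cantor} (hS : Fs S) : Fs (Hᶜ ∪ h ⁻¹' S) := by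
  rw [fs_iff, compl_union, compl_compl, ← preimage_compl]
  exact gd_pull hH hh (fs_iff.1 hS)

/-- B (or complement) as difference -/
theorem dP_diff (B : Set (ℕ → ℕ)) (hB : ∀ y, ∃ m, y ∉ dP B m) (D : Set (ℕ → ℕ)) (hD : D = B ∨ D = Bᶜ) :
    ∃ A : ℕ → Set (ℕ → ℕ), (∀ n, IsOpen (A n)) ∧ Monotone A ∧
      ∀ y, y ∈ D ↔ ∃ n, Odd n ∧ y ∈ A n ∧ ∀ m < n, y ∉ A m := by
  have hnP : ∀ m y, y ∉ dP B (m+1) ↔ ∃ k, (∀ u ∈ dP B m, agr k y u → u ∈ D) ∨ (∀ u ∈ dP B m, agr k y u → u ∉ D) := by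
    intro m y
    have : y ∈ dP B (m+1) ↔ ∀ k, (∃ u ∈ dP B m, agr k y u ∧ u ∈ B) ∧ (∃ u ∈ dP B m, agr k y u ∧ u ∉ B) := Iff.rfl
    rw [this]
    push Not
    refine exists_congr fun k => ?_
    rcases hD with rfl | rfl
    · constructor
      · intro h
        by_cases h' : ∃ u ∈ dP D m, agr k y u ∧ u ∈ D
        · left; exact h h'
        · right; push Not at h'; exact h'
      · rintro (h | h)
        · exact fun _ => h
        · rintro ⟨u, h1, h2, h3⟩; exact absurd h3 (h u h1 h2)
    · simp only [mem_compl_iff, not_not]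
      constructor
      · intro h
        by_cases h' : ∃ u ∈ dP B m, agr k y u ∧ u ∈ B
        · right; exact h h'
        · left; push Not at h'; exact h'
      · rintro (h | h)
        · rintro ⟨u, h1, h2, h3⟩; exact absurd h3 (h u h1 h2)
        · exact fun _ => h
  obtain ⟨Oo, hOo⟩ : ∃ Oo : ℕ → Set (ℕ → ℕ), ∀ m, Oo m = {y | ∃ k, ∀ u ∈ dP B m, agr k y u → u ∉ D} := ⟨_, fun _ => rfl⟩
  have hOo_open : ∀ m, IsOpen (Oo m) := by
    intro m
    rw [open_agr]
    intro x hx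
    rw [hOo] at hx ⊢
    obtain ⟨k, hk⟩ := hx
    exact ⟨k, fun u hu => ⟨k, fun v hv huv => hk v hv (hu.trans huv)⟩⟩
  have hOo_sub : ∀ m, Oo m ⊆ (dP B (m+1))ᶜ := by
    intro m y hy
    rw [hOo] at hy
    obtain ⟨k, hk⟩ := hy
    exact (hnP m y).2 ⟨k, Or.inr hk⟩
  obtain ⟨A, hA0, hA1⟩ : ∃ A : ℕ → Set (ℕ → ℕ), (∀ m, A (2*m) = (dP B m)ᶜ ∪ Oo m) ∧ (∀ m, A (2*m+1) = (dP B (m+1))ᶜ) := by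
    refine ⟨fun n => if n % 2 = 0 then (dP B (n/2))ᶜ ∪ Oo (n/2) else (dP B (n/2+1))ᶜ, fun m => ?_, fun m => ?_⟩
    · simp
    · have h1 : (2*m+1) % 2 = 1 := by omega
      have h2 : (2*m+1)/2 = m := by omega
      simp [h1, h2]
  have hmono : Monotone A := by
    refine monotone_nat_of_le_succ fun n => ?_
    rcases Nat.even_or_odd' n with ⟨m, rfl | rfl⟩
    · rw [hA0, hA1]
      exact union_subset (compl_subset_compl.2 (dP_succ_sub B m)) (hOo_sub m)
    · rw [hA1, show 2*m+1+1 = 2*(m+1) by ring, hA0]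
      exact subset_union_left
  refine ⟨A, ?_, hmono, ?_⟩
  · intro n
    rcases Nat.even_or_odd' n with ⟨m, rfl | rfl⟩
    · rw [hA0]; exact (dP_closed B m).isOpen_compl.union (hOo_open m)
    · rw [hA1]; exact (dP_closed B _).isOpen_compl
  · intro y
    have hlast : ∀ m, (y ∈ A (2*m+1) ∧ ∀ j < 2*m+1, y ∉ A j) ↔ (y ∉ dP B (m+1) ∧ y ∈ dP B m ∧ y ∉ Oo m) := by
      intro m
      have : (∀ j < 2*m+1, y ∉ A j) ↔ y ∉ A (2*m) :=
        ⟨fun h => h _ (by omega), fun h j hj hy => h (hmono (by omega : j ≤ 2*m) hy)⟩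
      rw [this, hA1, hA0]
      simp only [mem_compl_iff, mem_union, not_or, not_not]
    constructor
    · intro hy
      classical
      obtain ⟨m, hm1, hm2⟩ : ∃ m, y ∉ dP B (m+1) ∧ y ∈ dP B m := by
        have h0 := Nat.find_spec (hB y)
        have hne : Nat.find (hB y) ≠ 0 := fun h => by rw [h] at h0; exact h0 (mem_univ _)
        refine ⟨Nat.find (hB y) - 1, ?_, ?_⟩
        · rw [Nat.sub_add_cancel (by omega)]; exact h0
        · have := Nat.find_min (hB y) (show Nat.find (hB y) - 1 < Nat.find (hB y) by omega)
          exact not_not.1 this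
      refine ⟨2*m+1, ⟨m, rfl⟩, (hlast m).2 ⟨hm1, hm2, ?_⟩⟩
      rw [hOo]
      rintro ⟨k, hk⟩
      exact hk y hm2 (agr_refl _ _) hy
    · rintro ⟨n, ⟨m, rfl⟩, h⟩
      obtain ⟨h1, h2, h3⟩ := (hlast m).1 h
      obtain ⟨k, hk | hk⟩ := (hnP m y).1 h1
      · exact hk y h2 (agr_refl _ _)
      · exact absurd (by rw [hOo]; exact ⟨k, hk⟩) h3

theorem delta_of {X : Set Cantor} {H : Set Cantor} (hH : IsGδ H) {h : Cantor → Cantor} (hh : ContinuousOn h H)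
    {f : Cantor → ℕ → ℕ} (hf : Sig2 f) {B : Set (ℕ → ℕ)} (hX : ∀ x, x ∈ X ↔ x ∈ H ∧ f (h x) ∈ B)
    (hB : ∀ y, ∃ m, y ∉ dP B m) : InDelta X := by
  have main : ∀ (D : Set (ℕ → ℕ)), (D = B ∨ D = Bᶜ) → ∀ (E : Set Cantor), (E = ∅ ∨ E = Hᶜ) →
      DOmegaSigmaTwo {x | (x ∉ H ∧ x ∉ E) ∨ (x ∈ H ∧ f (h x) ∈ D)} := by
    intro D hD E hE
    have hEF : Fs E := by
      rcases hE with rfl | rfl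
      · exact isClosed_empty.fs
      · rw [fs_iff, compl_compl]; exact hH
    have hEH : E ⊆ Hᶜ := by
      rcases hE with rfl | rfl
      · exact empty_subset _
      · exact subset_rfl
    obtain ⟨A, hA, hAm, hAD⟩ := dP_diff B hB D hD
    obtain ⟨A', a0, a1, a2⟩ : ∃ A' : ℕ → Set Cantor, A' 0 = E ∧ A' 1 = Hᶜ ∧ ∀ n, A' (n+2) = Hᶜ ∪ h ⁻¹' (f ⁻¹' A n) :=
      ⟨fun n => Nat.casesOn n E (fun n => Nat.casesOn n Hᶜ fun n => Hᶜ ∪ h ⁻¹' (f ⁻¹' A n)), rfl, rfl, fun n => rfl⟩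
    refine ⟨A', ?_, ?_, ?_⟩
    · intro n
      match n with
      | 0 => rw [a0]; exact hEF
      | 1 => rw [a1]; exact fs_iff.2 (by rw [compl_compl]; exact hH)
      | n+2 => rw [a2]; exact fs_pull hH hh (hf.open (hA n))
    · refine monotone_nat_of_le_succ fun n => ?_
      match n with
      | 0 => rw [a0, a1]; exact hEH
      | 1 => rw [a1, a2]; exact subset_union_left
      | n+2 =>
        rw [a2, a2]
        exact union_subset_union_right _ (preimage_mono (preimage_mono (hAm (Nat.le_succ n))))
    · ext x
      simp only [mem_iUnion, mem_sdiff, exists_prop]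
      constructor
      · rintro (⟨h1, h2⟩ | ⟨h1, h2⟩)
        · refine ⟨1, odd_one, by rw [a1]; exact h1, ?_⟩
          rintro ⟨m, hm, hx⟩
          obtain rfl : m = 0 := by omega
          rw [a0] at hx; exact h2 hx
        · obtain ⟨n, hn, h3, h4⟩ := (hAD _).1 h2
          refine ⟨n+2, by simpa [Nat.odd_add] using hn, by rw [a2]; exact Or.inr h3, ?_⟩
          rintro ⟨m, hm, hx⟩
          match m with
          | 0 => rw [a0] at hx; exact hEH hx h1
          | 1 => rw [a1] at hx; exact hx h1
          | m+2 =>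
            rw [a2] at hx
            rcases hx with hx | hx
            · exact hx h1
            · exact h4 m (by omega) hx
      · rintro ⟨n, hn, h1, h2⟩
        match n with
        | 0 => exact absurd hn (by decide)
        | 1 =>
          rw [a1] at h1
          refine Or.inl ⟨h1, fun hE => h2 ⟨0, by omega, by rw [a0]; exact hE⟩⟩
        | n+2 =>
          rw [a2] at h1
          have hxH : x ∈ H := by
            by_contra hc
            exact h2 ⟨1, by omega, by rw [a1]; exact hc⟩
          refine Or.inr ⟨hxH, (hAD _).2 ⟨n, ?_, ?_, ?_⟩⟩
          · have : Odd (n+2) := hn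
            simpa [Nat.odd_add] using this
          · rcases h1 with h1 | h1
            · exact absurd hxH h1
            · exact h1
          · intro m hm hx
            exact h2 ⟨m+2, by omega, by rw [a2]; exact Or.inr hx⟩
  constructor
  · have := main B (Or.inl rfl) Hᶜ (Or.inr rfl)
    convert this using 1
    ext x
    rw [hX]
    show _ ↔ (x ∉ H ∧ x ∉ Hᶜ) ∨ (x ∈ H ∧ f (h x) ∈ B)
    simp only [mem_compl_iff]
    tauto
  · have := main Bᶜ (Or.inr rfl) ∅ (Or.inl rfl)
    convert this using 1
    ext x
    rw [mem_compl_iff, hX]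
    show _ ↔ (x ∉ H ∧ x ∉ (∅ : Set Cantor)) ∨ (x ∈ H ∧ f (h x) ∈ Bᶜ)
    simp only [mem_compl_iff, mem_empty_iff_false]
    tauto

theorem lemmaQ {Y : Type*} [TopologicalSpace Y] [PerfectlyNormalSpace Y] {H Q0 Q1 : Set Y} (hQ0 : Fs Q0) (hQ1 : Fs Q1)
    (hdisj : ∀ z, z ∈ Q0 → z ∉ Q1) (hH : ∀ z, z ∈ H ↔ z ∉ Q0 ∧ z ∉ Q1) {h : Y → Cantor} (hh : ContinuousOn h H)
    {f : Cantor → ℕ → ℕ} (hf : Sig2 f) {B : Set (ℕ → ℕ)} {Ψ : (ℕ → ℕ) → ℕ → ℕ} (hΨ : Continuous Ψ)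
    (hΨB : ∀ z, z ∈ Bq B ↔ Ψ z ∈ B) :
    ∃ t : Y → ℕ → ℕ, Sig2 t ∧ ∀ z, (t z ∈ B ↔ z ∈ Q0 ∨ (z ∈ H ∧ f (h z) ∈ B)) := by
  classical
  obtain ⟨F0, hF0, rfl⟩ := hQ0
  obtain ⟨F1, hF1, rfl⟩ := hQ1
  choose Ff hFf hFf' using hf
  obtain ⟨E, hE⟩ : ∃ E : ℕ → Set Y, ∀ i, E i = if i % 2 = 0 then F0 (i/2) else F1 (i/2) := ⟨_, fun _ => rfl⟩
  have hEcl : ∀ i, IsClosed (E i) := fun i => by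
    rw [hE]; split_ifs
    · exact hF0 _
    · exact hF1 _
  have hE0 : ∀ i z, z ∈ E i → i % 2 = 0 → z ∈ ⋃ n, F0 n := fun i z hz hi => by
    rw [hE, if_pos hi] at hz; exact mem_iUnion.2 ⟨_, hz⟩
  have hE1 : ∀ i z, z ∈ E i → i % 2 ≠ 0 → z ∈ ⋃ n, F1 n := fun i z hz hi => by
    rw [hE, if_neg hi] at hz; exact mem_iUnion.2 ⟨_, hz⟩
  have hEH : ∀ i z, z ∈ E i → z ∉ H := fun i z hz hzH => by
    rw [hH] at hzH
    by_cases hi : i % 2 = 0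
    · exact hzH.1 (hE0 i z hz hi)
    · exact hzH.2 (hE1 i z hz hi)
  have hEc : ∀ z, z ∉ H → ∃ i, z ∈ E i := fun z hz => by
    rw [hH, not_and_or, not_not, not_not] at hz
    rcases hz with hz | hz
    · obtain ⟨i, hi⟩ := mem_iUnion.1 hz
      refine ⟨2*i, ?_⟩
      have h1 : (2*i) % 2 = 0 := by omega
      have h2 : (2*i)/2 = i := by omega
      rw [hE, if_pos h1, h2]; exact hi
    · obtain ⟨i, hi⟩ := mem_iUnion.1 hz
      refine ⟨2*i+1, ?_⟩
      have h1 : ¬ (2*i+1) % 2 = 0 := by omega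
      have h2 : (2*i+1)/2 = i := by omega
      rw [hE, if_neg h1, h2]; exact hi
  obtain ⟨K, hK⟩ : ∃ K : ℕ → ℕ → Set Y, ∀ n j, K n j = closure (H ∩ h ⁻¹' (Ff n j.unpair.1 j.unpair.2)) := ⟨_, fun _ _ => rfl⟩
  have hKH : ∀ n j z, z ∈ H → z ∈ K n j → f (h z) n = j.unpair.1 := by
    intro n j z hzH hz
    rw [hK] at hz
    have h1 : h z ∈ closure (Ff n j.unpair.1 j.unpair.2) := by
      have h2 := (hh z hzH).mono (inter_subset_left : H ∩ h ⁻¹' (Ff n j.unpair.1 j.unpair.2) ⊆ H)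
      exact h2.mem_closure hz (fun y hy => hy.2)
    rw [(hFf _ _ _).closure_eq] at h1
    have : h z ∈ {x | f x n = j.unpair.1} := by rw [hFf']; exact mem_iUnion.2 ⟨_, h1⟩
    exact this
  have hKc : ∀ n z, z ∈ H → ∃ j, z ∈ K n j := by
    intro n z hz
    have : h z ∈ {x | f x n = f (h z) n} := rfl
    rw [hFf', mem_iUnion] at this
    obtain ⟨i, hi⟩ := this
    refine ⟨Nat.pair (f (h z) n) i, ?_⟩
    rw [hK, Nat.unpair_pair]
    exact subset_closure ⟨hz, hi⟩
  obtain ⟨L, hL0, hL1, hL2⟩ : ∃ L : ℕ → ℕ → Set Y, (∀ n i, L n (2*i) = E i) ∧ (∀ n q, n ≤ q → L n (2*q+1) = K n (q-n)) ∧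
      (∀ n q, ¬ n ≤ q → L n (2*q+1) = ∅) := by
    refine ⟨fun n m => if m % 2 = 0 then E (m/2) else if n ≤ m/2 then K n (m/2-n) else ∅, fun n i => ?_, fun n q hq => ?_, fun n q hq => ?_⟩
    · have h1 : (2*i) % 2 = 0 := by omega
      have h2 : (2*i)/2 = i := by omega
      simp only [h1, h2, if_true]
    · have h1 : ¬ (2*q+1) % 2 = 0 := by omega
      have h2 : (2*q+1)/2 = q := by omega
      simp only [h1, h2, hq, if_true, if_false]
    · have h1 : ¬ (2*q+1) % 2 = 0 := by omega
      have h2 : (2*q+1)/2 = q := by omega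
      simp only [h1, h2, hq, if_false]
  obtain ⟨lab, hl0, hl1⟩ : ∃ lab : ℕ → ℕ → ℕ, (∀ n i, lab n (2*i) = i % 2) ∧
      (∀ n q, lab n (2*q+1) = (q-n).unpair.1 + 2) := by
    refine ⟨fun n m => if m % 2 = 0 then (m/2) % 2 else (m/2-n).unpair.1 + 2, fun n i => ?_, fun n q => ?_⟩
    · have h1 : (2*i) % 2 = 0 := by omega
      have h2 : (2*i)/2 = i := by omega
      simp only [h1, h2, if_true]
    · have h1 : ¬ (2*q+1) % 2 = 0 := by omega
      have h2 : (2*q+1)/2 = q := by omega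
      simp only [h1, h2, if_false]
  have hLcl : ∀ n m, IsClosed (L n m) := by
    intro n m
    rcases Nat.even_or_odd' m with ⟨i, rfl | rfl⟩
    · rw [hL0]; exact hEcl i
    · by_cases hq : n ≤ i
      · rw [hL1 n i hq, hK]; exact isClosed_closure
      · rw [hL2 n i hq]; exact isClosed_empty
  have hLc : ∀ n z, ∃ m, z ∈ L n m := by
    intro n z
    by_cases hz : z ∈ H
    · obtain ⟨j, hj⟩ := hKc n z hz
      refine ⟨2*(n+j)+1, ?_⟩
      rw [hL1 n (n+j) (by omega), show n + j - n = j by omega]; exact hj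
    · obtain ⟨i, hi⟩ := hEc z hz
      exact ⟨2*i, by rw [hL0]; exact hi⟩
  obtain ⟨T, hT⟩ : ∃ T : Y → ℕ → ℕ, ∀ z n, T z n = lab n (Nat.find (hLc n z)) := ⟨_, fun _ _ => rfl⟩
  have hTs : Sig2 T := by
    refine sig2_least L hLcl hLc lab T fun z n i hi hi' => ?_
    rw [hT, (Nat.find_eq_iff (hLc n z)).2 ⟨hi, hi'⟩]
  have hTH : ∀ z ∈ H, ∀ n, T z n = f (h z) n + 2 := by
    intro z hz n
    rw [hT]
    have hs := Nat.find_spec (hLc n z)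
    generalize Nat.find (hLc n z) = m at hs
    rcases Nat.even_or_odd' m with ⟨i, rfl | rfl⟩
    · rw [hL0] at hs; exact absurd hz (hEH i z hs)
    · by_cases hq : n ≤ i
      · rw [hL1 n i hq] at hs
        rw [hl1, hKH n _ z hz hs]
      · rw [hL2 n i hq] at hs; exact absurd hs (notMem_empty _)
  refine ⟨fun z => Ψ (T z), hTs.cont_comp hΨ, fun z => ?_⟩
  rw [← hΨB]
  by_cases hz : z ∈ H
  · have hn : noQ (T z) := fun n => by rw [hTH z hz]; omega
    have hd : decq (T z) = f (h z) := funext fun n => by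
      show T z n - 2 = _
      rw [hTH z hz]; omega
    rw [Bq_noQ hn, hd]
    have := (hH z).1 hz
    tauto
  · have hEz := hEc z hz
    obtain ⟨i0, hi0, hmin⟩ : ∃ i0, z ∈ E i0 ∧ ∀ j < i0, z ∉ E j := ⟨Nat.find hEz, Nat.find_spec hEz, fun j hj => Nat.find_min hEz hj⟩
    have hTz : ∀ n, T z n = i0 % 2 ∨ (2 ≤ T z n ∧ n < i0) := by
      intro n
      rw [hT]
      have hs := Nat.find_spec (hLc n z)
      have hle : Nat.find (hLc n z) ≤ 2*i0 := Nat.find_min' _ (by rw [hL0]; exact hi0)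
      generalize Nat.find (hLc n z) = m at hs hle
      rcases Nat.even_or_odd' m with ⟨i, rfl | rfl⟩
      · rw [hL0] at hs
        have : i = i0 := by
          by_contra hne
          exact hmin i (by omega) hs
        left; rw [hl0, this]
      · by_cases hq : n ≤ i
        · right; rw [hl1]; omega
        · rw [hL2 n i hq] at hs; exact absurd hs (notMem_empty _)
    have hq : ¬ noQ (T z) := fun hq => by
      have h1 := hq i0
      rcases hTz i0 with h2 | h2 <;> omega
    obtain ⟨i, hi, hlt⟩ := not_noQ hq
    rw [Bq_quit hi hlt]
    have h1 : T z i = i0 % 2 := by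
      rcases hTz i with h2 | h2
      · exact h2
      · omega
    rw [h1]
    constructor
    · exact fun h2 => Or.inl (hE0 i0 z hi0 h2)
    · rintro (h2 | h2)
      · by_contra h3
        exact hdisj z h2 (hE1 i0 z hi0 h3)
      · exact absurd h2.1 hz

theorem lav_ext {X : Set Cantor} (hd : Dense X) (g : X → Cantor) (hg : Continuous g) :
    ∃ (G : Set Cantor) (k : Cantor → Cantor), IsGδ G ∧ X ⊆ G ∧ ContinuousOn k G ∧ ∀ x : X, k x = g x := by
  classical
  obtain ⟨O, hO⟩ : ∃ O : ℕ → Bool → Set Cantor, ∀ n b z, z ∈ O n b ↔ ∃ m, ∀ x : X, agr m z x → g x n = b :=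
    ⟨fun n b => {z | ∃ m, ∀ x : X, agr m z x → g x n = b}, fun _ _ _ => Iff.rfl⟩
  have Oo : ∀ n b, IsOpen (O n b) := fun n b => by
    rw [open_agr]
    intro z hz
    obtain ⟨m, hm⟩ := (hO _ _ _).1 hz
    exact ⟨m, fun u hu => (hO _ _ _).2 ⟨m, fun x hx => hm x (hu.trans hx)⟩⟩
  have Od : ∀ n z, z ∈ O n true → z ∉ O n false := by
    intro n z h1 h2
    obtain ⟨m, hm⟩ := (hO _ _ _).1 h1
    obtain ⟨m', hm'⟩ := (hO _ _ _).1 h2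
    obtain ⟨x, hx, hxX⟩ := hd.inter_open_nonempty _ (open_cyl (max m m') z) ⟨z, agr_refl _ _⟩
    have a := hm ⟨x, hxX⟩ (agr.mono hx (le_max_left _ _))
    have b := hm' ⟨x, hxX⟩ (agr.mono hx (le_max_right _ _))
    rw [a] at b; cases b
  have OX : ∀ n (x : X), (x : Cantor) ∈ O n (g x n) := by
    intro n x
    rw [hO]
    have ho : IsOpen {y : X | g y n = g x n} :=
      (isOpen_discrete {g x n}).preimage ((continuous_apply n).comp hg)
    obtain ⟨W, hW, hWe⟩ := isOpen_induced_iff.1 ho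
    have hx : (x : Cantor) ∈ W := by
      have : x ∈ Subtype.val ⁻¹' W := by rw [hWe]; rfl
      exact this
    obtain ⟨m, hm⟩ := open_agr.1 hW _ hx
    refine ⟨m, fun y hy => ?_⟩
    have : y ∈ Subtype.val ⁻¹' W := hm _ hy
    rw [hWe] at this
    exact this
  refine ⟨⋂ n, (O n true ∪ O n false), fun z n => decide (z ∈ O n true), ?_, ?_, ?_, ?_⟩
  · exact IsGδ.iInter fun n => ((Oo _ _).union (Oo _ _)).isGδ
  · intro x hx
    rw [mem_iInter]
    intro n
    have := OX n ⟨x, hx⟩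
    cases h : g ⟨x, hx⟩ n <;> rw [h] at this
    · exact Or.inr this
    · exact Or.inl this
  · rw [continuousOn_pi]
    intro n z hz
    rw [mem_iInter] at hz
    have : (fun z => decide (z ∈ O n true)) =ᶠ[nhds z] fun _ => decide (z ∈ O n true) := by
      rcases hz n with h | h
      · filter_upwards [(Oo _ _).mem_nhds h] with u hu
        simp [hu, h]
      · filter_upwards [(Oo _ _).mem_nhds h] with u hu
        have h1 : u ∉ O n true := fun h' => Od _ _ h' hu
        have h2 : z ∉ O n true := fun h' => Od _ _ h' h
        simp [h1, h2]
    exact (continuousAt_const.congr this.symm).continuousWithinAt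
  · intro x
    funext n
    have := OX n x
    cases h : g x n <;> rw [h] at this
    · have : (x : Cantor) ∉ O n true := fun h' => Od _ _ h' this
      simp [this]
    · simp [this]

theorem lav_loc {X : Set Cantor} (hd : Dense X) (hhom : IsHomogeneous X) {V : Set Cantor} (hV : IsClopen V)
    (hne : V.Nonempty) (x : Cantor) (hx : x ∈ X) :
    ∃ (C H : Set Cantor) (h : Cantor → Cantor), IsClopen C ∧ x ∈ C ∧ IsGδ H ∧ ContinuousOn h H ∧
      (∀ z ∈ C, z ∈ H → h z ∈ V) ∧ ∀ z, z ∈ X ↔ z ∈ H ∧ h z ∈ X := by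
  obtain ⟨y, hyV, hyX⟩ := hd.inter_open_nonempty V hV.isOpen hne
  obtain ⟨g, hg⟩ := hhom ⟨x, hx⟩ ⟨y, hyX⟩
  obtain ⟨G1, k1, hG1, hX1, hk1, he1⟩ := lav_ext hd (fun z => (g z : Cantor)) (by fun_prop)
  obtain ⟨G2, k2, hG2, hX2, hk2, he2⟩ := lav_ext hd (fun z => (g.symm z : Cantor)) (by fun_prop)
  have hA : IsGδ (G1 ∩ k1 ⁻¹' G2) := gd_pull hG1 hk1 hG2
  have hc : ContinuousOn (fun z => (k2 (k1 z), z)) (G1 ∩ k1 ⁻¹' G2) :=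
    ContinuousOn.prodMk (hk2.comp (hk1.mono inter_subset_left) fun z hz => hz.2) continuousOn_id
  have hH := gd_pull hA hc (isClosed_diagonal (X := Cantor)).isGδ
  have hxx : k1 x = y := by
    rw [he1 ⟨x, hx⟩, hg]
  obtain ⟨W, hW, hWe⟩ := continuousOn_iff'.1 hk1 V hV.isOpen
  have hxW : x ∈ W := by
    have : x ∈ W ∩ G1 := by rw [← hWe]; exact ⟨by rw [mem_preimage, hxx]; exact hyV, hX1 hx⟩
    exact this.1
  obtain ⟨m, hm⟩ := open_agr.1 hW x hxW
  refine ⟨{u | agr m x u}, _, k1, ⟨closed_cyl _ _, open_cyl _ _⟩, agr_refl _ _, hH,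
    hk1.mono fun z hz => hz.1.1, ?_, ?_⟩
  · intro z hz hzH
    have : z ∈ W ∩ G1 := ⟨hm _ hz, hzH.1.1⟩
    rw [← hWe] at this
    exact this.1
  · intro z
    constructor
    · intro hz
      have h1 := he1 ⟨z, hz⟩
      have h2 := he2 (g ⟨z, hz⟩)
      simp only at h1 h2
      refine ⟨⟨⟨hX1 hz, ?_⟩, ?_⟩, ?_⟩
      · rw [mem_preimage, h1]; exact hX2 (g _).2
      · show k2 (k1 z) = z
        rw [h1, h2]; simp
      · rw [h1]; exact (g _).2
    · rintro ⟨⟨_, h3⟩, h4⟩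
      have h3 : k2 (k1 z) = z := h3
      rw [← h3, he2 ⟨k1 z, h4⟩]
      exact (g.symm _).2

theorem lav {X : Set Cantor} (hd : Dense X) (hhom : IsHomogeneous X) {V : Set Cantor} (hV : IsClopen V)
    (hne : V.Nonempty) :
    ∃ (H : Set Cantor) (h : Cantor → Cantor), IsGδ H ∧ ContinuousOn h H ∧
      (∀ z ∈ H, h z ∈ V) ∧ ∀ z, z ∈ X ↔ z ∈ H ∧ h z ∈ X := by
  classical
  obtain ⟨x0, hx0⟩ := hd.nonempty
  choose! C H h hC hxC hH hh hV' hX using lav_loc hd hhom hV hne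
  obtain ⟨t, htX, htc, htU⟩ := TopologicalSpace.countable_cover_nhdsWithin (s := X) (f := C)
    (fun x hx => mem_nhdsWithin_of_mem_nhds ((hC x hx).isOpen.mem_nhds (hxC x hx)))
  have htne : t.Nonempty := by
    obtain ⟨i, hi, _⟩ := mem_iUnion₂.1 (htU hx0)
    exact ⟨i, hi⟩
  obtain ⟨e, rfl⟩ := htc.exists_eq_range htne
  have he : ∀ k, e k ∈ X := fun k => htX ⟨k, rfl⟩
  obtain ⟨D, hD⟩ : ∃ D : ℕ → Set Cantor, ∀ k, D k = C (e k) ∩ ⋂ j ∈ Finset.range k, (C (e j))ᶜ := ⟨_, fun _ => rfl⟩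
  have hDm : ∀ k z, z ∈ D k ↔ z ∈ C (e k) ∧ ∀ j < k, z ∉ C (e j) := fun k z => by
    rw [hD]; simp
  have hDc : ∀ k, IsClopen (D k) := fun k => by
    rw [hD]
    exact (hC _ (he k)).inter (isClopen_biInter_finset fun j _ => (hC _ (he j)).compl)
  have hDu : ∀ k j z, z ∈ D k → z ∈ D j → k = j := by
    intro k j z h1 h2
    rw [hDm] at h1 h2
    rcases lt_trichotomy k j with h | h | h
    · exact absurd h1.1 (h2.2 _ h)
    · exact h
    · exact absurd h2.1 (h1.2 _ h)
  have hDX : ∀ z ∈ X, ∃ k, z ∈ D k := by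
    intro z hz
    have : ∃ k, z ∈ C (e k) := by
      obtain ⟨i, ⟨k, rfl⟩, hi⟩ := mem_iUnion₂.1 (htU hz)
      exact ⟨k, hi⟩
    refine ⟨Nat.find this, (hDm _ _).2 ⟨Nat.find_spec this, fun j hj => Nat.find_min this hj⟩⟩
  obtain ⟨κ, hκ⟩ : ∃ κ : Cantor → ℕ, ∀ k z, z ∈ D k → κ z = k := by
    refine ⟨fun z => if hz : ∃ k, z ∈ D k then hz.choose else 0, fun k z hz => ?_⟩
    have hz' : ∃ k, z ∈ D k := ⟨k, hz⟩
    show dite _ _ _ = k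
    rw [dif_pos hz']
    exact hDu _ _ z hz'.choose_spec hz
  refine ⟨(⋃ k, D k) ∩ ⋂ k, ((D k)ᶜ ∪ H (e k)), fun z => h (e (κ z)) z, ?_, ?_, ?_, ?_⟩
  · exact (isOpen_iUnion fun k => (hDc k).isOpen).isGδ.inter
      (IsGδ.iInter fun k => (hDc k).compl.isOpen.isGδ.union (hH _ (he k)))
  · rw [contOn_agr]
    rintro z ⟨hz1, hz2⟩ l
    obtain ⟨k, hk⟩ := mem_iUnion.1 hz1
    have hzH : z ∈ H (e k) := ((mem_iInter.1 hz2 k).resolve_left fun h => h hk)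
    obtain ⟨n, hn⟩ := contOn_agr.1 (hh _ (he k)) z hzH l
    obtain ⟨n', hn'⟩ := open_agr.1 (hDc k).isOpen z hk
    refine ⟨max n n', fun u hu hzu => ?_⟩
    have huD := hn' u (hzu.mono (le_max_right _ _))
    have huH : u ∈ H (e k) := ((mem_iInter.1 hu.2 k).resolve_left fun h => h huD)
    show agr l (h (e (κ z)) z) (h (e (κ u)) u)
    rw [hκ k z hk, hκ k u huD]
    exact hn u huH (hzu.mono (le_max_left _ _))
  · rintro z ⟨hz1, hz2⟩
    obtain ⟨k, hk⟩ := mem_iUnion.1 hz1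
    have hzH : z ∈ H (e k) := ((mem_iInter.1 hz2 k).resolve_left fun h => h hk)
    show h (e (κ z)) z ∈ V
    rw [hκ k z hk]
    exact hV' _ (he k) z ((hDm _ _).1 hk).1 hzH
  · intro z
    show z ∈ X ↔ _ ∧ h (e (κ z)) z ∈ X
    constructor
    · intro hz
      obtain ⟨k, hk⟩ := hDX z hz
      have := (hX _ (he k) z).1 hz
      rw [hκ k z hk]
      refine ⟨⟨mem_iUnion.2 ⟨k, hk⟩, mem_iInter.2 fun j => ?_⟩, this.2⟩
      by_cases hj : z ∈ D j
      · rw [← hDu _ _ z hk hj]; exact Or.inr this.1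
      · exact Or.inl hj
    · rintro ⟨⟨hz1, hz2⟩, h3⟩
      obtain ⟨k, hk⟩ := mem_iUnion.1 hz1
      have hzH : z ∈ H (e k) := ((mem_iInter.1 hz2 k).resolve_left fun h => h hk)
      rw [hκ k z hk] at h3
      exact (hX _ (he k) z).2 ⟨hzH, h3⟩

theorem count_congr' {T T' : ℕ → Prop} [DecidablePred T] [DecidablePred T'] {a : ℕ} (h : ∀ i < a, (T i ↔ T' i)) : ∀ p ≤ a, Nat.count T p = Nat.count T' p := by
  intro p
  induction p with
  | zero => intro _; simp
  | succ p ih =>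
    intro hp
    rw [Nat.count_succ, Nat.count_succ, ih (by omega)]
    simp only [h p (by omega)]

open Classical in
noncomputable def eT (T : ℕ → Prop) (x : Cantor) (p : ℕ) : ℕ :=
  (x (Nat.count T p)).toNat + if T p then 2 else 0

theorem eT_flag (T : ℕ → Prop) (x : Cantor) (p : ℕ) : 2 ≤ eT T x p ↔ T p := by
  classical
  unfold eT
  by_cases h : T p
  · simp [h]
  · simp only [h, if_false, iff_false]
    cases x _ <;> simp

open Classical in
theorem eT_bodd (T : ℕ → Prop) (x : Cantor) (p : ℕ) : (eT T x p).bodd = x (Nat.count T p) := by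
  unfold eT
  by_cases h : T p <;> cases x (Nat.count T p) <;> simp [h]

theorem eT_cont (T : ℕ → Prop) : Continuous (eT T) := by
  classical
  rw [cont_agr]
  intro x k
  refine ⟨k, fun u hu p hp => ?_⟩
  unfold eT
  rw [hu _ (lt_of_le_of_lt (Nat.count_le _) hp)]

def fH : Set (ℕ → ℕ) := {z | ∀ n, ∃ p ≥ n, 2 ≤ z p}
def fQ (b : Bool) : Set (ℕ → ℕ) :=
  {z | ∃ p, (∀ i ≥ p, z i < 2) ∧ (p = 0 ∨ 2 ≤ z (p-1)) ∧ (z p).bodd = b}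

noncomputable def fphi (z : ℕ → ℕ) : Cantor := fun n => (z (Nat.nth (fun p => 2 ≤ z p) n)).bodd

theorem fH_inf {z : ℕ → ℕ} (hz : z ∈ fH) : (Set.ofPred fun p => 2 ≤ z p).Infinite := by
  refine Set.infinite_of_not_bddAbove ?_
  rintro ⟨M, hM⟩
  obtain ⟨p, hp, h⟩ := hz (M+1)
  have := hM (show p ∈ {p | 2 ≤ z p} from h)
  omega

theorem fphi_cont : ContinuousOn fphi fH := by
  classical
  rw [contOn_agr]
  intro z hz k
  have hi := fH_inf hz
  refine ⟨Nat.nth (fun p => 2 ≤ z p) k + 1, fun u _ hu i hik => ?_⟩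
  have hlt : Nat.nth (fun p => 2 ≤ z p) i < Nat.nth (fun p => 2 ≤ z p) k := Nat.nth_strictMono hi hik
  have hp : 2 ≤ z (Nat.nth (fun p => 2 ≤ z p) i) := Nat.nth_mem_of_infinite hi i
  have hc : Nat.count (fun p => 2 ≤ z p) (Nat.nth (fun p => 2 ≤ z p) i) = i := Nat.count_nth_of_infinite hi i
  unfold fphi
  generalize Nat.nth (fun p => 2 ≤ z p) i = q at *
  have e1 : u q = z q := (hu q (by omega)).symm
  have e2 : Nat.count (fun p => 2 ≤ u p) q = i := by
    rw [← hc]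
    refine (count_congr' (a := q) (fun i hi => ?_) q le_rfl)
    rw [hu i (by omega)]
  have e3 : Nat.nth (fun p => 2 ≤ u p) (Nat.count (fun p => 2 ≤ u p) q) = q := Nat.nth_count (p := fun p => 2 ≤ u p) (by rw [e1]; exact hp)
  rw [e2] at e3
  rw [e3, e1]

theorem fQ_fs (b : Bool) : Fs (fQ b) := by
  have : fQ b = ⋃ p, ({z : ℕ → ℕ | ∀ i, z ∈ {z : ℕ → ℕ | i ≥ p → z i < 2}} ∩ {z | (p = 0 ∨ 2 ≤ z (p-1)) ∧ (z p).bodd = b}) := by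
    ext z
    simp only [fQ, mem_iUnion, mem_inter_iff, mem_ofPred_eq]
  rw [this]
  refine Fs.iUnion fun p => Fs.inter (IsClosed.fs (IsClosed.forall fun i => ?_)) (IsClosed.fs ?_)
  · exact IsClosed.preimage (continuous_apply (A := fun _ : ℕ => ℕ) i) (isClosed_discrete {m : ℕ | i ≥ p → m < 2})
  · exact IsClosed.preimage (f := fun z : ℕ → ℕ => (z (p-1), z p)) (by fun_prop)
      (isClosed_discrete {q : ℕ × ℕ | (p = 0 ∨ 2 ≤ q.1) ∧ q.2.bodd = b})

theorem fQ_uniq {z : ℕ → ℕ} {p q : ℕ} (h1 : ∀ i ≥ p, z i < 2) (h2 : p = 0 ∨ 2 ≤ z (p-1))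
    (h3 : ∀ i ≥ q, z i < 2) (h4 : q = 0 ∨ 2 ≤ z (q-1)) : p = q := by
  rcases lt_trichotomy p q with h | h | h
  · have := h1 (q-1) (by omega)
    omega
  · exact h
  · have := h3 (p-1) (by omega)
    omega

theorem fH_iff (z : ℕ → ℕ) : z ∈ fH ↔ z ∉ fQ true ∧ z ∉ fQ false := by
  classical
  constructor
  · intro hz
    refine ⟨?_, ?_⟩ <;>
    · rintro ⟨p, hp, _⟩
      obtain ⟨q, hq, h⟩ := hz p
      have := hp q hq
      omega
  · rintro ⟨h1, h2⟩
    by_contra hc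
    have : ∃ n, ∀ p ≥ n, z p < 2 := by
      by_contra h
      push Not at h
      exact hc h
    have hs := Nat.find_spec this
    have hm : Nat.find this = 0 ∨ 2 ≤ z (Nat.find this - 1) := by
      by_contra h
      push Not at h
      have h3 := Nat.find_min this (m := Nat.find this - 1) (by omega)
      apply h3
      intro p hp
      rcases Nat.lt_or_ge p (Nat.find this) with h' | h'
      · have : p = Nat.find this - 1 := by omega
        rw [this]; exact h.2
      · exact hs p h'
    cases hb : (z (Nat.find this)).bodd
    · exact h2 ⟨_, hs, hm, hb⟩
    · exact h1 ⟨_, hs, hm, hb⟩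

theorem fQ_disj (z : ℕ → ℕ) (h : z ∈ fQ true) : z ∉ fQ false := by
  rintro ⟨p, h1, h2, h3⟩
  obtain ⟨q, h4, h5, h6⟩ := h
  have := fQ_uniq h1 h2 h4 h5
  subst this
  rw [h3] at h6; cases h6

theorem eT_phi {T : ℕ → Prop} (hT : (Set.ofPred T).Infinite) (x : Cantor) : eT T x ∈ fH ∧ fphi (eT T x) = x := by
  classical
  constructor
  · intro n
    obtain ⟨p, hp, h⟩ := hT.exists_gt n
    exact ⟨p, h.le, (eT_flag _ _ _).2 hp⟩
  · funext n
    unfold fphi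
    simp only [eT_flag]
    rw [eT_bodd]
    have : Nat.count T (Nat.nth (fun p => T p) n) = n := Nat.count_nth_of_infinite hT n
    rw [this]

theorem count_fin (S : Finset ℕ) (p : ℕ) [DecidablePred (fun i => i ∈ S)] : Nat.count (fun i => i ∈ S) p ≤ S.card := by
  rw [Nat.count_eq_card_filter_range]
  exact Finset.card_le_card fun i hi => (Finset.mem_filter.1 hi).2

theorem count_fin_eq (S : Finset ℕ) (p : ℕ) [DecidablePred (fun i => i ∈ S)] (h : ∀ i ∈ S, i < p) : Nat.count (fun i => i ∈ S) p = S.card := by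
  rw [Nat.count_eq_card_filter_range]
  congr 1
  ext i
  simp only [Finset.mem_filter, Finset.mem_range]
  exact ⟨fun h => h.2, fun h' => ⟨h i h', h'⟩⟩

theorem eT_fin (S : Finset ℕ) (x : Cantor) : eT (fun i => i ∈ S) x ∈ fQ (x S.card) := by
  classical
  have : ∃ p, (∀ i ∈ S, i < p) ∧ (p = 0 ∨ p - 1 ∈ S) := by
    rcases S.eq_empty_or_nonempty with rfl | h
    · exact ⟨0, by simp, Or.inl rfl⟩
    · exact ⟨S.max' h + 1, fun i hi => Nat.lt_succ_of_le (S.le_max' i hi), Or.inr (by simpa using S.max'_mem h)⟩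
  obtain ⟨p, hp, hp'⟩ := this
  refine ⟨p, fun i hi => ?_, ?_, ?_⟩
  · by_contra h
    push Not at h
    rw [eT_flag] at h
    have := hp i h
    omega
  · rw [eT_flag]; exact hp'
  · rw [eT_bodd]; congr 1; exact @count_fin_eq S p (fun a => Classical.propDecidable (a ∈ S)) hp

/-- separation step -/
theorem sep_step {r : (ℕ → ℕ) → Cantor} (hr : Continuous r) {X : Set Cantor}
    (h1 : ∀ z ∈ fQ true, r z ∈ X) (h0 : ∀ z ∈ fQ false, r z ∉ X) (S : Finset ℕ) :
    ∃ M, ∀ T : ℕ → Prop, (∀ i < M, (T i ↔ i ∈ S)) → ∀ x y, agr S.card x y → x S.card = true → y S.card = false →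
      r (eT T x) ≠ r (eT T y) := by
  classical
  obtain ⟨ω, hω⟩ : ∃ ω : (Fin S.card → Bool) → Bool → Cantor, ∀ w b i, ω w b i = if h : i < S.card then w ⟨i, h⟩ else b :=
    ⟨fun w b i => if h : i < S.card then w ⟨i, h⟩ else b, fun _ _ _ => rfl⟩
  have key : ∀ w, ∃ M, ∀ u u', agr M (eT (fun i => i ∈ S) (ω w true)) u → agr M (eT (fun i => i ∈ S) (ω w false)) u' → r u ≠ r u' := by
    intro w
    have e1 : r (eT (fun i => i ∈ S) (ω w true)) ∈ X := h1 _ (by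
      have := eT_fin S (ω w true); rw [hω] at this; simpa using this)
    have e0 : r (eT (fun i => i ∈ S) (ω w false)) ∉ X := h0 _ (by
      have := eT_fin S (ω w false); rw [hω] at this; simpa using this)
    have hne : r (eT (fun i => i ∈ S) (ω w true)) ≠ r (eT (fun i => i ∈ S) (ω w false)) := fun h => e0 (h ▸ e1)
    obtain ⟨k, hk⟩ := Function.ne_iff.1 hne
    obtain ⟨n, hn⟩ := cont_agr.1 hr (eT (fun i => i ∈ S) (ω w true)) (k+1)
    obtain ⟨n', hn'⟩ := cont_agr.1 hr (eT (fun i => i ∈ S) (ω w false)) (k+1)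
    refine ⟨max n n', fun u u' hu hu' he => hk ?_⟩
    rw [hn u (hu.mono (le_max_left _ _)) k (by omega), hn' u' (hu'.mono (le_max_right _ _)) k (by omega), he]
  choose M hM using key
  refine ⟨Finset.univ.sup M, fun T hT x y hxy hx hy => ?_⟩
  have main : ∀ (v : Cantor) (w : Fin S.card → Bool) (b : Bool), (∀ i : Fin S.card, v i = w i) → v S.card = b →
      agr (M w) (eT (fun i => i ∈ S) (ω w b)) (eT T v) := by
    intro v w b h1 h2 p hp
    have hpM : p < Finset.univ.sup M := lt_of_lt_of_le hp (Finset.le_sup (Finset.mem_univ w))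
    have hc : @Nat.count T (fun a => Classical.propDecidable (T a)) p = @Nat.count (fun i => i ∈ S) (fun a => Classical.propDecidable (a ∈ S)) p :=
      @count_congr' T (fun i => i ∈ S) (fun a => Classical.propDecidable (T a)) (fun a => Classical.propDecidable (a ∈ S)) _ hT p hpM.le
    unfold eT
    simp only [hT p hpM]
    rw [hc]
    congr 2
    have hle := @count_fin S p (fun a => Classical.propDecidable (a ∈ S))
    rw [hω]
    split_ifs with h
    · exact (h1 ⟨_, h⟩).symm
    · rw [← h2]; congr 1; exact le_antisymm (not_lt.1 h) hle
  exact hM (fun i => x i) _ _ (main x _ _ (fun _ => rfl) hx) (main y _ _ (fun i => (hxy i i.2).symm) hy)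

theorem sep_set {r : (ℕ → ℕ) → Cantor} (hr : Continuous r) {X : Set Cantor}
    (h1 : ∀ z ∈ fQ true, r z ∈ X) (h0 : ∀ z ∈ fQ false, r z ∉ X) :
    ∃ T : ℕ → Prop, (Set.ofPred T).Infinite ∧ Function.Injective (fun x => r (eT T x)) := by
  classical
  choose M hM using sep_step hr h1 h0
  obtain ⟨A, hA⟩ : ∃ A : Finset ℕ → ℕ, ∀ S, A S = max (M S) (S.sup id + 1) := ⟨_, fun _ => rfl⟩
  obtain ⟨S, S0, Ss⟩ : ∃ S : ℕ → Finset ℕ, S 0 = ∅ ∧ ∀ n, S (n+1) = insert (A (S n)) (S n) :=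
    ⟨fun n => Nat.rec ∅ (fun _ s => insert (A s) s) n, rfl, fun _ => rfl⟩
  have hlt : ∀ s : Finset ℕ, ∀ i ∈ s, i < A s := fun s i hi => by
    have : i ≤ s.sup id := Finset.le_sup (f := id) hi
    rw [hA]; exact lt_of_lt_of_le (Nat.lt_succ_of_le this) (le_max_right _ _)
  have hcard : ∀ n, (S n).card = n := by
    intro n
    induction n with
    | zero => rw [S0]; rfl
    | succ n ih =>
      rw [Ss, Finset.card_insert_of_notMem, ih]
      intro h
      exact lt_irrefl _ (hlt _ _ h)
  have hmono : StrictMono (fun n => A (S n)) := strictMono_nat_of_lt_succ fun n => by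
    apply hlt
    rw [Ss]; exact Finset.mem_insert_self _ _
  have hmem : ∀ n i, i ∈ S n ↔ ∃ m < n, i = A (S m) := by
    intro n i
    induction n with
    | zero => rw [S0]; simp
    | succ n ih =>
      rw [Ss, Finset.mem_insert, ih]
      constructor
      · rintro (h | ⟨m, h, h'⟩)
        · exact ⟨n, by omega, h⟩
        · exact ⟨m, by omega, h'⟩
      · rintro ⟨m, h, h'⟩
        rcases Nat.lt_succ_iff_lt_or_eq.1 h with h | h
        · exact Or.inr ⟨m, h, h'⟩
        · subst h; exact Or.inl h'
  refine ⟨fun i => ∃ m, i = A (S m), ?_, ?_⟩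
  · refine Set.infinite_of_injective_forall_mem hmono.injective fun n => ?_
    exact ⟨n, rfl⟩
  · have key : ∀ n x y, agr n x y → x n = true → y n = false →
        r (eT (fun i => ∃ m, i = A (S m)) x) ≠ r (eT (fun i => ∃ m, i = A (S m)) y) := by
      intro n x y hxy hx hy
      refine hM (S n) _ ?_ x y (by rw [hcard]; exact hxy) (by rw [hcard]; exact hx) (by rw [hcard]; exact hy)
      intro i hi
      rw [hmem]
      constructor
      · rintro ⟨m, hm⟩
        refine ⟨m, ?_, hm⟩
        by_contra hc
        push Not at hc
        have h1 : A (S n) ≤ A (S m) := hmono.monotone hc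
        have h2 : M (S n) ≤ A (S n) := by rw [hA]; exact le_max_left _ _
        omega
      · rintro ⟨m, _, hm⟩; exact ⟨m, hm⟩
    intro x y hxy
    by_contra hne
    have hex := Function.ne_iff.1 hne
    have hs := Nat.find_spec hex
    have hag : agr (Nat.find hex) x y := fun i hi => by
      by_contra h
      exact Nat.find_min hex hi h
    cases hxv : x (Nat.find hex) <;> cases hyv : y (Nat.find hex)
    · exact hs (by rw [hxv, hyv])
    · exact key _ y x hag.symm hyv hxv hxy.symm
    · exact key _ x y hag hxv hyv hxy
    · exact hs (by rw [hxv, hyv])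

theorem harr_star {X : Set Cantor} (hX : MeasurableSet X) (hd : Dense X) (hhom : IsHomogeneous X) (hdel : ¬ InDelta X)
    {V0 : Set Cantor} (hV : IsClopen V0) (hne : V0.Nonempty) :
    ∃ j : Cantor → Cantor, Continuous j ∧ Function.Injective j ∧ (∀ x, j x ∈ V0) ∧ ∀ x, (j x ∈ X ↔ x ∈ X) := by
  obtain ⟨s, hs⟩ := claimD hX hV hne
  obtain ⟨H, h, hH, hh, hHV, hHX⟩ := lav hd hhom s.clopen s.ne
  have hHX' : ∀ x, x ∈ X ↔ x ∈ H ∧ s.f (h x) ∈ s.B := by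
    intro x
    rw [hHX]
    exact and_congr_right fun hx => s.eqv _ (hHV x hx)
  have : ∃ y, ∀ m, y ∈ dP s.B m := by
    by_contra hc
    push Not at hc
    exact hdel (delta_of hH hh s.sig hHX' hc)
  obtain ⟨y0, hy0⟩ := this
  obtain ⟨Ψ, hΨ, hΨB⟩ := psi s.meas hy0
  obtain ⟨t1, ht1, ht1X⟩ := lemmaQ (H := H) (Q0 := ∅) (Q1 := Hᶜ) isClosed_empty.fs (fs_iff.2 (by rwa [compl_compl]))
    (fun z hz => absurd hz (notMem_empty _)) (fun z => by simp) hh s.sig hΨ hΨB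
  have ht1' : ∀ x, t1 x ∈ s.B ↔ x ∈ X := fun x => by
    rw [ht1X, hHX' x]; simp
  obtain ⟨t, ht, htX⟩ := lemmaQ (fQ_fs true) (fQ_fs false) fQ_disj fH_iff fphi_cont ht1 hΨ hΨB
  obtain ⟨r, hr, hrV, hrX⟩ := hs t ht
  have hr' : ∀ z, r z ∈ X ↔ z ∈ fQ true ∨ (z ∈ fH ∧ fphi z ∈ X) := fun z => by
    rw [hrX, htX, ht1']
  obtain ⟨T, hT, hinj⟩ := sep_set hr (X := X) (fun z hz => (hr' z).2 (Or.inl hz)) (fun z hz hc => by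
    rcases (hr' z).1 hc with h | h
    · exact fQ_disj z h hz
    · exact ((fH_iff z).1 h.1).2 hz)
  refine ⟨fun x => r (eT T x), hr.comp (eT_cont T), hinj, fun x => s.sub (hrV _), fun x => ?_⟩
  obtain ⟨a, b⟩ := eT_phi hT x
  rw [hr', b]
  constructor
  · rintro (h | h)
    · exact absurd h ((fH_iff _).1 a).1
    · exact h.2
  · intro h; exact Or.inr ⟨a, h⟩

theorem meagre_sub {X A : Set Cantor} (hd : Dense X) (hA : IsMeagre A) : IsMeagre (Subtype.val ⁻¹' A : Set X) := by
  rw [isMeagre_iff_countable_union_isNowhereDense] at hA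
  obtain ⟨S, hS, hSc, hAS⟩ := hA
  have h1 : (Subtype.val ⁻¹' A : Set X) ⊆ ⋃ t ∈ S, (Subtype.val ⁻¹' (closure t) : Set X) := by
    intro x hx
    obtain ⟨t, ht, hxt⟩ := hAS hx
    exact mem_iUnion₂.2 ⟨t, ht, subset_closure hxt⟩
  refine IsMeagre.mono h1 (isMeagre_biUnion hSc fun t ht => IsNowhereDense.isMeagre ?_)
  have hc : IsClosed (Subtype.val ⁻¹' (closure t) : Set X) := isClosed_closure.preimage continuous_subtype_val
  rw [hc.isNowhereDense_iff]
  by_contra hne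
  obtain ⟨x, hx⟩ := nonempty_iff_ne_empty.2 hne
  obtain ⟨W, hW, hWe⟩ := isOpen_induced_iff.1 (isOpen_interior (s := (Subtype.val ⁻¹' (closure t) : Set X)))
  have hxW : (x : Cantor) ∈ W := by
    have : x ∈ Subtype.val ⁻¹' W := by rw [hWe]; exact hx
    exact this
  have hWt : W ⊆ closure t := by
    intro z hz
    rw [← closure_closure, mem_closure_iff]
    intro O hO hzO
    obtain ⟨y, hy, hyX⟩ := hd.inter_open_nonempty (O ∩ W) (hO.inter hW) ⟨z, hzO, hz⟩
    refine ⟨y, hy.1, ?_⟩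
    have : (⟨y, hyX⟩ : X) ∈ Subtype.val ⁻¹' W := hy.2
    rw [hWe] at this
    have h5 := interior_subset (s := (Subtype.val ⁻¹' (closure t) : Set X)) this
    exact h5
  have := interior_maximal hWt hW hxW
  rw [hS t ht] at this
  exact this

theorem dich {X : Set Cantor} (hX : MeasurableSet X) (hd : Dense X) (hhom : IsHomogeneous X) :
    ∃ M : Set Cantor, (M = X ∨ M = Xᶜ) ∧ ∃ F : ℕ → Set Cantor, (∀ n, IsClosed (F n)) ∧ (∀ n, interior (F n) = ∅) ∧
      M ⊆ ⋃ n, F n := by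
  have h1 : IsMeagre X ∨ IsMeagre Xᶜ := by
    obtain ⟨u, hu, he⟩ := hX.baireMeasurableSet.residualEq_isOpen
    have hr : {z | z ∈ X ↔ z ∈ u} ∈ residual Cantor := by
      filter_upwards [he] with z hz
      exact iff_of_eq hz
    rcases u.eq_empty_or_nonempty with rfl | hun
    · left
      show Xᶜ ∈ residual _
      filter_upwards [hr] with z hz
      exact fun h => absurd (hz.1 h) (notMem_empty _)
    rcases (closure u)ᶜ.eq_empty_or_nonempty with hcu | hcu
    · right
      show Xᶜᶜ ∈ residual _
      have : Dense u := by
        rw [dense_iff_closure_eq, ← compl_empty_iff]; exact hcu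
      filter_upwards [hr, residual_of_dense_open hu this] with z hz hzu
      simpa using hz.2 hzu
    exfalso
    have m1 : IsMeagre (u \ X) := by
      show (u \ X)ᶜ ∈ residual _
      filter_upwards [hr] with z hz hzz
      exact hzz.2 (hz.2 hzz.1)
    have m2 : IsMeagre (X ∩ (closure u)ᶜ) := by
      show (X ∩ (closure u)ᶜ)ᶜ ∈ residual _
      filter_upwards [hr] with z hz hzz
      exact hzz.2 (subset_closure (hz.1 hzz.1))
    obtain ⟨x, hxu, hxX⟩ := hd.inter_open_nonempty u hu hun
    obtain ⟨y, hyu, hyX⟩ := hd.inter_open_nonempty _ isClosed_closure.isOpen_compl hcu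
    obtain ⟨g, hg⟩ := hhom ⟨x, hxX⟩ ⟨y, hyX⟩
    have m3 : IsMeagre (Subtype.val ⁻¹' (X ∩ (closure u)ᶜ) : Set X) := meagre_sub hd m2
    have m4 : IsMeagre (g ⁻¹' (Subtype.val ⁻¹' (X ∩ (closure u)ᶜ)) : Set X) :=
      m3.preimage_of_isOpenMap g.continuous g.isOpenMap
    have m5 := m4.image_val
    have hop : IsOpen {z : X | (g z : Cantor) ∈ (closure u)ᶜ} :=
      isClosed_closure.isOpen_compl.preimage (continuous_subtype_val.comp g.continuous)
    obtain ⟨W, hW, hWe⟩ := isOpen_induced_iff.1 hop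
    have hxW : x ∈ W := by
      have : (⟨x, hxX⟩ : X) ∈ Subtype.val ⁻¹' W := by
        rw [hWe]; show (g ⟨x, hxX⟩ : Cantor) ∈ (closure u)ᶜ; rw [hg]; exact hyu
      exact this
    refine not_isMeagre_of_isOpen (hW.inter hu) ⟨x, hxW, hxu⟩ ((m5.union m1).mono ?_)
    rintro z ⟨hzW, hzu⟩
    by_cases hzX : z ∈ X
    · left
      refine ⟨⟨z, hzX⟩, ?_, rfl⟩
      have : (⟨z, hzX⟩ : X) ∈ Subtype.val ⁻¹' W := hzW
      rw [hWe] at this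
      exact ⟨(g _).2, this⟩
    · right; exact ⟨hzu, hzX⟩
  have h2 : ∀ M : Set Cantor, IsMeagre M → ∃ F : ℕ → Set Cantor, (∀ n, IsClosed (F n)) ∧ (∀ n, interior (F n) = ∅) ∧
      M ⊆ ⋃ n, F n := by
    intro M hM
    obtain ⟨S, hS, hSc, hMS⟩ := isMeagre_iff_countable_union_isNowhereDense.1 hM
    obtain ⟨f, hf⟩ := (hSc.insert ∅).exists_eq_range ⟨∅, mem_insert _ _⟩
    have hf' : ∀ n, IsNowhereDense (f n) := fun n => by
      have : f n ∈ insert ∅ S := by rw [hf]; exact ⟨n, rfl⟩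
      rcases this with h | h
      · rw [h]; exact isNowhereDense_empty
      · exact hS _ h
    refine ⟨fun n => closure (f n), fun n => isClosed_closure, hf', fun z hz => ?_⟩
    obtain ⟨t, ht, hzt⟩ := hMS hz
    have : t ∈ range f := by rw [← hf]; exact Or.inr ht
    obtain ⟨n, rfl⟩ := this
    exact mem_iUnion.2 ⟨n, subset_closure hzt⟩
  rcases h1 with h | h
  · exact ⟨X, Or.inl rfl, h2 _ h⟩
  · exact ⟨_, Or.inr rfl, h2 _ h⟩

structure BSt where
  W : Set Cantor
  W' : Set Cantor
  k : ℕ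
  R : Set (Cantor × Cantor)

def BSt.sw (σ : BSt) : BSt := ⟨σ.W', σ.W, σ.k, Prod.swap ⁻¹' σ.R⟩

theorem BSt.sw_sw (σ : BSt) : σ.sw.sw = σ := rfl

structure BSt.Ok (X : Set Cantor) (A B : ℕ → Set Cantor) (σ : BSt) : Prop where
  c1 : IsClopen σ.W
  c2 : IsClopen σ.W'
  n1 : σ.W.Nonempty
  n2 : σ.W'.Nonempty
  s1 : ∀ p ∈ σ.R, p.1 ∈ σ.W
  s2 : ∀ p ∈ σ.R, p.2 ∈ σ.W'
  cl : IsClosed σ.R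
  i1 : ∀ p ∈ σ.R, ∀ q ∈ σ.R, p.1 = q.1 → p = q
  i2 : ∀ p ∈ σ.R, ∀ q ∈ σ.R, p.2 = q.2 → p = q
  pr : ∀ p ∈ σ.R, (p.1 ∈ X ↔ p.2 ∈ X)
  d1 : interior (Prod.fst '' σ.R) = ∅
  d2 : interior (Prod.snd '' σ.R) = ∅
  v1 : ∀ x ∈ A σ.k, x ∈ σ.W → ∃ p ∈ σ.R, p.1 = x
  v2 : ∀ y ∈ B σ.k, y ∈ σ.W' → ∃ p ∈ σ.R, p.2 = y

theorem sw_fst (R : Set (Cantor × Cantor)) : Prod.fst '' (Prod.swap ⁻¹' R) = Prod.snd '' R := by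
  ext y
  constructor
  · rintro ⟨p, hp, rfl⟩; exact ⟨_, hp, rfl⟩
  · rintro ⟨p, hp, rfl⟩; exact ⟨p.swap, hp, rfl⟩

theorem sw_snd (R : Set (Cantor × Cantor)) : Prod.snd '' (Prod.swap ⁻¹' R) = Prod.fst '' R := by
  ext y
  constructor
  · rintro ⟨p, hp, rfl⟩; exact ⟨_, hp, rfl⟩
  · rintro ⟨p, hp, rfl⟩; exact ⟨p.swap, hp, rfl⟩

theorem BSt.Ok.sw {X : Set Cantor} {A B : ℕ → Set Cantor} {σ : BSt} (h : σ.Ok X A B) : σ.sw.Ok X B A where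
  c1 := h.c2
  c2 := h.c1
  n1 := h.n2
  n2 := h.n1
  s1 := fun p hp => h.s2 p.swap hp
  s2 := fun p hp => h.s1 p.swap hp
  cl := h.cl.preimage continuous_swap
  i1 := fun p hp q hq e => Prod.swap_injective (h.i2 p.swap hp q.swap hq e)
  i2 := fun p hp q hq e => Prod.swap_injective (h.i1 p.swap hp q.swap hq e)
  pr := fun p hp => (h.pr p.swap hp).symm
  d1 := (congrArg interior (sw_fst _)).trans h.d2
  d2 := (congrArg interior (sw_snd _)).trans h.d1
  v1 := fun x hx hx' => by
    obtain ⟨p, hp, he⟩ := h.v2 x hx hx'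
    exact ⟨p.swap, hp, he⟩
  v2 := fun x hx hx' => by
    obtain ⟨p, hp, he⟩ := h.v1 x hx hx'
    exact ⟨p.swap, hp, he⟩

def BFresh (X : Set Cantor) (A B : ℕ → Set Cantor) : Prop :=
  ∀ k W W', IsClopen W → IsClopen W' → W.Nonempty → W'.Nonempty → ∃ R, (BSt.mk W W' k R).Ok X A B

theorem BFresh.sw {X : Set Cantor} {A B : ℕ → Set Cantor} (h : BFresh X A B) : BFresh X B A := by
  intro k W W' h1 h2 h3 h4
  obtain ⟨R, hR⟩ := h k W' W h2 h1 h4 h3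
  exact ⟨_, hR.sw⟩

def BTr (σ τ : BSt) : Prop :=
  (∀ p ∈ σ.R, (p.1 ∈ τ.W ↔ p.2 ∈ τ.W')) ∧
    ((τ.k = σ.k ∧ τ.R.Nonempty ∧ τ.R ⊆ σ.R) ∨ (τ.k = σ.k + 1 ∧ ∀ p ∈ σ.R, p.1 ∉ τ.W))

theorem BTr.sw {σ τ : BSt} (h : BTr σ τ) : BTr σ.sw τ.sw := by
  refine ⟨fun p hp => (h.1 p.swap hp).symm, ?_⟩
  rcases h.2 with ⟨h1, ⟨q, hq⟩, h3⟩ | ⟨h1, h2⟩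
  · exact Or.inl ⟨h1, ⟨q.swap, hq⟩, fun p hp => h3 hp⟩
  · exact Or.inr ⟨h1, fun p hp hc => h2 p.swap hp ((h.1 p.swap hp).2 hc)⟩

structure BCh (X : Set Cantor) (A B : ℕ → Set Cantor) (σ : BSt) (C : Set BSt) : Prop where
  ok : ∀ τ ∈ C, τ.Ok X A B
  s1 : ∀ τ ∈ C, τ.W ⊆ σ.W
  s2 : ∀ τ ∈ C, τ.W' ⊆ σ.W'
  tr : ∀ τ ∈ C, BTr σ τ
  v1 : ∀ x ∈ σ.W, ∃ τ ∈ C, x ∈ τ.W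
  v2 : ∀ x ∈ σ.W', ∃ τ ∈ C, x ∈ τ.W'
  u1 : ∀ τ ∈ C, ∀ τ' ∈ C, ∀ x, x ∈ τ.W → x ∈ τ'.W → τ = τ'
  u2 : ∀ τ ∈ C, ∀ τ' ∈ C, ∀ x, x ∈ τ.W' → x ∈ τ'.W' → τ = τ'

theorem BCh.sw {X : Set Cantor} {A B : ℕ → Set Cantor} {σ : BSt} {C : Set BSt} (h : BCh X A B σ C) :
    BCh X B A σ.sw (BSt.sw ⁻¹' C) where
  ok := fun τ hτ => (h.ok _ hτ).sw
  s1 := fun τ hτ => h.s2 _ hτ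
  s2 := fun τ hτ => h.s1 _ hτ
  tr := fun τ hτ => (h.tr _ hτ).sw
  v1 := fun x hx => by
    obtain ⟨τ, hτ, h⟩ := h.v2 x hx
    exact ⟨τ.sw, hτ, h⟩
  v2 := fun x hx => by
    obtain ⟨τ, hτ, h⟩ := h.v1 x hx
    exact ⟨τ.sw, hτ, h⟩
  u1 := fun τ hτ τ' hτ' x h1 h2 => congrArg BSt.sw (h.u2 _ hτ _ hτ' x h1 h2)
  u2 := fun τ hτ τ' hτ' x h1 h2 => congrArg BSt.sw (h.u1 _ hτ _ hτ' x h1 h2)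

theorem brefresh {X : Set Cantor} {A B : ℕ → Set Cantor} (hf : BFresh X A B) {σ : BSt} (h : σ.Ok X A B) :
    ∃ τ : BSt, τ.Ok X A B ∧ τ.W = σ.W ∧ τ.W' = σ.W' ∧
      ((τ.k = σ.k ∧ τ.R.Nonempty ∧ τ.R = σ.R) ∨ (τ.k = σ.k + 1 ∧ σ.R = ∅)) := by
  rcases σ.R.eq_empty_or_nonempty with h' | h'
  · obtain ⟨R, hR⟩ := hf (σ.k+1) σ.W σ.W' h.c1 h.c2 h.n1 h.n2
    exact ⟨_, hR, rfl, rfl, Or.inr ⟨rfl, h'⟩⟩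
  · exact ⟨σ, h, rfl, rfl, Or.inl ⟨rfl, h', rfl⟩⟩

theorem two_pts {O : Set Cantor} (hO : IsOpen O) (hne : O.Nonempty) : ∃ p ∈ O, ∃ q ∈ O, p ≠ q := by
  obtain ⟨z, hz⟩ := hne
  obtain ⟨n, hn⟩ := open_agr.1 hO z hz
  refine ⟨z, hz, Function.update z n (!z n), hn _ fun i hi => ?_, fun h => ?_⟩
  · rw [Function.update_of_ne (by omega)]
  · have := congrFun h n
    simp at this

theorem bsplit {X : Set Cantor} {A B : ℕ → Set Cantor} (hf : BFresh X A B) {σ : BSt} (h : σ.Ok X A B) (m : ℕ) :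
    ∃ C, BCh X A B σ C ∧ ∀ τ ∈ C, ∀ x ∈ τ.W, ∀ z ∈ τ.W, x m = z m := by
  obtain ⟨D, hD⟩ : ∃ D : Set Cantor, ∀ z, z ∈ D ↔ z m = true := ⟨{z | z m = true}, fun _ => Iff.rfl⟩
  have hDc : IsClopen D := by
    have : D = (fun z : Cantor => z m) ⁻¹' {true} := by ext z; rw [hD]; simp
    rw [this]
    exact (isClopen_discrete {true}).preimage (continuous_apply m)
  by_cases hsp : (σ.W ∩ D).Nonempty ∧ (σ.W \ D).Nonempty
  · obtain ⟨hs1, hs2⟩ := hsp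
    have hcl : IsClosed (Prod.snd '' σ.R) := (h.cl.isCompact.image continuous_snd).isClosed
    have hone : (σ.W' \ Prod.snd '' σ.R).Nonempty := by
      by_contra hc
      rw [not_nonempty_iff_eq_empty, sdiff_eq_empty] at hc
      have := interior_maximal hc h.c2.isOpen
      rw [h.d2] at this
      exact h.n2.not_subset_empty this
    obtain ⟨p0, hp0, p1, hp1, hpne⟩ := two_pts (h.c2.isOpen.sdiff hcl) hone
    have hcl0 : IsClosed (Prod.snd '' (σ.R ∩ Prod.fst ⁻¹' D)) :=
      ((h.cl.inter (hDc.isClosed.preimage continuous_fst)).isCompact.image continuous_snd).isClosed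
    have hcl1 : IsClosed (Prod.snd '' (σ.R ∩ Prod.fst ⁻¹' Dᶜ)) :=
      ((h.cl.inter (hDc.compl.isClosed.preimage continuous_fst)).isCompact.image continuous_snd).isClosed
    obtain ⟨E, hE, hE0, hE1⟩ : ∃ E : Set Cantor, IsClopen E ∧
        insert p0 (Prod.snd '' (σ.R ∩ Prod.fst ⁻¹' D)) ⊆ E ∧ E ⊆ (insert p1 (Prod.snd '' (σ.R ∩ Prod.fst ⁻¹' Dᶜ)))ᶜ := by
      refine exists_clopen_of_closed_subset_open (by rw [insert_eq]; exact isClosed_singleton.union hcl0)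
        (isOpen_compl_iff.2 (by rw [insert_eq]; exact isClosed_singleton.union hcl1))  ?_
      rintro y (rfl | ⟨p, ⟨hp, hpD⟩, rfl⟩) (hy | ⟨q, ⟨hq, hqD⟩, hy⟩)
      · exact hpne hy
      · exact hp0.2 ⟨q, hq, hy⟩
      · exact hp1.2 ⟨p, hp, hy⟩
      · have := h.i2 q hq p hp hy
        subst this
        exact hqD hpD
    have e0 : ∀ p ∈ σ.R, p.1 ∈ D → p.2 ∈ E := fun p hp hpD => hE0 (Or.inr ⟨p, ⟨hp, hpD⟩, rfl⟩)
    have e1 : ∀ p ∈ σ.R, p.1 ∉ D → p.2 ∉ E := fun p hp hpD hc => hE1 hc (Or.inr ⟨p, ⟨hp, hpD⟩, rfl⟩)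
    have gen : ∀ D' E' : Set Cantor, IsClopen D' → IsClopen E' → (σ.W ∩ D').Nonempty → (σ.W' ∩ E').Nonempty →
        (∀ p ∈ σ.R, (p.1 ∈ D' ↔ p.2 ∈ E')) → ∃ τ : BSt, τ.Ok X A B ∧ τ.W = σ.W ∩ D' ∧ τ.W' = σ.W' ∩ E' ∧ BTr σ τ := by
      intro D' E' hD' hE' hn1 hn2 hDE
      have hok : (BSt.mk (σ.W ∩ D') (σ.W' ∩ E') σ.k (σ.R ∩ Prod.fst ⁻¹' D')).Ok X A B :=
        { c1 := h.c1.inter hD'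
          c2 := h.c2.inter hE'
          n1 := hn1
          n2 := hn2
          s1 := fun p hp => ⟨h.s1 p hp.1, hp.2⟩
          s2 := fun p hp => ⟨h.s2 p hp.1, (hDE p hp.1).1 hp.2⟩
          cl := h.cl.inter (hD'.isClosed.preimage continuous_fst)
          i1 := fun p hp q hq => h.i1 p hp.1 q hq.1
          i2 := fun p hp q hq => h.i2 p hp.1 q hq.1
          pr := fun p hp => h.pr p hp.1
          d1 := subset_empty_iff.1 ((interior_mono (image_mono inter_subset_left)).trans h.d1.subset)
          d2 := subset_empty_iff.1 ((interior_mono (image_mono inter_subset_left)).trans h.d2.subset)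
          v1 := fun x hx hx' => by
            obtain ⟨p, hp, rfl⟩ := h.v1 x hx hx'.1
            exact ⟨p, ⟨hp, hx'.2⟩, rfl⟩
          v2 := fun x hx hx' => by
            obtain ⟨p, hp, rfl⟩ := h.v2 x hx hx'.1
            exact ⟨p, ⟨hp, (hDE p hp).2 hx'.2⟩, rfl⟩ }
      obtain ⟨τ, ht, w1, w2, h3⟩ := brefresh hf hok
      refine ⟨τ, ht, w1, w2, ?_, ?_⟩
      · intro p hp
        rw [w1, w2]
        simp only [mem_inter_iff, h.s1 p hp, h.s2 p hp, true_and]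
        exact hDE p hp
      · rcases h3 with ⟨a, b, c⟩ | ⟨a, b⟩
        · exact Or.inl ⟨a, b, c ▸ inter_subset_left⟩
        · refine Or.inr ⟨a, fun p hp hc => ?_⟩
          rw [w1] at hc
          have : p ∈ (∅ : Set (Cantor × Cantor)) := b ▸ (show p ∈ σ.R ∩ Prod.fst ⁻¹' D' from ⟨hp, hc.2⟩)
          exact this
    obtain ⟨τ0, ok0, w0, w0', tr0⟩ := gen D E hDc hE hs1 ⟨p0, hp0.1, hE0 (Or.inl rfl)⟩ fun p hp =>
      ⟨e0 p hp, fun hc => by by_contra h'; exact e1 p hp h' hc⟩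
    obtain ⟨τ1, ok1, w1, w1', tr1⟩ := gen Dᶜ Eᶜ hDc.compl hE.compl hs2 ⟨p1, hp1.1, fun hc => hE1 hc (Or.inl rfl)⟩ fun p hp =>
      ⟨e1 p hp, fun hc h' => hc (e0 p hp h')⟩
    refine ⟨{τ0, τ1}, ⟨?_, ?_, ?_, ?_, ?_, ?_, ?_, ?_⟩, ?_⟩
    · rintro τ (rfl | rfl) <;> assumption
    · rintro τ (rfl | rfl)
      · rw [w0]; exact inter_subset_left
      · rw [w1]; exact inter_subset_left
    · rintro τ (rfl | rfl)
      · rw [w0']; exact inter_subset_left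
      · rw [w1']; exact inter_subset_left
    · rintro τ (rfl | rfl) <;> assumption
    · intro x hx
      by_cases hxD : x ∈ D
      · exact ⟨τ0, Or.inl rfl, w0 ▸ ⟨hx, hxD⟩⟩
      · exact ⟨τ1, Or.inr rfl, w1 ▸ ⟨hx, hxD⟩⟩
    · intro x hx
      by_cases hxD : x ∈ E
      · exact ⟨τ0, Or.inl rfl, w0' ▸ ⟨hx, hxD⟩⟩
      · exact ⟨τ1, Or.inr rfl, w1' ▸ ⟨hx, hxD⟩⟩
    · rintro τ (rfl | rfl) τ' (rfl | rfl) x h1 h2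
      · rfl
      · rw [w0] at h1; rw [w1] at h2; exact absurd h1.2 h2.2
      · rw [w1] at h1; rw [w0] at h2; exact absurd h2.2 h1.2
      · rfl
    · rintro τ (rfl | rfl) τ' (rfl | rfl) x h1 h2
      · rfl
      · rw [w0'] at h1; rw [w1'] at h2; exact absurd h1.2 h2.2
      · rw [w1'] at h1; rw [w0'] at h2; exact absurd h2.2 h1.2
      · rfl
    · rintro τ (rfl | rfl) x hx z hz
      · rw [w0] at hx hz
        rw [(hD x).1 hx.2, (hD z).1 hz.2]
      · rw [w1] at hx hz
        have a : ¬ x m = true := fun h => hx.2 ((hD x).2 h)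
        have b : ¬ z m = true := fun h => hz.2 ((hD z).2 h)
        rw [Bool.not_eq_true] at a b
        rw [a, b]
  · obtain ⟨τ, ht, w1, w2, h3⟩ := brefresh hf h
    refine ⟨{τ}, ⟨?_, ?_, ?_, ?_, ?_, ?_, ?_, ?_⟩, ?_⟩
    · rintro _ rfl; exact ht
    · rintro _ rfl; exact w1.subset
    · rintro _ rfl; exact w2.subset
    · rintro _ rfl
      refine ⟨fun p hp => by rw [w1, w2]; exact iff_of_true (h.s1 p hp) (h.s2 p hp), ?_⟩
      rcases h3 with ⟨a, b, c⟩ | ⟨a, b⟩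
      · exact Or.inl ⟨a, b, c.subset⟩
      · refine Or.inr ⟨a, fun p hp => ?_⟩
        rw [b] at hp; exact absurd hp (notMem_empty _)
    · intro x hx; exact ⟨τ, rfl, w1 ▸ hx⟩
    · intro x hx; exact ⟨τ, rfl, w2 ▸ hx⟩
    · rintro _ rfl _ rfl _ _ _; rfl
    · rintro _ rfl _ rfl _ _ _; rfl
    · rintro _ rfl x hx z hz
      rw [w1] at hx hz
      by_contra hne
      apply hsp
      cases hxm : x m <;> cases hzm : z m
      · exact absurd (hxm.trans hzm.symm) hne
      · exact ⟨⟨z, hz, (hD _).2 hzm⟩, ⟨x, hx, fun h => by rw [hD, hxm] at h; cases h⟩⟩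
      · exact ⟨⟨x, hx, (hD _).2 hxm⟩, ⟨z, hz, fun h => by rw [hD, hzm] at h; cases h⟩⟩
      · exact absurd (hxm.trans hzm.symm) hne

theorem bstep {X : Set Cantor} {A B : ℕ → Set Cantor} (hf : BFresh X A B) {σ : BSt} (h : σ.Ok X A B) (n : ℕ) :
    ∃ C, BCh X A B σ C ∧ (Even n → ∀ τ ∈ C, ∀ x ∈ τ.W, ∀ z ∈ τ.W, x (n/2) = z (n/2)) ∧
      (¬ Even n → ∀ τ ∈ C, ∀ x ∈ τ.W', ∀ z ∈ τ.W', x (n/2) = z (n/2)) := by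
  by_cases hn : Even n
  · obtain ⟨C, h1, h2⟩ := bsplit hf h (n/2)
    exact ⟨C, h1, fun _ => h2, fun h => absurd hn h⟩
  · obtain ⟨C, h1, h2⟩ := bsplit hf.sw h.sw (n/2)
    refine ⟨_, h1.sw, fun h => absurd h hn, fun _ τ hτ x hx z hz => ?_⟩
    exact h2 _ hτ x hx z hz

theorem bfresh_aux {X : Set Cantor} (hst : ∀ V : Set Cantor, IsClopen V → V.Nonempty →
      ∃ j : Cantor → Cantor, Continuous j ∧ Function.Injective j ∧ (∀ x, j x ∈ V) ∧ ∀ x, (j x ∈ X ↔ x ∈ X))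
    {A B : ℕ → Set Cantor} {k : ℕ} (hA : IsClosed (A k)) (hA' : interior (A k) = ∅) (hB : B k = ∅)
    {W W' : Set Cantor} (h1 : IsClopen W) (h2 : IsClopen W') (h3 : W.Nonempty) (h4 : W'.Nonempty) :
    ∃ R, (BSt.mk W W' k R).Ok X A B := by
  obtain ⟨j, hj, hi, hV, hX⟩ := hst W' h2 h4
  have hfst : Prod.fst '' {p : Cantor × Cantor | p.1 ∈ A k ∩ W ∧ p.2 = j p.1} ⊆ A k := by
    rintro _ ⟨p, hp, rfl⟩; exact hp.1.1
  refine ⟨{p | p.1 ∈ A k ∩ W ∧ p.2 = j p.1}, ⟨h1, h2, h3, h4, fun p hp => hp.1.2, ?_, ?_, ?_, ?_, ?_, ?_, ?_, ?_, ?_⟩⟩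
  · intro p hp
    show p.2 ∈ W'
    rw [hp.2]; exact hV _
  · exact ((hA.inter h1.isClosed).preimage continuous_fst).inter (isClosed_eq continuous_snd (hj.comp continuous_fst))
  · intro p hp q hq e
    refine Prod.ext e ?_
    rw [hp.2, hq.2, e]
  · intro p hp q hq e
    have : p.1 = q.1 := hi (by rw [← hp.2, ← hq.2, e])
    exact Prod.ext this e
  · intro p hp
    rw [hp.2, hX]
  · exact subset_empty_iff.1 ((interior_mono hfst).trans hA'.subset)
  · by_contra hne
    obtain ⟨y, hy⟩ := nonempty_iff_ne_empty.2 hne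
    obtain ⟨p, hp, rfl⟩ := interior_subset hy
    have hsub : j ⁻¹' (interior (Prod.snd '' {p : Cantor × Cantor | p.1 ∈ A k ∩ W ∧ p.2 = j p.1})) ⊆ A k := by
      intro z hz
      obtain ⟨q, hq, hqz⟩ := interior_subset hz
      have : q.1 = z := hi (by rw [← hq.2, hqz])
      rw [← this]; exact hq.1.1
    have := interior_maximal hsub (isOpen_interior.preimage hj)
    rw [hA'] at this
    refine this (a := p.1) ?_
    rw [mem_preimage, ← hp.2]
    exact hy
  · intro x hx hxW
    exact ⟨(x, j x), ⟨⟨hx, hxW⟩, rfl⟩, rfl⟩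
  · intro y hy
    have : y ∈ B k := hy
    rw [hB] at this
    exact absurd this (notMem_empty _)

theorem bfinal {X : Set Cantor} {A B : ℕ → Set Cantor} (hf : BFresh X A B) {U : Set Cantor} (hU : IsClopen U)
    (hne : U.Nonempty) (hAB : ∀ x y, (∀ k, x ∉ A k) → (∀ k, y ∉ B k) → (x ∈ X ↔ y ∈ X)) :
    ∃ h : Cantor ≃ₜ U, ∀ x, ((h x : Cantor) ∈ X ↔ x ∈ X) := by
  classical
  obtain ⟨R0, hR0⟩ := hf 0 univ U isClopen_univ hU ⟨fun _ => true, trivial⟩ hne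
  have hst : ∀ (σ : BSt) (n : ℕ), ∃ C : Set BSt, σ.Ok X A B → (BCh X A B σ C ∧
      (Even n → ∀ τ ∈ C, ∀ x ∈ τ.W, ∀ z ∈ τ.W, x (n/2) = z (n/2)) ∧
      (¬ Even n → ∀ τ ∈ C, ∀ x ∈ τ.W', ∀ z ∈ τ.W', x (n/2) = z (n/2))) := by
    intro σ n
    by_cases h : σ.Ok X A B
    · obtain ⟨C, hC⟩ := bstep hf h n
      exact ⟨C, fun _ => hC⟩
    · exact ⟨∅, fun h' => absurd h' h⟩
  choose ch hch using hst
  obtain ⟨T, T0, Ts⟩ : ∃ T : ℕ → Set BSt, T 0 = {BSt.mk univ U 0 R0} ∧ ∀ n τ, τ ∈ T (n+1) ↔ ∃ σ ∈ T n, τ ∈ ch σ n :=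
    ⟨fun n => Nat.rec {BSt.mk univ U 0 R0} (fun n t => {τ | ∃ σ ∈ t, τ ∈ ch σ n}) n, rfl, fun _ _ => Iff.rfl⟩
  have hok : ∀ n, ∀ σ ∈ T n, σ.Ok X A B := by
    intro n
    induction n with
    | zero => intro σ hσ; rw [T0] at hσ; rw [hσ]; exact hR0
    | succ n ih =>
      intro τ hτ
      obtain ⟨σ, hσ, h⟩ := (Ts _ _).1 hτ
      exact (hch σ n (ih σ hσ)).1.ok τ h
  have hcov1 : ∀ n x, ∃ σ ∈ T n, x ∈ σ.W := by
    intro n x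
    induction n with
    | zero => exact ⟨BSt.mk univ U 0 R0, by rw [T0]; rfl, mem_univ x⟩
    | succ n ih =>
      obtain ⟨σ, hσ, hx⟩ := ih
      obtain ⟨τ, hτ, h⟩ := (hch σ n (hok n σ hσ)).1.v1 x hx
      exact ⟨τ, (Ts _ _).2 ⟨σ, hσ, hτ⟩, h⟩
  have hcov2 : ∀ n, ∀ y ∈ U, ∃ σ ∈ T n, y ∈ σ.W' := by
    intro n y hy
    induction n with
    | zero => exact ⟨_, by rw [T0]; rfl, hy⟩
    | succ n ih =>
      obtain ⟨σ, hσ, hx⟩ := ih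
      obtain ⟨τ, hτ, h⟩ := (hch σ n (hok n σ hσ)).1.v2 y hx
      exact ⟨τ, (Ts _ _).2 ⟨σ, hσ, hτ⟩, h⟩
  have hu1 : ∀ n, ∀ σ ∈ T n, ∀ τ ∈ T n, ∀ x, x ∈ σ.W → x ∈ τ.W → σ = τ := by
    intro n
    induction n with
    | zero => intro σ hσ τ hτ x _ _; rw [T0] at hσ hτ; rw [hσ, hτ]
    | succ n ih =>
      intro σ hσ τ hτ x h1 h2
      obtain ⟨σ', hσ', h3⟩ := (Ts _ _).1 hσ
      obtain ⟨τ', hτ', h4⟩ := (Ts _ _).1 hτ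
      have c1 := (hch σ' n (hok n σ' hσ')).1
      have c2 := (hch τ' n (hok n τ' hτ')).1
      have := ih σ' hσ' τ' hτ' x (c1.s1 _ h3 h1) (c2.s1 _ h4 h2)
      subst this
      exact c1.u1 _ h3 _ h4 x h1 h2
  have hu2 : ∀ n, ∀ σ ∈ T n, ∀ τ ∈ T n, ∀ x, x ∈ σ.W' → x ∈ τ.W' → σ = τ := by
    intro n
    induction n with
    | zero => intro σ hσ τ hτ x _ _; rw [T0] at hσ hτ; rw [hσ, hτ]
    | succ n ih =>
      intro σ hσ τ hτ x h1 h2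
      obtain ⟨σ', hσ', h3⟩ := (Ts _ _).1 hσ
      obtain ⟨τ', hτ', h4⟩ := (Ts _ _).1 hτ
      have c1 := (hch σ' n (hok n σ' hσ')).1
      have c2 := (hch τ' n (hok n τ' hτ')).1
      have := ih σ' hσ' τ' hτ' x (c1.s2 _ h3 h1) (c2.s2 _ h4 h2)
      subst this
      exact c1.u2 _ h3 _ h4 x h1 h2
  have hsubU : ∀ n, ∀ σ ∈ T n, σ.W' ⊆ U := by
    intro n
    induction n with
    | zero => intro σ hσ; rw [T0] at hσ; rw [hσ]
    | succ n ih =>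
      intro τ hτ
      obtain ⟨σ, hσ, h⟩ := (Ts _ _).1 hτ
      exact ((hch σ n (hok n σ hσ)).1.s2 τ h).trans (ih σ hσ)
  have hfine1 : ∀ m, ∀ τ ∈ T (2*m+1), ∀ x ∈ τ.W, ∀ z ∈ τ.W, x m = z m := by
    intro m τ hτ x hx z hz
    obtain ⟨σ, hσ, h⟩ := (Ts _ _).1 hτ
    have := (hch σ _ (hok _ σ hσ)).2.1 (even_two_mul m) τ h x hx z hz
    rwa [show 2 * m / 2 = m by omega] at this
  have hfine2 : ∀ m, ∀ τ ∈ T (2*m+2), ∀ x ∈ τ.W', ∀ z ∈ τ.W', x m = z m := by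
    intro m τ hτ x hx z hz
    obtain ⟨σ, hσ, h⟩ := (Ts _ _).1 hτ
    have := (hch σ _ (hok _ σ hσ)).2.2 (by simp [Nat.even_add_one]) τ h x hx z hz
    rwa [show (2 * m + 1) / 2 = m by omega] at this
  -- branch functions
  choose s hsT hsW using hcov1
  have hs_step : ∀ n x, s (n+1) x ∈ ch (s n x) n := by
    intro n x
    obtain ⟨σ, hσ, h⟩ := (Ts _ _).1 (hsT (n+1) x)
    have := hu1 n σ hσ _ (hsT n x) x ((hch σ n (hok n σ hσ)).1.s1 _ h (hsW _ _)) (hsW _ _)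
    rwa [← this]
  have hsch : ∀ n x, BCh X A B (s n x) (ch (s n x) n) := fun n x => (hch _ n (hok n _ (hsT n x))).1
  have ex1 : ∀ x, ∃ y, ∀ n, y ∈ (s n x).W' := by
    intro x
    have := IsCompact.nonempty_iInter_of_sequence_nonempty_isCompact_isClosed (fun n => (s n x).W')
      (fun n => (hsch n x).s2 _ (hs_step n x)) (fun n => (hok n _ (hsT n x)).n2)
      (hok 0 _ (hsT 0 x)).c2.isClosed.isCompact (fun n => (hok n _ (hsT n x)).c2.isClosed)
    obtain ⟨y, hy⟩ := this
    exact ⟨y, fun n => mem_iInter.1 hy n⟩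
  have ex2 : ∀ y ∈ U, ∃ x, ∀ n, y ∈ (s n x).W' := by
    intro y hy
    choose t htT htW using fun n => hcov2 n y hy
    have ht_step : ∀ n, (t (n+1)).W ⊆ (t n).W := by
      intro n
      obtain ⟨σ, hσ, h⟩ := (Ts _ _).1 (htT (n+1))
      have := hu2 n σ hσ _ (htT n) y ((hch σ n (hok n σ hσ)).1.s2 _ h (htW _)) (htW _)
      rw [← this]
      exact (hch σ n (hok n σ hσ)).1.s1 _ h
    have := IsCompact.nonempty_iInter_of_sequence_nonempty_isCompact_isClosed (fun n => (t n).W)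
      ht_step (fun n => (hok n _ (htT n)).n1)
      (hok 0 _ (htT 0)).c1.isClosed.isCompact (fun n => (hok n _ (htT n)).c1.isClosed)
    obtain ⟨x, hx⟩ := this
    refine ⟨x, fun n => ?_⟩
    rw [hu1 n _ (hsT n x) _ (htT n) x (hsW _ _) (mem_iInter.1 hx n)]
    exact htW n
  have un1 : ∀ x z, (∀ n, z ∈ (s n x).W) → z = x := by
    intro x z h
    funext m
    exact hfine1 m _ (hsT _ x) z (h _) x (hsW _ _)
  have un2 : ∀ x y y', (∀ n, y ∈ (s n x).W') → (∀ n, y' ∈ (s n x).W') → y = y' := by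
    intro x y y' h h'
    funext m
    exact hfine2 m _ (hsT _ x) y (h _) y' (h' _)
  choose f hfW using ex1
  have finj : Function.Injective f := by
    intro x z hxz
    symm
    refine un1 x z fun n => ?_
    rw [hu2 n _ (hsT n x) _ (hsT n z) (f x) (hfW x n) (by rw [hxz]; exact hfW z n)]
    exact hsW n z
  have fcont : Continuous f := by
    refine continuous_pi fun m => continuous_iff_continuousAt.2 fun x => ?_
    have : (fun z => f z m) =ᶠ[nhds x] fun _ => f x m := by
      filter_upwards [(hok _ _ (hsT (2*m+2) x)).c1.isOpen.mem_nhds (hsW _ _)] with z hz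
      refine hfine2 m _ (hsT _ x) _ ?_ _ (hfW x _)
      rw [hu1 _ _ (hsT (2*m+2) x) _ (hsT _ z) z hz (hsW _ _)]
      exact hfW z _
    exact continuousAt_const.congr this.symm
  have fU : ∀ x, f x ∈ U := fun x => hsubU 0 _ (hsT 0 x) (hfW x 0)
  have hbij : Function.Bijective (fun x => (⟨f x, fU x⟩ : U)) := by
    refine ⟨fun x z h => finj (congrArg Subtype.val h), fun y => ?_⟩
    obtain ⟨x, hx⟩ := ex2 y.1 y.2
    exact ⟨x, Subtype.ext (un2 x _ _ (hfW x) hx)⟩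
  have hc : Continuous (Equiv.ofBijective _ hbij) := fcont.subtype_mk fU
  refine ⟨hc.homeoOfEquivCompactToT2, fun x => ?_⟩
  show f x ∈ X ↔ x ∈ X
  -- along the branch of x
  have htr : ∀ n, BTr (s n x) (s (n+1) x) := fun n => (hsch n x).tr _ (hs_step n x)
  by_cases hcase : ∃ N, ∀ n ≥ N, (s (n+1) x).k = (s n x).k
  · obtain ⟨N, hN⟩ := hcase
    have hA : ∀ n ≥ N, (s (n+1) x).R.Nonempty ∧ (s (n+1) x).R ⊆ (s n x).R := by
      intro n hn
      rcases (htr n).2 with h | h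
      · exact h.2
      · have := hN n hn; omega
    have := IsCompact.nonempty_iInter_of_sequence_nonempty_isCompact_isClosed (fun n => (s (N+1+n) x).R)
      (fun n => (hA (N+1+n) (by omega)).2) (fun n => by
        have := (hA (N+n) (by omega)).1
        rwa [show N + n + 1 = N+1+n by omega] at this)
      (hok _ _ (hsT _ x)).cl.isCompact (fun n => (hok _ _ (hsT _ x)).cl)
    obtain ⟨p, hp⟩ := this
    rw [mem_iInter] at hp
    have anti1 : ∀ i j, i ≤ j → (s j x).W ⊆ (s i x).W := fun i j hij =>
      antitone_nat_of_succ_le (f := fun n => (s n x).W) (fun n => (hsch n x).s1 _ (hs_step n x)) hij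
    have anti2 : ∀ i j, i ≤ j → (s j x).W' ⊆ (s i x).W' := fun i j hij =>
      antitone_nat_of_succ_le (f := fun n => (s n x).W') (fun n => (hsch n x).s2 _ (hs_step n x)) hij
    have e1 : p.1 = x := un1 x _ fun n => anti1 n (N+1+n) (by omega) ((hok _ _ (hsT _ x)).s1 p (hp n))
    have e2 : p.2 = f x := un2 x _ _ (fun n => anti2 n (N+1+n) (by omega) ((hok _ _ (hsT _ x)).s2 p (hp n))) (hfW x)
    have := (hok _ _ (hsT _ x)).pr p (hp 0)
    rw [e1, e2] at this
    exact this.symm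
  · push Not at hcase
    have hinc : ∀ K, ∃ n, (s n x).k = K ∧ (s (n+1) x).k = K + 1 := by
      have step : ∀ n, ∃ n', (s n' x).k = (s n x).k ∧ (s (n'+1) x).k = (s n x).k + 1 := by
        intro n
        have hex : ∃ i, (s (n+i+1) x).k ≠ (s (n+i) x).k := by
          obtain ⟨q, hq, h⟩ := hcase n
          exact ⟨q - n, by rwa [show n + (q - n) = q by omega]⟩
        have hlow : ∀ i ≤ Nat.find hex, (s (n+i) x).k = (s n x).k := by
          intro i
          induction i with
          | zero => intro _; rfl
          | succ i ih =>
            intro hi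
            rw [← ih (by omega)]
            have := Nat.find_min hex (m := i) (by omega)
            push Not at this
            exact this
        refine ⟨n + Nat.find hex, hlow _ le_rfl, ?_⟩
        rw [← hlow _ le_rfl]
        rcases (htr (n + Nat.find hex)).2 with h | h
        · exact absurd h.1 (Nat.find_spec hex)
        · exact h.1
      intro K
      induction K with
      | zero =>
        obtain ⟨n, h⟩ := step 0
        have : (s 0 x).k = 0 := by
          have := hsT 0 x
          rw [T0] at this
          rw [this]
        rw [this] at h
        exact ⟨n, h⟩
      | succ K ih =>
        obtain ⟨n, _, h⟩ := ih
        obtain ⟨n', h'⟩ := step (n+1)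
        rw [h] at h'
        exact ⟨n', h'⟩
    have hR : ∀ K, ∃ n, (s n x).k = K ∧ ∀ p ∈ (s n x).R, p.1 ∉ (s (n+1) x).W := by
      intro K
      obtain ⟨n, h1, h2⟩ := hinc K
      refine ⟨n, h1, ?_⟩
      rcases (htr n).2 with h | h
      · omega
      · exact h.2
    refine (hAB x (f x) (fun K hK => ?_) (fun K hK => ?_)).symm
    · obtain ⟨n, h1, h2⟩ := hR K
      obtain ⟨p, hp, he⟩ := (hok n _ (hsT n x)).v1 x (by rw [h1]; exact hK) (hsW n x)
      exact h2 p hp (by rw [he]; exact hsW _ _)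
    · obtain ⟨n, h1, h2⟩ := hR K
      obtain ⟨p, hp, he⟩ := (hok n _ (hsT n x)).v2 (f x) (by rw [h1]; exact hK) (hfW x n)
      exact h2 p hp (((htr n).1 p hp).2 (by rw [he]; exact hfW _ _))

theorem hhomogeneously_embedded (X : Set Cantor)
    (hB : @MeasurableSet Cantor (borel Cantor) X) (hd : Dense X)
    (hhom : IsHomogeneous X) (hdel : ¬ InDelta X) :
    ∀ U : Set Cantor, IsClopen U → U.Nonempty →
      ∃ h : Cantor ≃ₜ U, (fun x => (h x : Cantor)) '' X = U ∩ X := by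
  intro U hU hne
  have hX : MeasurableSet X := by
    rw [← BorelSpace.measurable_eq (α := Cantor)] at hB
    exact hB
  obtain ⟨M, hM, F, hF, hFi, hMF⟩ := dich hX hd hhom
  obtain ⟨A, hA⟩ : ∃ A : ℕ → Set Cantor, ∀ k, A k = if Even k then F (k/2) else ∅ := ⟨_, fun _ => rfl⟩
  obtain ⟨B, hB'⟩ : ∃ B : ℕ → Set Cantor, ∀ k, B k = if Even k then ∅ else F (k/2) := ⟨_, fun _ => rfl⟩
  have hst : ∀ V : Set Cantor, IsClopen V → V.Nonempty →
      ∃ j : Cantor → Cantor, Continuous j ∧ Function.Injective j ∧ (∀ x, j x ∈ V) ∧ ∀ x, (j x ∈ X ↔ x ∈ X) :=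
    fun V h1 h2 => harr_star hX hd hhom hdel h1 h2
  have hf : BFresh X A B := by
    intro k W W' h1 h2 h3 h4
    by_cases hk : Even k
    · exact bfresh_aux hst (by rw [hA, if_pos hk]; exact hF _) (by rw [hA, if_pos hk]; exact hFi _)
        (by rw [hB', if_pos hk]) h1 h2 h3 h4
    · obtain ⟨R, hR⟩ := bfresh_aux (A := B) (B := A) (k := k) hst (by rw [hB', if_neg hk]; exact hF _) (by rw [hB', if_neg hk]; exact hFi _)
        (by rw [hA, if_neg hk]) h2 h1 h4 h3
      exact ⟨_, hR.sw⟩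
  obtain ⟨h, hh⟩ := bfinal hf hU hne (by
    intro x y hx hy
    have hx' : x ∉ M := fun hc => by
      obtain ⟨n, hn⟩ := mem_iUnion.1 (hMF hc)
      refine hx (2*n) ?_
      rw [hA, if_pos (even_two_mul n), show 2*n/2 = n by omega]; exact hn
    have hy' : y ∉ M := fun hc => by
      obtain ⟨n, hn⟩ := mem_iUnion.1 (hMF hc)
      refine hy (2*n+1) ?_
      rw [hB', if_neg (by simp [Nat.even_add_one]), show (2*n+1)/2 = n by omega]; exact hn
    rcases hM with rfl | rfl
    · exact iff_of_false hx' hy'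
    · rw [notMem_compl_iff] at hx' hy'
      exact iff_of_true hx' hy')
  refine ⟨h, ?_⟩
  ext y
  constructor
  · rintro ⟨x, hx, rfl⟩
    exact ⟨(h x).2, (hh x).2 hx⟩
  · rintro ⟨hyU, hyX⟩
    refine ⟨h.symm ⟨y, hyU⟩, ?_, by simp⟩
    rw [← hh]; simpa using hyX
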